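/- (a) For every deterministic Turing machine M recognizing a language L with space function S(n), there exists a nondeterministic Turing machine M' such that: (1) M' recognizes L; (2) M' is symmetric (its command set is closed under taking inverse commands); (3) both the space function and the generalized space function of M' are equivalent to S(n); (4) every command [V_1→V'_1,…,V_k→V'_k] of M' satisfies Σ|V_i|_a + Σ|V'_i|_a ≤ 1, i.e., involves at most one tape letter. (b) The same holds for every nondeterministic Turing machine M recognizing L with a fully space-constructible space function f(n), with 'equivalent to S(n)' replaced by 'equivalent to f(n)^2' in (3). -/

import Mathlib

namespace Olsh

noncomputable section

attribute [local instance] Classical.propDecidable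

/-! ## Words over a group alphabet, elementary transformations, presentations -/

/-- A group word over the alphabet `A`: a letter `(a, true)` stands for `a`,
and `(a, false)` stands for `a⁻¹`. -/
abbrev Word (A : Type) := List (A × Bool)

/-- The formal inverse of a group word. -/
def wInv {A : Type} (w : Word A) : Word A := (w.map (fun p => (p.1, !p.2))).reverse

/-- The positive group word spelled by a list of letters. -/
def posWord {A : Type} (l : List A) : Word A := l.map (fun a => (a, true))

/-- `y` is a cyclic permutation (cyclic shift) of `x`. -/
def IsCyclicShift {A : Type} (x y : Word A) : Prop := ∃ a b : Word A, x = a ++ b ∧ y = b ++ a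

/-- A word is (freely) reduced. -/
def ReducedW {A : Type} (w : Word A) : Prop :=
  List.Chain' (fun p q : A × Bool => ¬(p.1 = q.1 ∧ p.2 = !q.2)) w

/-- A word is cyclically reduced. -/
def CyclicallyReduced {A : Type} (w : Word A) : Prop :=
  ReducedW w ∧ ∀ h ∈ w.head?, ∀ l ∈ w.getLast?, ¬((l : A × Bool).1 = h.1 ∧ (l : A × Bool).2 = !h.2)

/-- Elementary `R`-transformations on finite sequences (tuples) of group words:
free reduction/insertion, deletion/insertion of a relator `r^{±1}` (`r ∈ R`),
cyclic permutation of one word, splitting a word `uv` into the pair `u, v`,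
and deletion of an empty word. -/
inductive ElemTrans {A : Type} (R : Set (Word A)) : List (Word A) → List (Word A) → Prop
  | freeDel (pre post : List (Word A)) (x y : Word A) (a : A × Bool) :
      ElemTrans R (pre ++ [x ++ [a, (a.1, !a.2)] ++ y] ++ post) (pre ++ [x ++ y] ++ post)
  | freeIns (pre post : List (Word A)) (x y : Word A) (a : A × Bool) :
      ElemTrans R (pre ++ [x ++ y] ++ post) (pre ++ [x ++ [a, (a.1, !a.2)] ++ y] ++ post)
  | relDel (pre post : List (Word A)) (x y r s : Word A)
      (hr : r ∈ R) (hs : s = r ∨ s = wInv r) :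
      ElemTrans R (pre ++ [x ++ s ++ y] ++ post) (pre ++ [x ++ y] ++ post)
  | relIns (pre post : List (Word A)) (x y r s : Word A)
      (hr : r ∈ R) (hs : s = r ∨ s = wInv r) :
      ElemTrans R (pre ++ [x ++ y] ++ post) (pre ++ [x ++ s ++ y] ++ post)
  | cyclic (pre post : List (Word A)) (u v : Word A) :
      ElemTrans R (pre ++ [u ++ v] ++ post) (pre ++ [v ++ u] ++ post)
  | split (pre post : List (Word A)) (u v : Word A) :
      ElemTrans R (pre ++ [u ++ v] ++ post) (pre ++ [u, v] ++ post)
  | delEmpty (pre post : List (Word A)) :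
      ElemTrans R (pre ++ [([] : Word A)] ++ post) (pre ++ post)

/-- `‖W‖` for a tuple of words: the sum of the (combinatorial) lengths. -/
def seqNorm {A : Type} (Ws : List (Word A)) : ℕ := (Ws.map List.length).sum

/-- There is a rewriting `(w) → ⋯ → ()` by elementary `R`-transformations whose
space (the maximum of `‖W_j‖` over the steps) is at most `m`. -/
def RewriteLe {A : Type} (R : Set (Word A)) (w : Word A) (m : ℕ) : Prop :=
  ∃ Ls : List (List (Word A)), Ls.head? = some [w] ∧ Ls.getLast? = some [] ∧
    Ls.Chain' (ElemTrans R) ∧ ∀ Wt ∈ Ls, seqNorm Wt ≤ m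

/-- The word `w` represents the identity of the group presented by `⟨A ∣ R⟩`. -/
def RepOne {A : Type} (R : Set (Word A)) (w : Word A) : Prop :=
  FreeGroup.mk w ∈ Subgroup.normalClosure (FreeGroup.mk '' R)

/-- The group presented by `⟨A ∣ R⟩`, where `R` is a set of group words. -/
abbrev presGroup {A : Type} (R : Set (Word A)) : Type := PresentedGroup (FreeGroup.mk '' R)

/-- `space_G(w)`: the minimal space of a rewriting from `(w)` to the empty tuple. -/
def presSpaceOf {A : Type} (R : Set (Word A)) (w : Word A) : ℕ := sInf {m | RewriteLe R w m}

/-- The space function of the presentation `⟨A ∣ R⟩`: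
`S_G(n) = max { space_G(w) : w = 1 in G, ‖w‖ ≤ n }` (implemented as the least
uniform space bound for all such words). -/
def presSpace {A : Type} (R : Set (Word A)) (n : ℕ) : ℕ :=
  sInf {m | ∀ w : Word A, RepOne R w → w.length ≤ n → RewriteLe R w m}

/-- `f ≼ g` : there is `c > 0` with `f(n) ≤ c g(c n) + c n` for all `n`. -/
def DomBy (f g : ℕ → ℕ) : Prop := ∃ c : ℕ, 0 < c ∧ ∀ n, f n ≤ c * g (c * n) + c * n

/-- Equivalence of nondecreasing functions: `f ≼ g` and `g ≼ f`. -/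
def FEquiv (f g : ℕ → ℕ) : Prop := DomBy f g ∧ DomBy g f

end

end Olsh
namespace Olsh

noncomputable section

attribute [local instance] Classical.propDecidable

/-! ## Multi-tape (nondeterministic) Turing machines -/

/-- One tape's part of a command of a multi-tape Turing machine: it replaces a
subword `u q v` around the head by `u' q' v'`; `lAnch`/`rAnch` indicate that the
pattern is anchored at the left (`α`) resp. right (`ω`) end of the tape. -/
structure CmdPart (Q Y : Type) where
  q : Q
  q' : Q
  u : List Y
  v : List Y
  u' : List Y
  v' : List Y
  lAnch : Bool
  rAnch : Bool

/-- The inverse command part. -/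
def CmdPart.inv {Q Y : Type} (p : CmdPart Q Y) : CmdPart Q Y :=
  ⟨p.q', p.q, p.u', p.v', p.u, p.v, p.lAnch, p.rAnch⟩

/-- Execution of one command part on one tape.  A tape configuration is
`(a, s, b)` : the word `a` to the left of the head, the head state `s`,
and the word `b` to the right of the head. -/
def CmdPart.Applies {Q Y : Type} (p : CmdPart Q Y)
    (c c' : List Y × Q × List Y) : Prop :=
  c.2.1 = p.q ∧ c'.2.1 = p.q' ∧
    ∃ a₀ b₀ : List Y,
      (p.lAnch = true → a₀ = []) ∧ (p.rAnch = true → b₀ = []) ∧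
      c.1 = a₀ ++ p.u ∧ c'.1 = a₀ ++ p.u' ∧
      c.2.2 = p.v ++ b₀ ∧ c'.2.2 = p.v' ++ b₀

/-- A (nondeterministic, multi-tape) Turing machine with tapes indexed by the
finite type `T` and input alphabet `X` (a subalphabet of the alphabet of the
distinguished input tape). -/
structure TM (T : Type) (X : Type) where
  finT : Fintype T
  Q : T → Type
  Y : T → Type
  finQ : ∀ i, Finite (Q i)
  finY : ∀ i, Finite (Y i)
  finX : Finite X
  inputTape : T
  emb : X → Y inputTape
  ι : Type
  finι : Finite ι
  cmds : ι → ∀ i : T, CmdPart (Q i) (Y i)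
  startQ : ∀ i, Q i
  acceptQ : ∀ i, Q i

namespace TM

variable {T X : Type} (M : TM T X)

/-- Configurations of the machine: for every tape, the word to the left of the
head, the head state, and the word to the right of the head. -/
def Conf : Type := ∀ i : T, List (M.Y i) × M.Q i × List (M.Y i)

/-- Transition by the command named `t`. -/
def StepVia (t : M.ι) (c c' : M.Conf) : Prop := ∀ i, (M.cmds t i).Applies (c i) (c' i)

/-- The (nondeterministic) transition relation of the machine. -/
def Step (c c' : M.Conf) : Prop := ∃ t : M.ι, M.StepVia t c c'

/-- The command `t` is applicable to the configuration `c`. -/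
def CmdApplicable (t : M.ι) (c : M.Conf) : Prop := ∃ c', M.StepVia t c c'

/-- `|c|_a`: the number of tape letters (tape squares) of a configuration. -/
def cSpace (c : M.Conf) : ℕ :=
  (@Finset.univ T M.finT).sum (fun i => (c i).1.length + (c i).2.2.length)

/-- The input configuration on the input word `u`: `u` is written on the input
tape with the head at its right end, all other tapes are empty and all heads are
in the start states. -/
def inputConf (u : List X) : M.Conf :=
  @Function.update T (fun i => List (M.Y i) × M.Q i × List (M.Y i)) (Classical.decEq T)
    (fun i => ([], M.startQ i, [])) M.inputTape (u.map M.emb, M.startQ M.inputTape, [])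

/-- The accept configuration: all tapes empty, all heads in the accept states. -/
def acceptConf : M.Conf := fun i => ([], M.acceptQ i, [])

/-- There is an accepting computation starting at `c` of space at most `s`. -/
def AcceptsWithin (c : M.Conf) (s : ℕ) : Prop :=
  ∃ cs : List M.Conf, cs.head? = some c ∧ cs.getLast? = some M.acceptConf ∧
    cs.Chain' M.Step ∧ ∀ d ∈ cs, M.cSpace d ≤ s

/-- The configuration `c` is accepted. -/
def AcceptsConf (c : M.Conf) : Prop := ∃ s, M.AcceptsWithin c s

/-- `space_M(c)`: the minimal space of an accepting computation from `c`. -/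
def minSpace (c : M.Conf) : ℕ := sInf {s | M.AcceptsWithin c s}

/-- The language recognized by the machine. -/
def lang : Set (List X) := {u | M.AcceptsConf (M.inputConf u)}

/-- The space function `S_M(n)` of the machine: the maximum of `space_M(u)` over
accepted input words `u` of length at most `n` (implemented as the least uniform
space bound). -/
def spaceFun (n : ℕ) : ℕ :=
  sInf {s | ∀ u : List X, u.length ≤ n → M.AcceptsConf (M.inputConf u) →
    M.AcceptsWithin (M.inputConf u) s}

/-- The generalized space function `S'_M(n)`: as `S_M`, but over all accepted
configurations with at most `n` tape letters. -/
def genSpaceFun (n : ℕ) : ℕ :=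
  sInf {s | ∀ c : M.Conf, M.cSpace c ≤ n → M.AcceptsConf c → M.AcceptsWithin c s}

/-- The machine is deterministic. -/
def Deterministic : Prop := ∀ c c₁ c₂ : M.Conf, M.Step c c₁ → M.Step c c₂ → c₁ = c₂

/-- The computation starting at `c` halts. -/
def Halts (c : M.Conf) : Prop :=
  ∃ d, Relation.ReflTransGen M.Step c d ∧ ∀ e, ¬ M.Step d e

/-- `M` is a deterministic machine deciding the language `Lset`: it is
deterministic, halts on every input and accepts exactly the words of `Lset`. -/
def DecidesLang (Lset : Set (List X)) : Prop :=
  M.Deterministic ∧ M.lang = Lset ∧ ∀ u : List X, M.Halts (M.inputConf u)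

/-- The set of commands is closed under taking inverse commands. -/
def SymmetricTM : Prop := ∀ t : M.ι, ∃ t' : M.ι, ∀ i, M.cmds t' i = (M.cmds t i).inv

/-- The total number of tape letters involved in the command `t`. -/
def cmdLetters (t : M.ι) : ℕ :=
  (@Finset.univ T M.finT).sum (fun i =>
    (M.cmds t i).u.length + (M.cmds t i).v.length +
    (M.cmds t i).u'.length + (M.cmds t i).v'.length)

/-- A computation from `c` to `d` with history `h` all whose configurations
satisfy `P`. -/
inductive TracedIn (P : M.Conf → Prop) : M.Conf → List M.ι → M.Conf → Prop
  | nil (c : M.Conf) : P c → TracedIn P c [] c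
  | cons {c c' d : M.Conf} (t : M.ι) {h : List M.ι} :
      P c → M.StepVia t c c' → TracedIn P c' h d → TracedIn P c (t :: h) d

/-- A (finite, halting or not) run from `c` to `d` along the list `cs`. -/
def RunTo (c d : M.Conf) (cs : List M.Conf) : Prop :=
  cs.head? = some c ∧ cs.getLast? = some d ∧ cs.Chain' M.Step

/-- The `s⃗₁₀`-condition: only input configurations involve start state letters,
at most one command is applicable to an input configuration, and there is a
unique accepting command (into the unique accept configuration). -/
def S10 : Prop :=
  (∀ c : M.Conf, (∃ i, (c i).2.1 = M.startQ i) → ∃ u : List X, c = M.inputConf u) ∧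
  (∀ (u : List X) (t t' : M.ι), M.CmdApplicable t (M.inputConf u) →
      M.CmdApplicable t' (M.inputConf u) → t = t') ∧
  (∀ (t t' : M.ι), (∃ c, M.StepVia t c M.acceptConf) →
      (∃ c, M.StepVia t' c M.acceptConf) → t = t')

end TM

/-- `f` is fully space-constructible: a two-tape deterministic Turing machine
halts on every input of length `n` having used exactly `f(n)` squares of its
work tape. -/
def FSC (f : ℕ → ℕ) : Prop :=
  ∃ (X : Type) (M : TM Bool X), Nonempty X ∧ M.Deterministic ∧ M.inputTape = false ∧
    ∀ u : List X, ∃ (cs : List M.Conf) (d : M.Conf),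
      M.RunTo (M.inputConf u) d cs ∧ (∀ e, ¬ M.Step d e) ∧
      (∀ c ∈ cs, (c true).1.length + (c true).2.2.length ≤ f u.length) ∧
      (∃ c ∈ cs, (c true).1.length + (c true).2.2.length = f u.length)

/-- Decode a list of bits into a natural number. -/
def bitsToNat (l : List Bool) : ℕ := l.foldr (fun b n => 2 * n + (if b then 1 else 0)) 0

/-- The real `α` is computable with space `≤ f(m)`: a deterministic Turing
machine, given `m` (in binary), halts having written (on a fixed output tape,
via a fixed decoding of its alphabet) a binary rational `α_m` (with denominator
`2^m`) with `|α − α_m| = O(2^{-m})`, the computation using space at most `f(m)`. -/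
def ComputableWithSpace (α : ℝ) (f : ℕ → ℕ) : Prop :=
  ∃ (T : Type) (M : TM T Bool) (τ : T) (dec : M.Y τ → Bool) (C : ℝ),
    M.Deterministic ∧ 0 < C ∧
    ∀ m : ℕ, ∃ (cs : List M.Conf) (d : M.Conf),
      M.RunTo (M.inputConf (Nat.bits m)) d cs ∧ (∀ e, ¬ M.Step d e) ∧
      (∀ c ∈ cs, M.cSpace c ≤ f m) ∧
      |α - (bitsToNat (((d τ).1 ++ (d τ).2.2).map dec) : ℝ) / 2 ^ m| ≤ C / 2 ^ m

end

end Olsh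
namespace Olsh

noncomputable section

attribute [local instance] Classical.propDecidable

/-! ## The 3-stage machine `M₂` and the symmetrization `M₃ = M₂^{sym}` -/

variable {T X : Type}

/-- State sets of `M₂`: each head state of `M₁` is tagged with the stage
(`0` = `M₂₁`, `1` = `M₂₂`, `2` = `M₂₃`); the extra `(k+1)`-th tape (index
`none`) only records the stage. -/
abbrev M2Q (M : TM T X) : Option T → Type :=
  fun o => o.elim (Fin 3) (fun i => Fin 3 × M.Q i)

/-- Tape alphabets of `M₂`: the old tapes keep their alphabets, the extra tape
carries the single auxiliary letter `*`. -/
abbrev M2Y (M : TM T X) : Option T → Type := fun o => o.elim Unit M.Y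

/-- Tag a command part of `M₁` with stages (used in stage `M₂₂`). -/
def tagCmd {Q Y : Type} (s s' : Fin 3) (p : CmdPart Q Y) : CmdPart (Fin 3 × Q) Y :=
  ⟨(s, p.q), (s', p.q'), p.u, p.v, p.u', p.v', p.lAnch, p.rAnch⟩

/-- The net change `m₁ - m₂` of the number of tape squares effected by the
command `t` of `M₁`. -/
def netDelta (M : TM T X) (t : M.ι) : ℤ :=
  (@Finset.univ T M.finT).sum (fun i =>
    ((M.cmds t i).u'.length + (M.cmds t i).v'.length : ℤ) -
    ((M.cmds t i).u.length + (M.cmds t i).v.length : ℤ))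

/-- Names of the commands of `M₂`: the padding command `θ_*` of `M₂₁`, the
connecting command `θ₁₂`, the simulating commands of `M₂₂` (one for each
command of `M₁`), the connecting command `θ₂₃`, and the erasing command of
`M₂₃`. -/
abbrev M2I (M : TM T X) : Type := Unit ⊕ Unit ⊕ M.ι ⊕ Unit ⊕ Unit

/-- The 3-stage machine `M₂` built from `M₁` by adding a `(k+1)`-th tape:
stage `M₂₁` repeatedly appends a square `*` to the new tape while the old tapes
hold an input configuration of `M₁`; `θ₁₂` switches on stage `M₂₂`, which
simulates `M₁` while inserting/deleting `*`-squares so that the total number of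
tape squares is unchanged; when the old tapes reach the accept configuration,
`θ₂₃` switches on stage `M₂₃`, which erases the new tape square by square and
accepts. -/
def M2M (M : TM T X) : TM (Option T) X where
  finT := @instFintypeOption T M.finT
  Q := M2Q M
  Y := M2Y M
  finQ := fun o => match o with
    | none => (inferInstance : Finite (Fin 3))
    | some i => (letI := M.finQ i; inferInstance : Finite (Fin 3 × M.Q i))
  finY := fun o => match o with
    | none => (inferInstance : Finite Unit)
    | some i => M.finY i
  finX := M.finX
  inputTape := some M.inputTape
  emb := M.emb
  ι := M2I M
  finι := letI := M.finι; inferInstance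
  cmds := fun t o => match t, o with
    | Sum.inl _, none =>
        ⟨(0 : Fin 3), (0 : Fin 3), [], [], [Unit.unit], [], false, true⟩
    | Sum.inl _, some i =>
        ⟨((0 : Fin 3), M.startQ i), ((0 : Fin 3), M.startQ i), [], [], [], [],
          (if i = M.inputTape then false else true), true⟩
    | Sum.inr (Sum.inl _), none =>
        ⟨(0 : Fin 3), (1 : Fin 3), [], [], [], [], false, true⟩
    | Sum.inr (Sum.inl _), some i =>
        ⟨((0 : Fin 3), M.startQ i), ((1 : Fin 3), M.startQ i), [], [], [], [],
          (if i = M.inputTape then false else true), true⟩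
    | Sum.inr (Sum.inr (Sum.inl t)), none =>
        ⟨(1 : Fin 3), (1 : Fin 3), List.replicate (netDelta M t).toNat Unit.unit, [],
          List.replicate (-(netDelta M t)).toNat Unit.unit, [], false, true⟩
    | Sum.inr (Sum.inr (Sum.inl t)), some i => tagCmd 1 1 (M.cmds t i)
    | Sum.inr (Sum.inr (Sum.inr (Sum.inl _))), none =>
        ⟨(1 : Fin 3), (2 : Fin 3), [], [], [], [], false, true⟩
    | Sum.inr (Sum.inr (Sum.inr (Sum.inl _))), some i =>
        ⟨((1 : Fin 3), M.acceptQ i), ((2 : Fin 3), M.acceptQ i), [], [], [], [], true, true⟩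
    | Sum.inr (Sum.inr (Sum.inr (Sum.inr _))), none =>
        ⟨(2 : Fin 3), (2 : Fin 3), [Unit.unit], [], [], [], false, true⟩
    | Sum.inr (Sum.inr (Sum.inr (Sum.inr _))), some i =>
        ⟨((2 : Fin 3), M.acceptQ i), ((2 : Fin 3), M.acceptQ i), [], [], [], [], true, true⟩
  startQ := fun o => match o with
    | none => (0 : Fin 3)
    | some i => ((0 : Fin 3), M.startQ i)
  acceptQ := fun o => match o with
    | none => (2 : Fin 3)
    | some i => ((2 : Fin 3), M.acceptQ i)

/-- The padding command `θ_*` of `M₂`. -/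
def thetaStar (M : TM T X) : (M2M M).ι := Sum.inl ()

/-- `u(w)`: the configuration `w` of `M₂` carries the input word `u` of `M₁`
on the (old) input tape. -/
def CarriesInput (M : TM T X) (w : (M2M M).Conf) (u : List X) : Prop :=
  (w (some M.inputTape)).1 = u.map M.emb

/-- The symmetrization `M^{sym}` of a Turing machine: for every command the
inverse command is added. -/
def symTM (M : TM T X) : TM T X :=
  { M with
    ι := M.ι ⊕ M.ι
    finι := letI := M.finι; inferInstance
    cmds := fun t => match t with
      | Sum.inl t => M.cmds t
      | Sum.inr t => fun i => (M.cmds t i).inv }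

/-- The machine `M₃ = M₂^{sym}`. -/
def M3M (M : TM T X) : TM (Option T) X := symTM (M2M M)

end

end Olsh
namespace Olsh

noncomputable section

attribute [local instance] Classical.propDecidable

/-! ## S-machines -/

/-- Free reduction of a group word. -/
def reduceW {A : Type} (w : Word A) : Word A :=
  letI := Classical.decEq A; FreeGroup.reduce w

/-- A rule of an `S`-machine with `k+1` state letters and `k` tape sectors:
it replaces the subwords `U_i = v_{i-1} q_i u_i` by `V_i = v'_{i-1} q'_i u'_i`,
and is applicable only to admissible words all whose tape letters lie in the
alphabets `allowed i = Y_i(θ)`. -/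
structure SRule {k : ℕ} (Q : Fin (k + 1) → Type) (Y : Fin k → Type) : Type where
  allowed : ∀ i : Fin k, Set (Y i)
  q : ∀ i : Fin (k + 1), Q i
  q' : ∀ i : Fin (k + 1), Q i
  u : ∀ i : Fin k, Word (Y i)
  v : ∀ i : Fin k, Word (Y i)
  u' : ∀ i : Fin k, Word (Y i)
  v' : ∀ i : Fin k, Word (Y i)

/-- The inverse rule. -/
def SRule.inv {k : ℕ} {Q : Fin (k + 1) → Type} {Y : Fin k → Type}
    (θ : SRule Q Y) : SRule Q Y :=
  ⟨θ.allowed, θ.q', θ.q, θ.u', θ.v', θ.u, θ.v⟩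

/-- Application of an `S`-rule to an admissible word (a tuple of state letters
together with the reduced tape words between them): each state letter `q_i` is
replaced according to the rule and the neighbouring tape words are multiplied by
the corresponding group words, followed by free reduction. -/
def SRule.RApplies {k : ℕ} {Q : Fin (k + 1) → Type} {Y : Fin k → Type} (θ : SRule Q Y)
    (w w' : (∀ i, Q i) × (∀ i : Fin k, Word (Y i))) : Prop :=
  w.1 = θ.q ∧ w'.1 = θ.q' ∧ ∀ i : Fin k,
    (∀ p ∈ w.2 i, p.1 ∈ θ.allowed i) ∧
    w'.2 i = reduceW (θ.u' i ++ wInv (θ.u i) ++ w.2 i ++ wInv (θ.v i) ++ θ.v' i)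

/-- Map a rule along letterwise translations of the state and tape alphabets. -/
def SRule.mapLetters {k : ℕ} {Q Q' : Fin (k + 1) → Type} {Y Y' : Fin k → Type}
    (fQ : ∀ i, Q i → Q' i) (fY : ∀ i, Y i → Y' i) (θ : SRule Q Y) : SRule Q' Y' where
  allowed := fun i => fY i '' θ.allowed i
  q := fun i => fQ i (θ.q i)
  q' := fun i => fQ i (θ.q' i)
  u := fun i => (θ.u i).map (fun p => (fY i p.1, p.2))
  v := fun i => (θ.v i).map (fun p => (fY i p.1, p.2))
  u' := fun i => (θ.u' i).map (fun p => (fY i p.1, p.2))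
  v' := fun i => (θ.v' i).map (fun p => (fY i p.1, p.2))

/-- The rule with all tape words deleted and empty allowed alphabets. -/
def SRule.strip {k : ℕ} {Q : Fin (k + 1) → Type} {Y : Fin k → Type}
    (θ : SRule Q Y) : SRule Q Y :=
  { θ with allowed := fun _ => ∅, u := fun _ => [], v := fun _ => [],
           u' := fun _ => [], v' := fun _ => [] }

/-- An `S`-machine with `k+1` state letters, `k` tape sectors, and input
alphabet `X` (a subalphabet of the alphabet of the distinguished input sector).
`ι` indexes the positive rules. -/
structure SM (k : ℕ) (X : Type) where
  Q : Fin (k + 1) → Type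
  Y : Fin k → Type
  finQ : ∀ i, Finite (Q i)
  finY : ∀ i, Finite (Y i)
  finX : Finite X
  inputSector : Fin k
  emb : X → Y inputSector
  ι : Type
  finι : Finite ι
  rules : ι → SRule Q Y
  startQ : ∀ i, Q i
  acceptQ : ∀ i, Q i

namespace SM

variable {k : ℕ} {X : Type} (S : SM k X)

/-- Admissible words `q₁ u₁ q₂ … u_k q_{k+1}` of the machine. -/
def AWord : Type := (∀ i : Fin (k + 1), S.Q i) × (∀ i : Fin k, Word (S.Y i))

/-- The labelled rules: `(t, true)` is the positive rule `t`, `(t, false)` its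
inverse. -/
def ruleOfLbl (l : S.ι × Bool) : SRule S.Q S.Y :=
  if l.2 then S.rules l.1 else (S.rules l.1).inv

/-- Application of the labelled rule `l`. -/
def ApplyLbl (l : S.ι × Bool) (w w' : S.AWord) : Prop := (S.ruleOfLbl l).RApplies w w'

/-- The transition relation of the `S`-machine (rules and their inverses). -/
def step (w w' : S.AWord) : Prop := ∃ l : S.ι × Bool, S.ApplyLbl l w w'

/-- The number of tape letters of an admissible word. -/
def aLen (w : S.AWord) : ℕ := ∑ i : Fin k, (w.2 i).length

/-- The input admissible word on the input word `u`. -/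
def inputW (u : List X) : S.AWord :=
  (S.startQ,
    Function.update (fun _ => []) S.inputSector (u.map (fun x => (S.emb x, true))))

/-- The accept admissible word. -/
def acceptW : S.AWord := (S.acceptQ, fun _ => [])

/-- There is an accepting computation from `w` with space at most `s`. -/
def AcceptsWithin (w : S.AWord) (s : ℕ) : Prop :=
  ∃ ws : List S.AWord, ws.head? = some w ∧ ws.getLast? = some S.acceptW ∧
    ws.Chain' S.step ∧ ∀ v ∈ ws, S.aLen v ≤ s

/-- The admissible word `w` is accepted. -/
def AcceptsW (w : S.AWord) : Prop := ∃ s, S.AcceptsWithin w s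

/-- The minimal space of an accepting computation from `w`. -/
def minSpace (w : S.AWord) : ℕ := sInf {s | S.AcceptsWithin w s}

/-- The language recognized by the `S`-machine. -/
def lang : Set (List X) := {u | S.AcceptsW (S.inputW u)}

/-- The space function of the `S`-machine. -/
def spaceFun (n : ℕ) : ℕ :=
  sInf {s | ∀ u : List X, u.length ≤ n → S.AcceptsW (S.inputW u) →
    S.AcceptsWithin (S.inputW u) s}

/-- The generalized space function of the `S`-machine. -/
def genSpaceFun (n : ℕ) : ℕ :=
  sInf {s | ∀ w : S.AWord, S.aLen w ≤ n → S.AcceptsW w → S.AcceptsWithin w s}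

/-- A computation from `w` to `w''` with history `h`, all whose admissible words
satisfy `P`. -/
inductive TracedIn (P : S.AWord → Prop) : S.AWord → List (S.ι × Bool) → S.AWord → Prop
  | nil (w : S.AWord) : P w → TracedIn P w [] w
  | cons {w w' w'' : S.AWord} (l : S.ι × Bool) {h : List (S.ι × Bool)} :
      P w → S.ApplyLbl l w w' → TracedIn P w' h w'' → TracedIn P w (l :: h) w''

/-- An admissible word is positive if it contains no inverse tape letters. -/
def Positive (w : S.AWord) : Prop := ∀ i : Fin k, ∀ p ∈ w.2 i, p.2 = true

/-- The `s⃗₁₀`-condition for `S`-machines. -/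
def S10 : Prop :=
  (∀ w : S.AWord, (∃ i, w.1 i = S.startQ i) → ∃ u : List X, w = S.inputW u) ∧
  (∀ (u : List X) (l l' : S.ι × Bool), (∃ w', S.ApplyLbl l (S.inputW u) w') →
      (∃ w', S.ApplyLbl l' (S.inputW u) w') → l = l') ∧
  (∀ (l l' : S.ι × Bool), (∃ w, S.ApplyLbl l w S.acceptW) →
      (∃ w, S.ApplyLbl l' w S.acceptW) → l = l')

end SM

/-- The bundle of properties of the `S`-machine provided by Lemma 2.10:
the `s⃗₁₀`-condition; every rule or its inverse inserts/deletes at most one tape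
letter on the left and at most one on the right of every state letter; the
unique start rule has the form `q₁ → q'₁, q₂ →ℓ q'₂, …`; the state letters of
`Q₁` are passive; and the input sector is the first sector. -/
def GoodSM {k : ℕ} {X : Type} (S : SM k X) : Prop :=
  S.S10 ∧
  (∀ (t : S.ι) (i : Fin k),
      ((S.rules t).u i).length + ((S.rules t).u' i).length ≤ 1 ∧
      ((S.rules t).v i).length + ((S.rules t).v' i).length ≤ 1) ∧
  (∃ t₀ : S.ι, (S.rules t₀).q = S.startQ ∧
      (∀ i, (S.rules t₀).u i = [] ∧ (S.rules t₀).v i = [] ∧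
            (S.rules t₀).u' i = [] ∧ (S.rules t₀).v' i = []) ∧
      (∀ i, i ≠ S.inputSector → (S.rules t₀).allowed i = ∅)) ∧
  (∀ (h0 : 0 < k) (t : S.ι),
      (S.rules t).u ⟨0, h0⟩ = [] ∧ (S.rules t).u' ⟨0, h0⟩ = []) ∧
  S.inputSector.val = 0

/-! ## The S-machine `S(M)` of a symmetric Turing machine -/

section SofM

variable {k : ℕ} {X : Type} (M : TM (Fin (k + 1)) X)

/-- The tape of a state-letter position of `S(M)`:  the positions
`3i, 3i+1, 3i+2` carry the letters `α_i, q_i, ω_i` of tape `i`. -/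
def spos (j : Fin (3 * k + 2 + 1)) : Fin (k + 1) := ⟨j.val / 3, by omega⟩

/-- The tape of a sector of `S(M)`. -/
def tpos (j : Fin (3 * k + 2)) : Fin (k + 1) := ⟨j.val / 3, by omega⟩

/-- State letter sets of `S(M)`: the head letters `q_i` at positions `≡ 1 mod 3`,
and the (inactive) letters `α_i, ω_i` elsewhere. -/
def QS (j : Fin (3 * k + 2 + 1)) : Type :=
  if j.val % 3 = 1 then M.Q (spos j) else Unit

/-- Sector alphabets of `S(M)`: the sector between `α_i` and `q_i` (resp.
between `q_i` and `ω_i`) carries the alphabet of tape `i`; the sectors between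
`ω_i` and `α_{i+1}` are empty. -/
def YS (j : Fin (3 * k + 2)) : Type :=
  if j.val % 3 = 2 then PEmpty else M.Y (tpos j)

/-- Constructor for state letters of `S(M)`. -/
def mkQS (j : Fin (3 * k + 2 + 1)) (f : j.val % 3 = 1 → M.Q (spos j)) : QS M j := by
  unfold QS; split
  next h => exact f h
  next h => exact Unit.unit

/-- Push a tape letter into a sector alphabet of `S(M)`. -/
def toYS (j : Fin (3 * k + 2)) (h : ¬ j.val % 3 = 2) (y : M.Y (tpos j)) : YS M j := by
  unfold YS; rw [if_neg h]; exact y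

/-- Push a word into a sector alphabet of `S(M)`. -/
def mkWS (j : Fin (3 * k + 2)) (f : ¬ j.val % 3 = 2 → Word (M.Y (tpos j))) :
    Word (YS M j) :=
  if h : j.val % 3 = 2 then [] else (f h).map (fun p => (toYS M j h p.1, p.2))

/-- The input sector of `S(M)`. -/
def inSec : Fin (3 * k + 2) :=
  ⟨3 * M.inputTape.val, by have := M.inputTape.isLt; omega⟩

/-- The input tape of `M` is the tape of the input sector of `S(M)`. -/
theorem tpos_inSec : M.inputTape = tpos (inSec M) := by
  apply Fin.ext; simp [tpos, inSec]

/-- The rule of `S(M)` interpreting the command `t` of `M`:  a command part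
`u q v → u' q' v'` of tape `i` becomes `q → u⁻¹ u' q' v' v⁻¹` (acting on the
two sectors adjacent to `q_i`), anchored parts get empty allowed alphabets. -/
def ruleS (t : M.ι) : SRule (QS M) (YS M) where
  allowed := fun j =>
    if (j.val % 3 = 0 ∧ (M.cmds t (tpos j)).lAnch = true) ∨
       (j.val % 3 = 1 ∧ (M.cmds t (tpos j)).rAnch = true) then ∅ else Set.univ
  q := fun j => mkQS M j (fun _ => (M.cmds t (spos j)).q)
  q' := fun j => mkQS M j (fun _ => (M.cmds t (spos j)).q')
  u := fun j => mkWS M j (fun _ =>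
    if j.val % 3 = 0 then [] else posWord (M.cmds t (tpos j)).v)
  v := fun j => mkWS M j (fun _ =>
    if j.val % 3 = 0 then posWord (M.cmds t (tpos j)).u else [])
  u' := fun j => mkWS M j (fun _ =>
    if j.val % 3 = 0 then [] else posWord (M.cmds t (tpos j)).v')
  v' := fun j => mkWS M j (fun _ =>
    if j.val % 3 = 0 then posWord (M.cmds t (tpos j)).u' else [])

/-- The `S`-machine `S(M)` obtained by interpreting the commands of the
(symmetric) Turing machine `M` as `S`-rules. -/
def SofM : SM (3 * k + 2) X where
  Q := QS M
  Y := YS M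
  finQ := fun j => by unfold QS; split
                      · exact M.finQ _
                      · infer_instance
  finY := fun j => by unfold YS; split
                      · infer_instance
                      · exact M.finY _
  finX := M.finX
  inputSector := inSec M
  emb := fun x =>
    toYS M (inSec M) (by simp [inSec])
      (cast (congrArg (fun i => M.Y i) (tpos_inSec M)) (M.emb x))
  ι := M.ι
  finι := M.finι
  rules := fun t => ruleS M t
  startQ := fun j => mkQS M j (fun _ => M.startQ (spos j))
  acceptQ := fun j => mkQS M j (fun _ => M.acceptQ (spos j))

/-- The admissible word of `S(M)` corresponding to a configuration of `M`. -/
def confToAWord (c : M.Conf) : (SofM M).AWord :=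
  (fun j => mkQS M j (fun _ => (c (spos j)).2.1),
   fun j => mkWS M j (fun _ =>
     if j.val % 3 = 0 then posWord (c (tpos j)).1 else posWord (c (tpos j)).2.2))

end SofM

/-! ## Disjoint copies sharing the input alphabet and the start/accept letters -/

section UnionSM

variable {k : ℕ} {X : Type} (S : SM k X)

/-- The state letters shared between `S` and its copy `Ŝ`: the start and accept
letters. -/
def SharedQ (i : Fin (k + 1)) (q : S.Q i) : Prop := q = S.startQ i ∨ q = S.acceptQ i

/-- The tape letters shared between `S` and its copy `Ŝ`: the input letters. -/
def SharedY (i : Fin k) (y : S.Y i) : Prop :=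
  ∃ h : i = S.inputSector, h ▸ y ∈ Set.range S.emb

/-- State letters of `S ∪ Ŝ`. -/
def QU (i : Fin (k + 1)) : Type := S.Q i ⊕ {q : S.Q i // ¬ SharedQ S i q}

/-- Tape letters of `S ∪ Ŝ`. -/
def YU (i : Fin k) : Type := S.Y i ⊕ {y : S.Y i // ¬ SharedY S i y}

/-- The hat copy of a state letter. -/
def hatQ (i : Fin (k + 1)) (q : S.Q i) : QU S i :=
  if h : SharedQ S i q then Sum.inl q else Sum.inr ⟨q, h⟩

/-- The hat copy of a tape letter. -/
def hatY (i : Fin k) (y : S.Y i) : YU S i :=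
  if h : SharedY S i y then Sum.inl y else Sum.inr ⟨y, h⟩

/-- The machine `S ∪ Ŝ`: the union of `S` and of its disjoint copy `Ŝ`, the two
sharing exactly the input alphabet and the start and accept state letters. -/
def unionSM : SM k X where
  Q := QU S
  Y := YU S
  finQ := fun i => by have := S.finQ i; unfold QU; infer_instance
  finY := fun i => by have := S.finY i; unfold YU; infer_instance
  finX := S.finX
  inputSector := S.inputSector
  emb := fun x => Sum.inl (S.emb x)
  ι := S.ι ⊕ S.ι
  finι := letI := S.finι; inferInstance
  rules := Sum.elim
    (fun t => (S.rules t).mapLetters (fun _ q => Sum.inl q) (fun _ y => Sum.inl y))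
    (fun t => (S.rules t).mapLetters (hatQ S) (hatY S))
  startQ := fun i => Sum.inl (S.startQ i)
  acceptQ := fun i => Sum.inl (S.acceptQ i)

/-- The copy `Ŝ` of `S` (realized on the letters of `S ∪ Ŝ`). -/
def hatSM : SM k X :=
  { unionSM S with
    ι := S.ι
    finι := S.finι
    rules := fun t => (S.rules t).mapLetters (hatQ S) (hatY S) }

end UnionSM

end

end Olsh
namespace Olsh

noncomputable section

attribute [local instance] Classical.propDecidable

/-! ## The group `G(S ∪ Ŝ, L)` with the hub relation -/

section GroupG

variable {k : ℕ} {X : Type} (S : SM k X) (L : ℕ)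

/-- The `q`-generators of the group: the letters `k₁, …, k_L` and, for every
block `j` and every state position, the state letters of `S ∪ Ŝ`. -/
def QGen : Type := Fin L ⊕ (Fin L × Σ p : Fin (k + 1), QU S p)

/-- The `a`-generators: for every block, copies of the tape letters of `S ∪ Ŝ`. -/
def AGen : Type := Fin L × Σ i : Fin k, YU S i

/-- The `θ`-generators: for every (positive) rule of `S ∪ Ŝ` one letter `θ_n`
for each of the `N = (k+2)L` positions. -/
def ThGen : Type := (S.ι ⊕ S.ι) × Fin L × Fin (k + 2)

/-- The generators of the group `G(S ∪ Ŝ, L)`. -/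
def GGen : Type := QGen S L ⊕ AGen S L ⊕ ThGen S L

def kGen (j : Fin L) : GGen S L := Sum.inl (Sum.inl j)
def qGen (j : Fin L) (p : Fin (k + 1)) (q : QU S p) : GGen S L :=
  Sum.inl (Sum.inr (j, ⟨p, q⟩))
def aGen (j : Fin L) (i : Fin k) (y : YU S i) : GGen S L :=
  Sum.inr (Sum.inl (j, ⟨i, y⟩))
def tGen (r : S.ι ⊕ S.ι) (j : Fin L) (p : Fin (k + 2)) : GGen S L :=
  Sum.inr (Sum.inr (r, j, p))

def isQg : GGen S L → Bool := fun g => match g with | Sum.inl _ => true | _ => false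
def isAg : GGen S L → Bool :=
  fun g => match g with | Sum.inr (Sum.inl _) => true | _ => false
def isTg : GGen S L → Bool :=
  fun g => match g with | Sum.inr (Sum.inr _) => true | _ => false

/-- Spell a sector word of the block `j` as a group word. -/
def spellSec (j : Fin L) (i : Fin k) (w : Word (YU S i)) : Word (GGen S L) :=
  w.map (fun p => (aGen S L j i p.1, p.2))

/-- Spell an admissible word of `S ∪ Ŝ` (in the straight, non-mirrored order)
inside block `j`. -/
def spellBlock (j : Fin L) (W : (unionSM S).AWord) : Word (GGen S L) :=
  ((List.finRange (k + 1)).map (fun p =>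
      (qGen S L j p (W.1 p), true) ::
        (if h : p.val < k then spellSec S L j ⟨p.val, h⟩ (W.2 ⟨p.val, h⟩)
         else []))).foldr (· ++ ·) []

/-- Spell an admissible word of the machine `S(L) ∪ Ŝ(L)`, given by its tuple
of blocks: `k₁ W₁ k₂ W₂ … k_L W_L`, the even-numbered blocks being mirror
(reversed) copies. -/
def spellConf (c : Fin L → (unionSM S).AWord) : Word (GGen S L) :=
  ((List.finRange L).map (fun j =>
      (kGen S L j, true) ::
        (if j.val % 2 = 0 then spellBlock S L j (c j)
         else (spellBlock S L j (c j)).reverse))).foldr (· ++ ·) []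

/-- The hub word `Σ₀` (the accept word of `S(L)`). -/
def hubWord : Word (GGen S L) := spellConf S L (fun _ => (unionSM S).acceptW)

/-- The rule of `S ∪ Ŝ` acting in block `j`: the rules of `Ŝ` act on the first
block with all tape letters deleted (the first block of `Ŝ(L)` carries no
`a`-letters). -/
def blockRule (r : S.ι ⊕ S.ι) (j : Fin L) : SRule (QU S) (YU S) :=
  if r.isRight = true ∧ j.val = 0 then ((unionSM S).rules r).strip
  else (unionSM S).rules r

/-- The word `v_{s-1} q_s u_s` of a rule, spelled in block `j`. -/
def partU (ρ : SRule (QU S) (YU S)) (j : Fin L) (s : Fin (k + 1)) : Word (GGen S L) :=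
  (if h : 0 < s.val then
      spellSec S L j ⟨s.val - 1, by have := s.isLt; omega⟩
        (ρ.v ⟨s.val - 1, by have := s.isLt; omega⟩)
   else []) ++
  [(qGen S L j s (ρ.q s), true)] ++
  (if h : s.val < k then spellSec S L j ⟨s.val, h⟩ (ρ.u ⟨s.val, h⟩) else [])

/-- The word `v'_{s-1} q'_s u'_s` of a rule, spelled in block `j`. -/
def partV (ρ : SRule (QU S) (YU S)) (j : Fin L) (s : Fin (k + 1)) : Word (GGen S L) :=
  (if h : 0 < s.val then
      spellSec S L j ⟨s.val - 1, by have := s.isLt; omega⟩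
        (ρ.v' ⟨s.val - 1, by have := s.isLt; omega⟩)
   else []) ++
  [(qGen S L j s (ρ.q' s), true)] ++
  (if h : s.val < k then spellSec S L j ⟨s.val, h⟩ (ρ.u' ⟨s.val, h⟩) else [])

/-- The word `U` of the rule `r` at position `(j, p)` (mirrored in the
even-numbered blocks). -/
def Uword (r : S.ι ⊕ S.ι) (j : Fin L) (p : Fin (k + 2)) : Word (GGen S L) :=
  if h : p.val = 0 then [(kGen S L j, true)]
  else if j.val % 2 = 0 then
    partU S L (blockRule S L r j) j ⟨p.val - 1, by have := p.isLt; omega⟩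
  else
    (partU S L (blockRule S L r j) j ⟨k + 1 - p.val, by have := p.isLt; omega⟩).reverse

/-- The word `V` of the rule `r` at position `(j, p)`. -/
def Vword (r : S.ι ⊕ S.ι) (j : Fin L) (p : Fin (k + 2)) : Word (GGen S L) :=
  if h : p.val = 0 then [(kGen S L j, true)]
  else if j.val % 2 = 0 then
    partV S L (blockRule S L r j) j ⟨p.val - 1, by have := p.isLt; omega⟩
  else
    (partV S L (blockRule S L r j) j ⟨k + 1 - p.val, by have := p.isLt; omega⟩).reverse

/-- The position following `(j, p)` (cyclically, modulo `N`). -/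
def nextPos (j : Fin L) (p : Fin (k + 2)) : Fin L × Fin (k + 2) :=
  if h : p.val + 1 < k + 2 then (j, ⟨p.val + 1, h⟩)
  else (⟨(j.val + 1) % L, by have := j.isLt; exact Nat.mod_lt _ (by omega)⟩, ⟨0, by omega⟩)

/-- The `(θ, q)`-relation `U_n θ_{n+1} V_n⁻¹ θ_n⁻¹` of the rule `r` at position
`n = (j, p)`. -/
def qRelWord (r : S.ι ⊕ S.ι) (j : Fin L) (p : Fin (k + 2)) : Word (GGen S L) :=
  Uword S L r j p ++ [(tGen S L r (nextPos L j p).1 (nextPos L j p).2, true)] ++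
    wInv (Vword S L r j p) ++ [(tGen S L r j p, false)]

/-- The position of the `θ`-letter adjacent to the sector `i` of block `j`. -/
def secPos (j : Fin L) (i : Fin k) : Fin (k + 2) :=
  if j.val % 2 = 0 then ⟨i.val + 2, by have := i.isLt; omega⟩
  else ⟨k - i.val + 1, by have := i.isLt; omega⟩

/-- The `(θ, a)`-relation `θ a θ⁻¹ a⁻¹`. -/
def aRelWord (r : S.ι ⊕ S.ι) (j : Fin L) (i : Fin k) (y : YU S i) : Word (GGen S L) :=
  [(tGen S L r j (secPos L j i), true), (aGen S L j i y, true),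
   (tGen S L r j (secPos L j i), false), (aGen S L j i y, false)]

/-- The defining relations of the group `G(S ∪ Ŝ, L)` associated with the
machine `S(L) ∪ Ŝ(L)`, together with the hub relation `Σ₀ = 1`. -/
def RelsG : Set (Word (GGen S L)) :=
  {w | ∃ (r : S.ι ⊕ S.ι) (j : Fin L) (p : Fin (k + 2)), w = qRelWord S L r j p} ∪
  {w | ∃ (r : S.ι ⊕ S.ι) (j : Fin L) (i : Fin k) (y : YU S i),
      y ∈ (blockRule S L r j).allowed i ∧ w = aRelWord S L r j i y} ∪
  {hubWord S L}

/-- The group `G`. -/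
abbrev GGroup : Type := presGroup (RelsG S L)

/-- The image of a generator in the group `G`. -/
def gOf (g : GGen S L) : GGroup S L :=
  PresentedGroup.of (rels := FreeGroup.mk '' RelsG S L) g

/-- The generator of `G` corresponding to an input letter (in the first block). -/
def inGen (h0 : 0 < L) (x : X) : GGen S L :=
  aGen S L ⟨0, h0⟩ S.inputSector (Sum.inl (S.emb x))

/-! ### The modified (`δ`-weighted) length and space over tuples -/

/-- Split a word into its maximal `q`-letter-free segments. -/
def splitSegs {A : Type} (isQ : A → Bool) (w : Word A) : List (Word A) :=
  w.foldr (fun p acc =>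
    if isQ p.1 then [] :: acc
    else match acc with
      | [] => [[p]]
      | s :: rest => (p :: s) :: rest) [[]]

/-- The modified length of a `q`-free segment: `s + δ·max(0, t − s)` where `s`
is the number of `θ`-letters and `t` the number of `a`-letters. -/
def segLen {A : Type} (δ : ℝ) (isT isA : A → Bool) (v : Word A) : ℝ :=
  (v.countP (fun p => isT p.1) : ℝ) +
    δ * max 0 ((v.countP (fun p => isA p.1) : ℝ) - (v.countP (fun p => isT p.1) : ℝ))

/-- The modified length `|w|` of a word. -/
def mlenGen {A : Type} (δ : ℝ) (isQ isT isA : A → Bool) (w : Word A) : ℝ :=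
  (w.countP (fun p => isQ p.1) : ℝ) + ((splitSegs isQ w).map (segLen δ isT isA)).sum

/-- The modified length of a word in the generators of `G`. -/
def mlenG (δ : ℝ) (w : Word (GGen S L)) : ℝ :=
  mlenGen δ (isQg S L) (isTg S L) (isAg S L) w

/-- The total modified length of a tuple of words. -/
def seqMlenG (δ : ℝ) (Ws : List (Word (GGen S L))) : ℝ := (Ws.map (mlenG S L δ)).sum

/-- There is an elementary reduction of `w` to the empty tuple all whose steps
have total modified length at most `m`. -/
def SpaceLeG (δ : ℝ) (w : Word (GGen S L)) (m : ℝ) : Prop :=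
  ∃ Ls : List (List (Word (GGen S L))), Ls.head? = some [w] ∧ Ls.getLast? = some [] ∧
    Ls.Chain' (ElemTrans (RelsG S L)) ∧ ∀ Wt ∈ Ls, seqMlenG S L δ Wt ≤ m

/-- `Space_G(w)`. -/
def SpaceG (δ : ℝ) (w : Word (GGen S L)) : ℝ := sInf {m | SpaceLeG S L δ w m}

/-- `f_{G,W}(x)`: the space function of `G` restricted to the vanishing set `W`
(implemented as the least uniform bound). -/
def fGW (δ : ℝ) (Wset : Set (Word (GGen S L))) (x : ℝ) : ℝ :=
  sInf {m | ∀ w ∈ Wset, mlenG S L δ w ≤ x → SpaceLeG S L δ w m}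

/-! ### The machines `S(L)` and `Ŝ(L)` -/

/-- Application of the labelled rule `l` of `S(L) ∪ Ŝ(L)` to a tuple of blocks:
the same rule is applied to every block simultaneously (the mirroring is a
matter of spelling only). -/
def SLApply (l : (S.ι ⊕ S.ι) × Bool) (c c' : Fin L → (unionSM S).AWord) : Prop :=
  ∀ j : Fin L,
    (if l.2 then blockRule S L l.1 j else (blockRule S L l.1 j).inv).RApplies (c j) (c' j)

/-- The transition relation of the machine `S(L)`. -/
def SLstepS (c c' : Fin L → (unionSM S).AWord) : Prop :=
  ∃ (t : S.ι) (b : Bool), SLApply S L (Sum.inl t, b) c c'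

/-- The transition relation of the machine `Ŝ(L)`. -/
def SLstepHat (c c' : Fin L → (unionSM S).AWord) : Prop :=
  ∃ (t : S.ι) (b : Bool), SLApply S L (Sum.inr t, b) c c'

/-- The admissible word `k₁W₁…k_LW_L` is accepted by `S(L)`. -/
def SLAcceptedS (c : Fin L → (unionSM S).AWord) : Prop :=
  Relation.ReflTransGen (SLstepS S L) c (fun _ => (unionSM S).acceptW)

/-- The admissible word is accepted by `Ŝ(L)`. -/
def SLAcceptedHat (c : Fin L → (unionSM S).AWord) : Prop :=
  Relation.ReflTransGen (SLstepHat S L) c (fun _ => (unionSM S).acceptW)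

/-- Accepted by `S(L)` or by `Ŝ(L)`. -/
def SLAccepted (c : Fin L → (unionSM S).AWord) : Prop :=
  SLAcceptedS S L c ∨ SLAcceptedHat S L c

end GroupG

end

end Olsh

namespace Olsh

section StackPrograms

open scoped Classical

/-- A prefix-rewriting pattern `pre ↦ post` on the top of a stack; if `anch` holds
it only applies to the whole stack. -/
structure Pat (A : Type) where
  pre : List A
  post : List A
  anch : Bool

namespace Pat

variable {A : Type}

/-- The relation on stacks defined by a pattern. -/
def Rel (p : Pat A) (l l' : List A) : Prop :=
  ∃ a, (p.anch = true → a = []) ∧ l = p.pre ++ a ∧ l' = p.post ++ a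

/-- The inverse pattern. -/
def inv (p : Pat A) : Pat A := ⟨p.post, p.pre, p.anch⟩

/-- The pattern that changes nothing. -/
def idle : Pat A := ⟨[], [], false⟩

/-- Pop a given letter. -/
def pop (x : A) : Pat A := ⟨[x], [], false⟩

/-- Push a given letter. -/
def push (x : A) : Pat A := ⟨[], [x], false⟩

/-- Test for the empty stack. -/
def test : Pat A := ⟨[], [], true⟩

/-- Look at the top letter. -/
def peek (x : A) : Pat A := ⟨[x], [x], false⟩

theorem rel_inv {p : Pat A} {l l' : List A} : p.inv.Rel l l' ↔ p.Rel l' l := by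
  unfold Rel inv
  constructor <;> rintro ⟨a, h1, h2, h3⟩ <;> exact ⟨a, h1, h3, h2⟩

theorem Rel.unique {p : Pat A} {l m m' : List A} (h : p.Rel l m) (h' : p.Rel l m') : m = m' := by
  obtain ⟨a, -, h2, h3⟩ := h
  obtain ⟨b, -, h5, h6⟩ := h'
  have : a = b := List.append_cancel_left (h2.symm.trans h5)
  rw [h3, h6, this]

theorem Rel.unique' {p : Pat A} {l l' m : List A} (h : p.Rel l m) (h' : p.Rel l' m) : l = l' :=
  (rel_inv.2 h).unique (rel_inv.2 h')

theorem Rel.length {p : Pat A} {l l' : List A} (h : p.Rel l l') :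
    (l'.length : ℤ) = l.length + (p.post.length - p.pre.length) := by
  obtain ⟨a, -, rfl, rfl⟩ := h
  simp only [List.length_append]
  push_cast
  ring

@[simp] theorem rel_idle {l l' : List A} : (idle : Pat A).Rel l l' ↔ l' = l := by
  simp [Rel, idle, eq_comm]

@[simp] theorem rel_test {l l' : List A} : (test : Pat A).Rel l l' ↔ l = [] ∧ l' = [] := by
  simp [Rel, test]

@[simp] theorem rel_pop {x : A} {l l' : List A} : (pop x).Rel l l' ↔ l = x :: l' := by
  simp [Rel, pop]

@[simp] theorem rel_push {x : A} {l l' : List A} : (push x).Rel l l' ↔ l' = x :: l := by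
  simp [Rel, push]

@[simp] theorem rel_peek {x : A} {l l' : List A} :
    (peek x).Rel l l' ↔ l' = l ∧ ∃ a, l = x :: a := by
  simp only [Rel, peek]
  constructor
  · rintro ⟨a, -, rfl, rfl⟩
    exact ⟨rfl, a, rfl⟩
  · rintro ⟨rfl, a, rfl⟩
    exact ⟨a, by simp, rfl, rfl⟩

/-- Composition of the relations of a list of patterns. -/
def LRel : List (Pat A) → List A → List A → Prop
  | [], l, l' => l' = l
  | p :: ps, l, l' => ∃ m, p.Rel l m ∧ LRel ps m l'

theorem lrel_append {ps qs : List (Pat A)} {l l' : List A} :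
    LRel (ps ++ qs) l l' ↔ ∃ m, LRel ps l m ∧ LRel qs m l' := by
  induction ps generalizing l with
  | nil => simp [LRel]
  | cons p ps ih =>
    simp only [List.cons_append, LRel, ih]
    constructor
    · rintro ⟨m, h1, m', h2, h3⟩
      exact ⟨m', ⟨m, h1, h2⟩, h3⟩
    · rintro ⟨m', ⟨m, h1, h2⟩, h3⟩
      exact ⟨m, h1, m', h2, h3⟩

/-- Decomposition of a pattern into patterns involving at most one letter. -/
def split (p : Pat A) : List (Pat A) :=
  p.pre.map pop ++ ([⟨[], [], p.anch⟩] ++ p.post.reverse.map push)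

theorem lrel_pops {w l l' : List A} : LRel (w.map pop) l l' ↔ l = w ++ l' := by
  induction w generalizing l with
  | nil => simp [LRel, eq_comm]
  | cons x w ih =>
    simp only [List.map_cons, LRel, rel_pop, ih]
    constructor
    · rintro ⟨m, rfl, rfl⟩
      rfl
    · intro h
      exact ⟨w ++ l', h, rfl⟩

theorem lrel_pushes {w l l' : List A} : LRel (w.map push) l l' ↔ l' = w.reverse ++ l := by
  induction w generalizing l with
  | nil => simp [LRel]
  | cons x w ih => simp [LRel, ih]

theorem lrel_split {p : Pat A} {l l' : List A} : LRel p.split l l' ↔ p.Rel l l' := by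
  simp only [split, lrel_append, lrel_pops, lrel_pushes, Rel]
  constructor
  · rintro ⟨a, rfl, m, ⟨b, ⟨c, h1, h2, h3⟩, h4⟩, h5⟩
    simp only [List.nil_append] at h2 h3 h4
    obtain rfl : m = b := h4
    subst h2 h3
    exact ⟨_, h1, rfl, by simpa using h5⟩
  · rintro ⟨a, h1, rfl, rfl⟩
    exact ⟨a, rfl, a, ⟨a, ⟨a, h1, rfl, rfl⟩, rfl⟩, by simp⟩

/-- The number of letters involved in a pattern. -/
def letters (p : Pat A) : ℕ := p.pre.length + p.post.length

theorem letters_split {p q : Pat A} (h : q ∈ p.split) : q.letters ≤ 1 := by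
  simp only [split, List.mem_append, List.mem_map, List.mem_singleton] at h
  rcases h with ⟨x, -, rfl⟩ | rfl | ⟨x, -, rfl⟩ <;> simp [letters, pop, push]

end Pat

section Families

variable {K : Type} {Γ : K → Type}

/-- A pattern on every stack. -/
abbrev Fam (Γ : K → Type) : Type := ∀ k, Pat (Γ k)

/-- A content of every stack. -/
abbrev Stk (Γ : K → Type) : Type := ∀ k, List (Γ k)

/-- The relation on stack contents defined by a family of patterns. -/
def FRel (f : Fam Γ) (s s' : Stk Γ) : Prop := ∀ k, (f k).Rel (s k) (s' k)

theorem FRel.unique {f : Fam Γ} {s t t' : Stk Γ} (h : FRel f s t) (h' : FRel f s t') : t = t' :=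
  funext fun k => (h k).unique (h' k)

theorem FRel.unique' {f : Fam Γ} {s s' t : Stk Γ} (h : FRel f s t) (h' : FRel f s' t) : s = s' :=
  funext fun k => (h k).unique' (h' k)

/-- Composition of the relations of a list of families. -/
def LRel : List (Fam Γ) → Stk Γ → Stk Γ → Prop
  | [], s, s' => s' = s
  | f :: fs, s, s' => ∃ m, FRel f s m ∧ LRel fs m s'

theorem lrel_append {fs gs : List (Fam Γ)} {s s' : Stk Γ} :
    LRel (fs ++ gs) s s' ↔ ∃ m, LRel fs s m ∧ LRel gs m s' := by
  induction fs generalizing s with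
  | nil => simp [LRel]
  | cons p ps ih =>
    simp only [List.cons_append, LRel, ih]
    constructor
    · rintro ⟨m, h1, m', h2, h3⟩
      exact ⟨m', ⟨m, h1, h2⟩, h3⟩
    · rintro ⟨m', ⟨m, h1, h2⟩, h3⟩
      exact ⟨m, h1, m', h2, h3⟩

theorem lrel_singleton {f : Fam Γ} {s s' : Stk Γ} : LRel [f] s s' ↔ FRel f s s' := by
  simp [LRel]

/-- The family acting on one stack only. -/
noncomputable def single (k : K) (p : Pat (Γ k)) : Fam Γ :=
  Function.update (fun _ => Pat.idle) k p

@[simp] theorem single_self (k : K) (p : Pat (Γ k)) : single k p k = p := by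
  simp [single]

theorem single_of_ne {k j : K} (p : Pat (Γ k)) (h : j ≠ k) : single k p j = Pat.idle := by
  simp [single, h]

theorem frel_single {k : K} {p : Pat (Γ k)} {s s' : Stk Γ} :
    FRel (single k p) s s' ↔ p.Rel (s k) (s' k) ∧ ∀ j, j ≠ k → s' j = s j := by
  constructor
  · intro h
    refine ⟨by simpa using h k, fun j hj => ?_⟩
    have := h j
    rwa [single_of_ne p hj, Pat.rel_idle] at this
  · rintro ⟨h1, h2⟩ j
    by_cases hj : j = k
    · subst hj
      simpa using h1
    · rw [single_of_ne p hj, Pat.rel_idle]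
      exact h2 j hj

theorem lrel_map_single {k : K} {ps : List (Pat (Γ k))} {s s' : Stk Γ} :
    LRel (ps.map (single k)) s s' ↔ Pat.LRel ps (s k) (s' k) ∧ ∀ j, j ≠ k → s' j = s j := by
  induction ps generalizing s with
  | nil =>
    simp only [List.map_nil, LRel, Pat.LRel]
    constructor
    · rintro rfl
      simp
    · rintro ⟨h1, h2⟩
      funext j
      by_cases hj : j = k
      · subst hj
        exact h1
      · exact h2 j hj
  | cons p ps ih =>
    simp only [List.map_cons, LRel, Pat.LRel, ih, frel_single]
    constructor
    · rintro ⟨m, ⟨h1, h2⟩, h3, h4⟩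
      exact ⟨⟨_, h1, h3⟩, fun j hj => (h4 j hj).trans (h2 j hj)⟩
    · rintro ⟨⟨m, h1, h2⟩, h3⟩
      refine ⟨Function.update s k m, ⟨by simpa using h1, fun j hj => by simp [hj]⟩,
        by simpa using h2, fun j hj => by simp [hj, h3 j hj]⟩

/-- Decomposition of a family, restricted to a list of stacks, into families
involving at most one letter. -/
noncomputable def splitOn (f : Fam Γ) (ks : List K) : List (Fam Γ) :=
  ks.flatMap fun k => (f k).split.map (single k)

theorem lrel_splitOn {f : Fam Γ} {ks : List K} (hk : ks.Nodup) {s s' : Stk Γ} :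
    LRel (splitOn f ks) s s' ↔
      (∀ k ∈ ks, (f k).Rel (s k) (s' k)) ∧ ∀ k, k ∉ ks → s' k = s k := by
  induction ks generalizing s with
  | nil =>
    simp only [splitOn, List.flatMap_nil, LRel]
    simp [funext_iff]
  | cons k ks ih =>
    rw [List.nodup_cons] at hk
    have h0 : splitOn f (k :: ks) = (f k).split.map (single k) ++ splitOn f ks := rfl
    simp only [h0, lrel_append, lrel_map_single, ih hk.2, Pat.lrel_split]
    constructor
    · rintro ⟨m, ⟨h1, h2⟩, h3, h4⟩
      constructor
      · intro j hj
        rcases List.mem_cons.1 hj with rfl | hj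
        · rw [h4 _ hk.1]
          exact h1
        · have : j ≠ k := fun h => hk.1 (h ▸ hj)
          rw [← h2 j this]
          exact h3 j hj
      · intro j hj
        rw [List.mem_cons, not_or] at hj
        rw [h4 j hj.2, h2 j hj.1]
    · rintro ⟨h1, h2⟩
      refine ⟨Function.update s k (s' k), ⟨by simpa using h1 k (by simp),
        fun j hj => by simp [hj]⟩, ?_, ?_⟩
      · intro j hj
        have : j ≠ k := fun h => hk.1 (h ▸ hj)
        simpa [this] using h1 j (by simp [hj])
      · intro j hj
        by_cases hjk : j = k
        · subst hjk
          simp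
        · simpa [hjk] using h2 j (by simp [hj, hjk])

variable [Fintype K]

/-- Decomposition of a family into families involving at most one letter. -/
noncomputable def splitFam (f : Fam Γ) : List (Fam Γ) := splitOn f Finset.univ.toList

theorem lrel_splitFam {f : Fam Γ} {s s' : Stk Γ} : LRel (splitFam f) s s' ↔ FRel f s s' := by
  rw [splitFam, lrel_splitOn (Finset.nodup_toList _)]
  simp [FRel]

/-- The number of letters involved in a family. -/
def letters (f : Fam Γ) : ℕ := ∑ k, (f k).letters

theorem letters_single (k : K) (p : Pat (Γ k)) : letters (single k p) = p.letters := by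
  unfold letters
  rw [Finset.sum_eq_single k]
  · simp
  · intro j _ hj
    rw [single_of_ne p hj]
    rfl
  · simp

theorem letters_splitFam {f g : Fam Γ} (h : g ∈ splitFam f) : letters g ≤ 1 := by
  simp only [splitFam, splitOn, List.mem_flatMap, List.mem_map] at h
  obtain ⟨k, -, p, hp, rfl⟩ := h
  rw [letters_single]
  exact Pat.letters_split hp

/-- Total number of letters on the stacks. -/
def ssize (s : Stk Γ) : ℕ := ∑ k, (s k).length

/-- The change of the total number of letters. -/
def fnet (f : Fam Γ) : ℤ := ∑ k, (((f k).post.length : ℤ) - (f k).pre.length)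

theorem FRel.ssize {f : Fam Γ} {s s' : Stk Γ} (h : FRel f s s') :
    (ssize s' : ℤ) = ssize s + fnet f := by
  simp only [Olsh.ssize, fnet, Nat.cast_sum, ← Finset.sum_add_distrib]
  exact Finset.sum_congr rfl fun k _ => (h k).length

theorem LRel.ssize {fs : List (Fam Γ)} {s s' : Stk Γ} (h : LRel fs s s') :
    (ssize s' : ℤ) = ssize s + (fs.map fnet).sum := by
  induction fs generalizing s with
  | nil =>
    obtain rfl : s' = s := h
    simp
  | cons f fs ih =>
    obtain ⟨m, h1, h2⟩ := h
    rw [ih h2, h1.ssize]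
    simp
    ring

theorem length_le_ssize (s : Stk Γ) (k : K) : (s k).length ≤ ssize s :=
  Finset.single_le_sum (f := fun k => (s k).length) (fun _ _ => Nat.zero_le _) (Finset.mem_univ k)

theorem ssize_eq_zero {s : Stk Γ} : ssize s = 0 ↔ s = fun _ => [] := by
  simp [ssize, funext_iff]

theorem fnet_single (k : K) (p : Pat (Γ k)) :
    fnet (single k p) = (p.post.length : ℤ) - p.pre.length := by
  unfold fnet
  rw [Finset.sum_eq_single k]
  · simp
  · intro j _ hj
    rw [single_of_ne p hj]
    simp [Pat.idle]
  · simp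

end Families

/-- A system of rewriting rules with states acting on a family of stacks. -/
structure Rules (K : Type) (Γ : K → Type) (Q : Type) (ι : Type) where
  src : ι → Q
  dst : ι → Q
  fam : ι → Fam Γ

namespace Rules

variable {K : Type} {Γ : K → Type} {Q ι : Type} (R : Rules K Γ Q ι)

/-- Application of one rule. -/
def Step (i : ι) (a b : Q × Stk Γ) : Prop :=
  a.1 = R.src i ∧ b.1 = R.dst i ∧ FRel (R.fam i) a.2 b.2

/-- Application of a rule or of the inverse of a rule. -/
def Adj (a b : Q × Stk Γ) : Prop := ∃ i, R.Step i a b ∨ R.Step i b a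

/-- Connectedness. -/
def Conn : Q × Stk Γ → Q × Stk Γ → Prop := Relation.ReflTransGen R.Adj

variable {R}

theorem Adj.symm {a b : Q × Stk Γ} (h : R.Adj a b) : R.Adj b a := by
  obtain ⟨i, h⟩ := h
  exact ⟨i, h.symm⟩

theorem Conn.symm {a b : Q × Stk Γ} (h : R.Conn a b) : R.Conn b a := by
  induction h with
  | refl => exact .refl
  | tail _ h ih => exact .head h.symm ih

variable (R) [Fintype K]

/-- A step in bounded space. -/
def AdjW (s : ℕ) (a b : Q × Stk Γ) : Prop := R.Adj a b ∧ ssize a.2 ≤ s ∧ ssize b.2 ≤ s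

/-- Connectedness in bounded space. -/
def ConnW (s : ℕ) : Q × Stk Γ → Q × Stk Γ → Prop := Relation.ReflTransGen (R.AdjW s)

variable {R}

theorem AdjW.symm {s : ℕ} {a b : Q × Stk Γ} (h : R.AdjW s a b) : R.AdjW s b a :=
  ⟨h.1.symm, h.2.2, h.2.1⟩

theorem ConnW.symm {s : ℕ} {a b : Q × Stk Γ} (h : R.ConnW s a b) : R.ConnW s b a := by
  induction h with
  | refl => exact .refl
  | tail _ h ih => exact .head h.symm ih

theorem ConnW.mono {s t : ℕ} (hst : s ≤ t) {a b : Q × Stk Γ} (h : R.ConnW s a b) :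
    R.ConnW t a b := by
  induction h with
  | refl => exact .refl
  | tail _ h ih => exact .tail ih ⟨h.1, h.2.1.trans hst, h.2.2.trans hst⟩

end Rules

end StackPrograms

section ToTM

open scoped Classical

variable {K : Type} {Γ : K → Type} {Q ι X : Type}

/-- The command part simulating a pattern; the stack is stored to the left of the head,
with its top next to the head. -/
def patCmd {A : Type} (q q' : Q) (p : Pat A) : CmdPart Q A :=
  ⟨q, q', p.pre.reverse, [], p.post.reverse, [], p.anch, true⟩

theorem patCmd_applies {A : Type} {q q' : Q} {p : Pat A} {c c' : List A × Q × List A} :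
    (patCmd q q' p).Applies c c' ↔ ∃ l l', p.Rel l l' ∧
      c = (l.reverse, q, []) ∧ c' = (l'.reverse, q', []) := by
  obtain ⟨x, y, z⟩ := c
  obtain ⟨x', y', z'⟩ := c'
  simp only [CmdPart.Applies, patCmd, Pat.Rel, Prod.mk.injEq]
  constructor
  · rintro ⟨rfl, rfl, a, b, h1, h2, rfl, rfl, rfl, rfl⟩
    refine ⟨p.pre ++ a.reverse, p.post ++ a.reverse, ⟨a.reverse, ?_, rfl, rfl⟩, ?_, ?_⟩
    · simpa using h1
    · simpa using h2
    · simpa using h2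
  · rintro ⟨l, l', ⟨a, h1, rfl, rfl⟩, ⟨rfl, rfl, rfl⟩, rfl, rfl, rfl⟩
    exact ⟨rfl, rfl, a.reverse, [], by simpa using h1, by simp, by simp⟩

/-- The symmetric Turing machine of a system of rules. -/
def Rules.toTM [Fintype K] (R : Rules K Γ Q ι) (hQ : Finite Q) (hΓ : ∀ k, Finite (Γ k))
    (hX : Finite X) (hι : Finite ι) (inp : K) (emb : X → Γ inp) (start acc : Q) : TM K X where
  finT := inferInstance
  Q := fun _ => Q
  Y := Γ
  finQ := fun _ => hQ
  finY := hΓ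
  finX := hX
  inputTape := inp
  emb := emb
  ι := ι × Bool
  finι := inferInstance
  cmds := fun t k => if t.2 then patCmd (R.dst t.1) (R.src t.1) (R.fam t.1 k).inv
    else patCmd (R.src t.1) (R.dst t.1) (R.fam t.1 k)
  startQ := fun _ => start
  acceptQ := fun _ => acc

/-- The initial stacks on an input word. -/
noncomputable def iniStk (inp : K) (emb : X → Γ inp) (u : List X) : Stk Γ :=
  Function.update (fun _ => []) inp (u.map emb).reverse

namespace Rules

variable [Fintype K] (R : Rules K Γ Q ι) (hQ : Finite Q) (hΓ : ∀ k, Finite (Γ k))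
    (hX : Finite X) (hι : Finite ι) (inp : K) (emb : X → Γ inp) (start acc : Q)

local notation "𝓜" => R.toTM hQ hΓ hX hι inp emb start acc

/-- Stack configurations as configurations of the Turing machine. -/
def toConf (a : Q × Stk Γ) : (𝓜).Conf := fun k => ((a.2 k).reverse, a.1, [])

theorem toConf_injective : Function.Injective (R.toConf hQ hΓ hX hι inp emb start acc) := by
  intro a b h
  have h1 : ∀ k, ((a.2 k).reverse, a.1, ([] : List (Γ k))) = ((b.2 k).reverse, b.1, []) :=
    fun k => congrFun h k
  refine Prod.ext ?_ (funext fun k => ?_)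
  · have := h1 inp
    simp only [Prod.mk.injEq] at this
    exact this.2.1
  · have := h1 k
    simp only [Prod.mk.injEq, List.reverse_inj] at this
    exact this.1

theorem toTM_step {c d : (𝓜).Conf} : (𝓜).Step c d ↔ ∃ a b, R.Adj a b ∧
    c = R.toConf hQ hΓ hX hι inp emb start acc a ∧
    d = R.toConf hQ hΓ hX hι inp emb start acc b := by
  have key : ∀ (q q' : Q) (f : Fam Γ), (∀ k, (patCmd q q' (f k)).Applies (c k) (d k)) ↔
      ∃ s s', FRel f s s' ∧ c = R.toConf hQ hΓ hX hι inp emb start acc (q, s) ∧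
        d = R.toConf hQ hΓ hX hι inp emb start acc (q', s') := by
    intro q q' f
    constructor
    · intro h
      choose s s' h1 h2 h3 using fun k => patCmd_applies.1 (h k)
      exact ⟨s, s', h1, funext h2, funext h3⟩
    · rintro ⟨s, s', h1, rfl, rfl⟩ k
      exact patCmd_applies.2 ⟨_, _, h1 k, rfl, rfl⟩
  constructor
  · rintro ⟨⟨i, b⟩, h⟩
    cases b with
    | false =>
      obtain ⟨s, s', h1, h2, h3⟩ := (key (R.src i) (R.dst i) (R.fam i)).1 (fun k => h k)
      exact ⟨_, _, ⟨i, .inl ⟨rfl, rfl, h1⟩⟩, h2, h3⟩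
    | true =>
      obtain ⟨s, s', h1, h2, h3⟩ :=
        (key (R.dst i) (R.src i) (fun k => (R.fam i k).inv)).1 (fun k => h k)
      exact ⟨_, _, ⟨i, .inr ⟨rfl, rfl, fun k => Pat.rel_inv.1 (h1 k)⟩⟩, h2, h3⟩
  · rintro ⟨⟨q, s⟩, ⟨q', s'⟩, ⟨i, ⟨h1, h2, h3⟩ | ⟨h1, h2, h3⟩⟩, h4, h5⟩
    · obtain rfl : q = _ := h1
      obtain rfl : q' = _ := h2
      exact ⟨(i, false), (key _ _ (R.fam i)).2 ⟨s, s', h3, h4, h5⟩⟩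
    · obtain rfl : q' = _ := h1
      obtain rfl : q = _ := h2
      exact ⟨(i, true), (key _ _ (fun k => (R.fam i k).inv)).2
        ⟨s, s', fun k => Pat.rel_inv.2 (h3 k), h4, h5⟩⟩

theorem toTM_cSpace (a : Q × Stk Γ) :
    (𝓜).cSpace (R.toConf hQ hΓ hX hι inp emb start acc a) = ssize a.2 := by
  unfold TM.cSpace ssize
  exact Finset.sum_congr rfl fun k _ => List.length_reverse (as := a.2 k)

theorem toTM_inputConf (u : List X) : (𝓜).inputConf u =
    R.toConf hQ hΓ hX hι inp emb start acc (start, iniStk inp emb u) := by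
  funext k
  by_cases hk : k = inp
  · subst hk
    simp only [TM.inputConf, toConf, iniStk, Function.update_self, List.reverse_reverse]
    exact Function.update_self _ _ _
  · simp only [toConf, iniStk, Function.update_of_ne hk, List.reverse_nil]
    exact Function.update_of_ne hk _ _

theorem toTM_acceptConf : (𝓜).acceptConf =
    R.toConf hQ hΓ hX hι inp emb start acc (acc, fun _ => []) := rfl

theorem toTM_symmetric : (𝓜).SymmetricTM := by
  rintro ⟨i, b⟩
  refine ⟨(i, !b), fun k => ?_⟩
  cases b <;> rfl

theorem toTM_cmdLetters (h : ∀ i, letters (R.fam i) ≤ 1) (t : (𝓜).ι) : (𝓜).cmdLetters t ≤ 1 := by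
  obtain ⟨i, b⟩ := t
  refine le_trans (le_of_eq ?_) (h i)
  unfold TM.cmdLetters letters
  refine Finset.sum_congr rfl fun k _ => ?_
  cases b
  · simp [toTM, patCmd, Pat.letters]
  · simp [toTM, patCmd, Pat.letters, Pat.inv]
    exact Nat.add_comm _ _

end Rules

end ToTM

section ListPaths

variable {α : Type}

theorem exists_chain_iff {r : α → α → Prop} {P : α → Prop} {a b : α} :
    (∃ cs : List α, cs.head? = some a ∧ cs.getLast? = some b ∧ cs.IsChain r ∧ ∀ d ∈ cs, P d) ↔
      P a ∧ Relation.ReflTransGen (fun x y => r x y ∧ P x ∧ P y) a b := by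
  constructor
  · rintro ⟨cs, h1, h2, h3, h4⟩
    induction cs generalizing a with
    | nil => simp at h1
    | cons c cs ih =>
      simp only [List.head?_cons, Option.some.injEq] at h1
      subst h1
      refine ⟨h4 _ (by simp), ?_⟩
      cases cs with
      | nil =>
        simp only [List.getLast?_singleton, Option.some.injEq] at h2
        subst h2
        exact .refl
      | cons d cs =>
        have h5 := List.isChain_cons_cons.1 h3
        exact .head ⟨h5.1, h4 _ (by simp), h4 _ (by simp)⟩
          (ih rfl (by simpa using h2) h5.2 (fun e he => h4 e (by simp [he]))).2
  · rintro ⟨h0, h⟩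
    induction h using Relation.ReflTransGen.head_induction_on with
    | refl => exact ⟨[b], rfl, rfl, by simp, by simpa using h0⟩
    | @head a c h1 _ ih =>
      obtain ⟨cs, h2, h3, h4, h5⟩ := ih h1.2.2
      refine ⟨a :: cs, rfl, ?_, ?_, ?_⟩
      · cases cs with
        | nil => simp at h2
        | cons d cs => simpa using h3
      · cases cs with
        | nil => simp at h2
        | cons d cs =>
          simp only [List.head?_cons, Option.some.injEq] at h2
          subst h2
          exact List.isChain_cons_cons.2 ⟨h1.1, h4⟩
      · intro d hd
        rcases List.mem_cons.1 hd with rfl | hd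
        · exact h0
        · exact h5 d hd

theorem TM.acceptsWithin_iff {T X : Type} (M : TM T X) (c : M.Conf) (s : ℕ) :
    M.AcceptsWithin c s ↔ M.cSpace c ≤ s ∧
      Relation.ReflTransGen (fun x y => M.Step x y ∧ M.cSpace x ≤ s ∧ M.cSpace y ≤ s)
        c M.acceptConf :=
  exists_chain_iff

theorem TM.AcceptsWithin.mono {T X : Type} {M : TM T X} {c : M.Conf} {s t : ℕ}
    (h : M.AcceptsWithin c s) (hst : s ≤ t) : M.AcceptsWithin c t := by
  obtain ⟨cs, h1, h2, h3, h4⟩ := h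
  exact ⟨cs, h1, h2, h3, fun d hd => (h4 d hd).trans hst⟩

end ListPaths

namespace Rules

variable {K : Type} {Γ : K → Type} {Q ι X : Type}
variable [Fintype K] (R : Rules K Γ Q ι) (hQ : Finite Q) (hΓ : ∀ k, Finite (Γ k))
    (hX : Finite X) (hι : Finite ι) (inp : K) (emb : X → Γ inp) (start acc : Q)

local notation "𝓜" => R.toTM hQ hΓ hX hι inp emb start acc

theorem toTM_acceptsWithin (a : Q × Stk Γ) (s : ℕ) :
    (𝓜).AcceptsWithin (R.toConf hQ hΓ hX hι inp emb start acc a) s ↔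
      ssize a.2 ≤ s ∧ R.ConnW s a (acc, fun _ => []) := by
  rw [TM.acceptsWithin_iff, toTM_cSpace, and_congr_right_iff]
  intro _
  rw [toTM_acceptConf]
  constructor
  · intro h
    generalize hc : R.toConf hQ hΓ hX hι inp emb start acc a = c at h
    induction h using Relation.ReflTransGen.head_induction_on generalizing a with
    | refl =>
      rw [toConf_injective _ _ _ _ _ _ _ _ _ hc]
      exact .refl
    | @head c d h1 _ ih =>
      obtain ⟨h1, h4, h5⟩ := h1
      obtain ⟨a', b, h2, h3, rfl⟩ := (R.toTM_step ..).1 h1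
      obtain rfl := toConf_injective _ _ _ _ _ _ _ _ _ (hc.trans h3)
      subst hc
      rw [toTM_cSpace] at h4 h5
      exact .head ⟨h2, h4, h5⟩ (ih b h5 rfl)
  · intro h
    refine Relation.ReflTransGen.lift (R.toConf hQ hΓ hX hι inp emb start acc) ?_ _ _ h
    intro x y hxy
    exact ⟨(R.toTM_step hQ hΓ hX hι inp emb start acc).2 ⟨x, y, hxy.1, rfl, rfl⟩,
      by rw [toTM_cSpace]; exact hxy.2.1, by rw [toTM_cSpace]; exact hxy.2.2⟩

theorem toTM_accepts_range {c : (𝓜).Conf} (h : (𝓜).AcceptsConf c) :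
    ∃ a, c = R.toConf hQ hΓ hX hι inp emb start acc a := by
  obtain ⟨s, h⟩ := h
  have h := ((𝓜).acceptsWithin_iff c s).1 h
  rcases Relation.ReflTransGen.cases_head h.2 with h | ⟨d, h, -⟩
  · exact ⟨_, h.trans (toTM_acceptConf ..)⟩
  · obtain ⟨a, b, -, h3, -⟩ := (R.toTM_step ..).1 h.1
    exact ⟨a, h3⟩

end Rules

section Wrapper

open scoped Classical

variable {K : Type} {Γ : K → Type}

/-- The stack alphabets enlarged by a marker stack. -/
abbrev WAlph (Γ : K → Type) : Option K → Type
  | none => Unit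
  | some k => Γ k

/-- Stack contents together with a content of the marker stack. -/
def wstk (m : List Unit) (s : Stk Γ) : Stk (WAlph Γ)
  | none => m
  | some k => s k

/-- A family together with a pattern on the marker stack. -/
def wfam (p : Pat Unit) (f : Fam Γ) : Fam (WAlph Γ)
  | none => p
  | some k => f k

/-- The idle family. -/
def idleFam : Fam Γ := fun _ => Pat.idle

/-- The family testing all stacks for emptiness. -/
def testFam : Fam Γ := fun _ => Pat.test

theorem frel_idleFam {s s' : Stk Γ} : FRel idleFam s s' ↔ s' = s := by
  simp [FRel, idleFam, funext_iff]

theorem frel_testFam {s s' : Stk Γ} : FRel testFam s s' ↔ s = (fun _ => []) ∧ s' = fun _ => [] := by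
  simp [FRel, testFam, funext_iff, forall_and]

theorem exists_wstk (σ : Stk (WAlph Γ)) : ∃ m s, σ = wstk m s :=
  ⟨σ none, fun k => σ (some k), by funext o; cases o <;> rfl⟩

theorem frel_wfam {p : Pat Unit} {f : Fam Γ} {m m' : List Unit} {s s' : Stk Γ} :
    FRel (wfam p f) (wstk m s) (wstk m' s') ↔ p.Rel m m' ∧ FRel f s s' := by
  constructor
  · intro h
    exact ⟨h none, fun k => h (some k)⟩
  · rintro ⟨h1, h2⟩ o
    cases o
    · exact h1
    · exact h2 _

theorem wstk_inj {m m' : List Unit} {s s' : Stk Γ} : wstk m s = wstk m' s' ↔ m = m' ∧ s = s' := by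
  constructor
  · intro h
    exact ⟨congrFun h none, funext fun k => congrFun h (some k)⟩
  · rintro ⟨rfl, rfl⟩
    rfl

theorem wstk_nil : wstk [] (fun _ => [] : Stk Γ) = fun _ => [] := by
  funext o
  cases o <;> rfl

variable [Fintype K]

theorem ssize_wstk (m : List Unit) (s : Stk Γ) : ssize (wstk m s) = m.length + ssize s := by
  simp only [ssize, Fintype.sum_option]
  rfl

theorem letters_wfam (p : Pat Unit) (f : Fam Γ) : Olsh.letters (wfam p f) = p.letters + Olsh.letters f := by
  simp only [Olsh.letters, Fintype.sum_option]
  rfl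

theorem letters_idleFam : Olsh.letters (idleFam : Fam Γ) = 0 := by
  simp [Olsh.letters, idleFam, Pat.letters, Pat.idle]

theorem letters_testFam : Olsh.letters (testFam : Fam Γ) = 0 := by
  simp [Olsh.letters, testFam, Pat.letters, Pat.test]

theorem ssize_update (s : Stk Γ) (k : K) (l : List (Γ k)) :
    ssize (Function.update s k l) + (s k).length = ssize s + l.length := by
  simp only [ssize, ← Finset.add_sum_erase _ _ (Finset.mem_univ k), Function.update_self]
  have : ∑ x ∈ Finset.univ.erase k, (Function.update s k l x).length =
      ∑ x ∈ Finset.univ.erase k, (s x).length :=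
    Finset.sum_congr rfl fun x hx => by rw [Function.update_of_ne (Finset.ne_of_mem_erase hx)]
  rw [this]
  omega

variable {Q ι : Type} (R : Rules K Γ Q ι)

/-- The elementary operations simulating a rule. -/
noncomputable def Rules.ops (i : ι) : List (Fam Γ) := splitFam (R.fam i)

/-- States of the wrapped system. -/
inductive WState : Type
  | start
  | pre
  | fin
  | acc
  | usr (q : Q)
  | mid (i : ι) (j : Fin ((R.ops i).length + 1))

variable (pad : K → Bool) (hs : Prop)

/-- Rules of the wrapped system. -/
inductive WRule : Type
  | mark
  | pad (k : {k // pad k = true}) (x : Γ k)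
  | enter
  | go (i : ι)
  | mic (i : ι) (j : Fin (R.ops i).length)
  | ret (i : ι)
  | leave
  | unmark
  | erase (k : K) (x : Γ k)
  | done
  | short (h : hs)

/-- The family testing the stacks that are neither the input nor padding. -/
noncomputable def enterFam (inp : K) : Fam Γ :=
  fun k => if k ≠ inp ∧ pad k = false then Pat.test else Pat.idle

theorem frel_enterFam {inp : K} {s s' : Stk Γ} :
    FRel (enterFam pad inp) s s' ↔ s' = s ∧ ∀ k, k ≠ inp → pad k = false → s k = [] := by
  constructor
  · intro h
    have h1 : ∀ k, s' k = s k ∧ (k ≠ inp → pad k = false → s k = []) := by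
      intro k
      have h2 := h k
      unfold enterFam at h2
      split_ifs at h2 with h3
      · rw [Pat.rel_test] at h2
        exact ⟨h2.2.trans h2.1.symm, fun _ _ => h2.1⟩
      · rw [Pat.rel_idle] at h2
        exact ⟨h2, fun h4 h5 => absurd ⟨h4, h5⟩ h3⟩
    exact ⟨funext fun k => (h1 k).1, fun k => (h1 k).2⟩
  · rintro ⟨rfl, h⟩ k
    unfold enterFam
    split_ifs with h3
    · simpa using h k h3.1 h3.2
    · simp

variable (inp : K) (qin qout : Q)

/-- The wrapped system: it places a marker, pads some stacks, runs the original system from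
`qin` to `qout`, removes the marker, erases everything and accepts. -/
noncomputable def wrap :
    Rules (Option K) (WAlph Γ) (WState R) (WRule R pad hs) where
  src
    | .mark => .start
    | .pad _ _ => .pre
    | .enter => .pre
    | .go i => .usr (R.src i)
    | .mic i j => .mid i j.castSucc
    | .ret i => .mid i (Fin.last _)
    | .leave => .usr qout
    | .unmark => .fin
    | .erase _ _ => .fin
    | .done => .fin
    | .short _ => .start
  dst
    | .mark => .pre
    | .pad _ _ => .pre
    | .enter => .usr qin
    | .go i => .mid i 0
    | .mic i j => .mid i j.succ
    | .ret i => .usr (R.dst i)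
    | .leave => .fin
    | .unmark => .fin
    | .erase _ _ => .fin
    | .done => .acc
    | .short _ => .acc
  fam
    | .mark => wfam (Pat.push ()) idleFam
    | .pad k x => wfam Pat.idle (single k.1 (Pat.push x))
    | .enter => wfam Pat.idle (enterFam pad inp)
    | .go _ => wfam Pat.idle idleFam
    | .mic i j => wfam Pat.idle (R.ops i)[j]
    | .ret _ => wfam Pat.idle idleFam
    | .leave => wfam (Pat.pop ()) idleFam
    | .unmark => wfam (Pat.pop ()) idleFam
    | .erase k x => wfam Pat.idle (single k (Pat.pop x))
    | .done => wfam Pat.test testFam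
    | .short _ => wfam Pat.test testFam

instance [Finite Q] [Finite ι] : Finite (WState R) := by
  refine Finite.of_surjective
    (fun x : Fin 4 ⊕ Q ⊕ (Σ i : ι, Fin ((R.ops i).length + 1)) => match x with
      | .inl 0 => .start
      | .inl 1 => .pre
      | .inl 2 => .fin
      | .inl 3 => .acc
      | .inr (.inl q) => .usr q
      | .inr (.inr ⟨i, j⟩) => .mid i j) ?_
  rintro (_ | _ | _ | _ | q | ⟨i, j⟩)
  · exact ⟨.inl 0, rfl⟩
  · exact ⟨.inl 1, rfl⟩
  · exact ⟨.inl 2, rfl⟩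
  · exact ⟨.inl 3, rfl⟩
  · exact ⟨.inr (.inl q), rfl⟩
  · exact ⟨.inr (.inr ⟨i, j⟩), rfl⟩

instance [∀ k, Finite (Γ k)] [Finite ι] : Finite (WRule R pad hs) := by
  refine Finite.of_surjective
    (fun x : Fin 5 ⊕ (Σ k : {k // pad k = true}, Γ k) ⊕ (Σ k : K, Γ k) ⊕ (ι ⊕ ι) ⊕
        (Σ i : ι, Fin (R.ops i).length) ⊕ PLift hs => match x with
      | .inl 0 => .mark
      | .inl 1 => .enter
      | .inl 2 => .leave
      | .inl 3 => .unmark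
      | .inl 4 => .done
      | .inr (.inl ⟨k, x⟩) => .pad k x
      | .inr (.inr (.inl ⟨k, x⟩)) => .erase k x
      | .inr (.inr (.inr (.inl (.inl i)))) => .go i
      | .inr (.inr (.inr (.inl (.inr i)))) => .ret i
      | .inr (.inr (.inr (.inr (.inl ⟨i, j⟩)))) => .mic i j
      | .inr (.inr (.inr (.inr (.inr h)))) => .short h.1) ?_
  rintro (_ | ⟨k, x⟩ | _ | i | ⟨i, j⟩ | i | _ | _ | ⟨k, x⟩ | _ | h)
  · exact ⟨.inl 0, rfl⟩
  · exact ⟨.inr (.inl ⟨k, x⟩), rfl⟩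
  · exact ⟨.inl 1, rfl⟩
  · exact ⟨.inr (.inr (.inr (.inl (.inl i)))), rfl⟩
  · exact ⟨.inr (.inr (.inr (.inr (.inl ⟨i, j⟩)))), rfl⟩
  · exact ⟨.inr (.inr (.inr (.inl (.inr i)))), rfl⟩
  · exact ⟨.inl 2, rfl⟩
  · exact ⟨.inl 3, rfl⟩
  · exact ⟨.inr (.inr (.inl ⟨k, x⟩)), rfl⟩
  · exact ⟨.inl 4, rfl⟩
  · exact ⟨.inr (.inr (.inr (.inr (.inr ⟨h⟩)))), rfl⟩

theorem wrap_letters (e : WRule R pad hs) :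
    Olsh.letters ((wrap R pad hs inp qin qout).fam e) ≤ 1 := by
  have h1 : Olsh.letters (enterFam pad inp : Fam Γ) = 0 := by
    refine Finset.sum_eq_zero fun k _ => ?_
    unfold enterFam
    split_ifs <;> rfl
  rcases e with (_ | ⟨k, x⟩ | _ | i | ⟨i, j⟩ | i | _ | _ | ⟨k, x⟩ | _ | h) <;>
    simp only [wrap, letters_wfam, letters_idleFam, letters_testFam, letters_single, h1] <;>
    try simp [Pat.letters, Pat.push, Pat.pop, Pat.idle, Pat.test]
  exact letters_splitFam (List.getElem_mem _)

/-- The step relation of the wrapped system, in one direction. -/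
inductive WStep : WState R → List Unit → Stk Γ → WState R → List Unit → Stk Γ → Prop
  | mark (m s) : WStep .start m s .pre (() :: m) s
  | pad (k) (hk : pad k = true) (x : Γ k) (m s s') (h1 : s' k = x :: s k)
      (h2 : ∀ j, j ≠ k → s' j = s j) : WStep .pre m s .pre m s'
  | enter (m s) (h : ∀ k, k ≠ inp → pad k = false → s k = []) : WStep .pre m s (.usr qin) m s
  | go (i m s) : WStep (.usr (R.src i)) m s (.mid i 0) m s
  | mic (i) (j : Fin (R.ops i).length) (m s s') (h : FRel (R.ops i)[j] s s') :
      WStep (.mid i j.castSucc) m s (.mid i j.succ) m s'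
  | ret (i m s) : WStep (.mid i (Fin.last _)) m s (.usr (R.dst i)) m s
  | leave (m s) : WStep (.usr qout) (() :: m) s .fin m s
  | unmark (m s) : WStep .fin (() :: m) s .fin m s
  | erase (k) (x : Γ k) (m s s') (h1 : s k = x :: s' k)
      (h2 : ∀ j, j ≠ k → s' j = s j) : WStep .fin m s .fin m s'
  | done : WStep .fin [] (fun _ => []) .acc [] (fun _ => [])
  | short (h : hs) : WStep .start [] (fun _ => []) .acc [] (fun _ => [])

theorem exists_wrap_step {q q' : WState R} {m m' : List Unit} {s s' : Stk Γ} :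
    (∃ e, (wrap R pad hs inp qin qout).Step e (q, wstk m s) (q', wstk m' s')) ↔
      WStep R pad hs inp qin qout q m s q' m' s' := by
  constructor
  · rintro ⟨e, h1, h2, h3⟩
    rcases e with (_ | ⟨k, x⟩ | _ | i | ⟨i, j⟩ | i | _ | _ | ⟨k, x⟩ | _ | h) <;>
      simp only [wrap, frel_wfam, Pat.rel_idle, Pat.rel_push, Pat.rel_pop, Pat.rel_test,
        frel_idleFam, frel_testFam, frel_enterFam, frel_single] at h1 h2 h3 <;>
      subst h1 h2
    · obtain ⟨rfl, rfl⟩ := h3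
      exact .mark ..
    · obtain ⟨rfl, h3, h4⟩ := h3
      exact .pad k.1 k.2 x _ _ _ h3 h4
    · obtain ⟨rfl, rfl, h3⟩ := h3
      exact .enter _ _ h3
    · obtain ⟨rfl, rfl⟩ := h3
      exact .go ..
    · obtain ⟨rfl, h3⟩ := h3
      exact .mic _ _ _ _ _ h3
    · obtain ⟨rfl, rfl⟩ := h3
      exact .ret ..
    · obtain ⟨rfl, rfl⟩ := h3
      exact .leave ..
    · obtain ⟨rfl, rfl⟩ := h3
      exact .unmark ..
    · obtain ⟨rfl, h3, h4⟩ := h3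
      exact .erase k x _ _ _ h3 h4
    · obtain ⟨⟨rfl, rfl⟩, rfl, rfl⟩ := h3
      exact .done
    · obtain ⟨⟨rfl, rfl⟩, rfl, rfl⟩ := h3
      exact .short h
  · intro h
    cases h with
    | mark => exact ⟨.mark, rfl, rfl, by simp [wrap, frel_wfam, frel_idleFam]⟩
    | pad k hk x m s s' h1 h2 =>
      refine ⟨.pad ⟨k, hk⟩ x, rfl, rfl, ?_⟩
      simp only [wrap, frel_wfam, frel_single, Pat.rel_idle, Pat.rel_push, true_and]
      exact ⟨h1, h2⟩
    | enter m s h =>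
      refine ⟨.enter, rfl, rfl, ?_⟩
      simp only [wrap, frel_wfam, frel_enterFam, Pat.rel_idle, true_and]
      exact h
    | go i => exact ⟨.go i, rfl, rfl, by simp [wrap, frel_wfam, frel_idleFam]⟩
    | mic i j m s s' h =>
      refine ⟨.mic i j, rfl, rfl, ?_⟩
      simp only [wrap, frel_wfam, Pat.rel_idle, true_and]
      exact h
    | ret i => exact ⟨.ret i, rfl, rfl, by simp [wrap, frel_wfam, frel_idleFam]⟩
    | leave => exact ⟨.leave, rfl, rfl, by simp [wrap, frel_wfam, frel_idleFam]⟩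
    | unmark => exact ⟨.unmark, rfl, rfl, by simp [wrap, frel_wfam, frel_idleFam]⟩
    | erase k x m s s' h1 h2 =>
      refine ⟨.erase k x, rfl, rfl, ?_⟩
      simp only [wrap, frel_wfam, frel_single, Pat.rel_idle, Pat.rel_pop, true_and]
      exact ⟨h1, h2⟩
    | done => exact ⟨.done, rfl, rfl, by simp [wrap, frel_wfam, frel_testFam]⟩
    | short h => exact ⟨.short h, rfl, rfl, by simp [wrap, frel_wfam, frel_testFam]⟩

theorem wrap_adj {q q' : WState R} {m m' : List Unit} {s s' : Stk Γ} :
    (wrap R pad hs inp qin qout).Adj (q, wstk m s) (q', wstk m' s') ↔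
      WStep R pad hs inp qin qout q m s q' m' s' ∨ WStep R pad hs inp qin qout q' m' s' q m s := by
  simp only [Rules.Adj, exists_or, exists_wrap_step]

end Wrapper

section Simulation

open scoped Classical

variable {K : Type} [Fintype K] {Γ : K → Type} {Q ι : Type}

/-- The stack contents from which the simulation of the computation on `u` may start. -/
def IsIni {X : Type} (inp : K) (emb : X → Γ inp) (pad : K → Bool) (u : List X) (s : Stk Γ) : Prop :=
  s inp = (u.map emb).reverse ∧ ∀ k, k ≠ inp → pad k = false → s k = []

/-- A system of rules recognizing, in a way that is robust under inverting the rules, the words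
accepted in the sense of `Acc`, in space controlled by `g`. -/
structure Sim {X : Type} (R : Rules K Γ Q ι) (Acc : List X → ℕ → Prop) (g : ℕ → ℕ) where
  inp : K
  emb : X → Γ inp
  emb_inj : Function.Injective emb
  emb_surj : Function.Surjective emb
  pad : K → Bool
  pad_inp : pad inp = false
  qin : Q
  qout : Q
  corr : Q → ℤ
  C : ℕ
  Inv : ℕ → Q → Stk Γ → Prop
  net : ∀ i, fnet (R.fam i) + corr (R.dst i) = corr (R.src i)
  init : ∀ N u s, IsIni inp emb pad u s → ssize s ≤ N →
    (¬ ∃ t, Acc u t ∧ g t ≤ C * (N + 1)) → Inv N qin s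
  step : ∀ N i s s', FRel (R.fam i) s s' → (Inv N (R.src i) s ↔ Inv N (R.dst i) s')
  back : ∀ N u s, Inv N qin s → IsIni inp emb pad u s → ¬ ∃ t, Acc u t ∧ g t ≤ C * (N + 1)
  final : ∀ N s, ¬ Inv N qout s
  complete : ∀ u t, Acc u t → ∃ s s', IsIni inp emb pad u s ∧ ssize s ≤ C * (g t + 1) ∧
    R.Conn (qin, s) (qout, s')

theorem sum_fnet_ops (R : Rules K Γ Q ι) (i : ι) : ((R.ops i).map fnet).sum = fnet (R.fam i) := by
  have h : FRel (R.fam i) (fun k => (R.fam i k).pre) (fun k => (R.fam i k).post) :=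
    fun k => ⟨[], by simp, by simp, by simp⟩
  have h1 := h.ssize
  have h2 := (lrel_splitFam.2 h).ssize
  unfold Rules.ops
  linarith

namespace Sim

variable {X : Type} {R : Rules K Γ Q ι} {Acc : List X → ℕ → Prop} {g : ℕ → ℕ} (S : Sim R Acc g)

/-- The wrapped system of a simulation. -/
noncomputable abbrev W : Rules (Option K) (WAlph Γ) (WState R) (WRule R S.pad (Acc [] 0)) :=
  wrap R S.pad (Acc [] 0) S.inp S.qin S.qout

/-- Steps of the wrapped system of a simulation. -/
abbrev WS : WState R → List Unit → Stk Γ → WState R → List Unit → Stk Γ → Prop :=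
  WStep R S.pad (Acc [] 0) S.inp S.qin S.qout

/-- The word `u` is accepted in space compatible with the bound `N`. -/
def Good (N : ℕ) (u : List X) : Prop := ∃ t, Acc u t ∧ g t ≤ S.C * (N + 1)

/-- The initial stack contents of a simulation. -/
abbrev Ini (u : List X) (s : Stk Γ) : Prop := IsIni S.inp S.emb S.pad u s

/-- The invariant of the wrapped system. -/
def WInv (N : ℕ) : WState R → Stk Γ → Prop
  | .start, s => ∀ u, S.Ini u s → ¬ S.Good N u
  | .pre, s => ∀ u, S.Ini u s → ¬ S.Good N u
  | .usr q, s => S.Inv N q s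
  | .mid i j, s => (∃ s₀, LRel ((R.ops i).take j) s₀ s ∧ S.Inv N (R.src i) s₀) ∨
      ∃ s₁, LRel ((R.ops i).drop j) s s₁ ∧ S.Inv N (R.dst i) s₁
  | .fin, _ => False
  | .acc, _ => False

theorem ini_congr {u : List X} {s s' : Stk Γ} (h : ∀ k, S.pad k = false → s' k = s k) :
    S.Ini u s' ↔ S.Ini u s := by
  unfold Ini IsIni
  rw [h _ S.pad_inp]
  refine and_congr_right fun _ => forall_congr' fun k => forall_congr' fun _ =>
    forall_congr' fun h2 => ?_
  rw [h k h2]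

theorem ini_exists {s : Stk Γ} (h : ∀ k, k ≠ S.inp → S.pad k = false → s k = []) :
    ∃ u, S.Ini u s := by
  obtain ⟨u, hu⟩ := (List.map_surjective_iff.2 S.emb_surj) (s S.inp).reverse
  exact ⟨u, by rw [hu, List.reverse_reverse], h⟩

theorem winv_step (g0 : g 0 = 0) {N : ℕ} {q q' : WState R} {m m' : List Unit} {s s' : Stk Γ}
    (h : S.WS q m s q' m' s') (hs : ssize s ≤ N) : S.WInv N q s ↔ S.WInv N q' s' := by
  cases h with
  | mark => rfl
  | pad k hk x m s s' h1 h2 =>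
    refine forall_congr' fun u => ?_
    rw [S.ini_congr (s' := s') (s := s)]
    intro j hj
    refine h2 j ?_
    rintro rfl
    rw [hk] at hj
    exact Bool.noConfusion hj
  | enter m s h =>
    constructor
    · intro h1
      obtain ⟨u, hu⟩ := S.ini_exists h
      exact S.init N u s hu hs (h1 u hu)
    · intro h1 u hu
      exact S.back N u s h1 hu
  | go i m s =>
    constructor
    · intro h
      exact .inl ⟨s, by simp [LRel], h⟩
    · rintro (⟨s₀, h1, h2⟩ | ⟨s₁, h1, h2⟩)
      · obtain rfl : s = s₀ := by simpa [LRel] using h1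
        exact h2
      · have h3 : LRel (R.ops i) s s₁ := h1
        exact (S.step N i s s₁ (lrel_splitFam.1 h3)).2 h2
  | mic i j m s s' h =>
    have e1 : (R.ops i).take (j.succ : Fin _).val = (R.ops i).take j ++ [(R.ops i)[j]] := by
      simp
    have e2 : (R.ops i).drop j = (R.ops i)[j] :: (R.ops i).drop (j.succ : Fin _).val := by
      simp
    constructor
    · rintro (⟨s₀, h1, h2⟩ | ⟨s₁, h1, h2⟩)
      · refine .inl ⟨s₀, ?_, h2⟩
        rw [e1, lrel_append]
        exact ⟨s, h1, lrel_singleton.2 h⟩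
      · refine .inr ⟨s₁, ?_, h2⟩
        simp only [Fin.val_castSucc] at h1
        rw [e2] at h1
        obtain ⟨m, h3, h4⟩ := h1
        rw [h.unique h3]
        exact h4
    · rintro (⟨s₀, h1, h2⟩ | ⟨s₁, h1, h2⟩)
      · refine .inl ⟨s₀, ?_, h2⟩
        rw [e1, lrel_append] at h1
        obtain ⟨m, h3, h4⟩ := h1
        rw [h.unique' (lrel_singleton.1 h4)]
        exact h3
      · refine .inr ⟨s₁, ?_, h2⟩
        simp only [Fin.val_castSucc]
        rw [e2]
        exact ⟨s', h, h1⟩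
  | ret i m s =>
    constructor
    · rintro (⟨s₀, h1, h2⟩ | ⟨s₁, h1, h2⟩)
      · have h3 : LRel (R.ops i) s₀ s := by simpa using h1
        exact (S.step N i s₀ s (lrel_splitFam.1 h3)).1 h2
      · obtain rfl : s₁ = s := by simpa [LRel] using h1
        exact h2
    · intro h
      exact .inr ⟨s, by simp [LRel], h⟩
  | leave m s => exact iff_of_false (S.final N s) id
  | unmark => rfl
  | erase => rfl
  | done => rfl
  | short h =>
    refine iff_of_false (fun h1 => h1 [] ⟨rfl, fun _ _ _ => rfl⟩ ⟨0, h, ?_⟩) id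
    rw [g0]
    exact Nat.zero_le _

theorem conn_induction {N : ℕ} {P : WState R → List Unit → Stk Γ → Prop}
    (h0 : P .acc [] fun _ => [])
    (h1 : ∀ q m s q' m' s', (S.WS q m s q' m' s' ∨ S.WS q' m' s' q m s) →
      m.length + ssize s ≤ N → m'.length + ssize s' ≤ N →
      S.W.ConnW N (q', wstk m' s') (.acc, fun _ => []) → P q' m' s' → P q m s)
    {q : WState R} {m : List Unit} {s : Stk Γ}
    (h : S.W.ConnW N (q, wstk m s) (.acc, fun _ => [])) : P q m s := by
  generalize hc : (q, wstk m s) = c at h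
  induction h using Relation.ReflTransGen.head_induction_on generalizing q m s with
  | refl =>
    rw [← wstk_nil, Prod.mk.injEq, wstk_inj] at hc
    obtain ⟨rfl, rfl, rfl⟩ := hc
    exact h0
  | @head c d hcd hd ih =>
    subst hc
    obtain ⟨q', σ⟩ := d
    obtain ⟨m', s', rfl⟩ := exists_wstk σ
    obtain ⟨h2, h3, h4⟩ := hcd
    rw [ssize_wstk] at h3 h4
    exact h1 _ _ _ _ _ _ (wrap_adj _ _ _ _ _ _ |>.1 h2) h3 h4 hd (ih rfl)

theorem sound (g0 : g 0 = 0) {N : ℕ} {q : WState R} {m : List Unit} {s : Stk Γ}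
    (h : S.W.ConnW N (q, wstk m s) (.acc, fun _ => [])) : ¬ S.WInv N q s := by
  refine S.conn_induction (N := N) (P := fun q _ s => ¬ S.WInv N q s) id ?_ h
  rintro q m s q' m' s' (h1 | h1) h2 h3 - h4 h5
  · exact h4 ((S.winv_step g0 h1 (by omega)).1 h5)
  · exact h4 ((S.winv_step g0 h1 (by omega)).2 h5)

theorem sound_pre (g0 : g 0 = 0) {N : ℕ} {q : WState R} (hq : q = .start ∨ q = .pre)
    {m : List Unit} {s : Stk Γ}
    (h : S.W.ConnW N (q, wstk m s) (.acc, fun _ => [])) : ∃ u, S.Ini u s ∧ S.Good N u := by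
  have h1 := S.sound g0 h
  rcases hq with rfl | rfl <;> simpa [WInv] using h1

theorem conn_of_step {N : ℕ} {q q' : WState R} {m m' : List Unit} {s s' : Stk Γ}
    (h : S.WS q m s q' m' s') (h1 : m.length + ssize s ≤ N) (h2 : m'.length + ssize s' ≤ N) :
    S.W.ConnW N (q, wstk m s) (q', wstk m' s') :=
  .single ⟨(wrap_adj _ _ _ _ _ _).2 (.inl h), by rwa [ssize_wstk], by rwa [ssize_wstk]⟩

/-- The number of missing letters in a state of the wrapped system. -/
noncomputable def cr : WState R → ℤ
  | .usr q => S.corr q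
  | .mid i j => S.corr (R.src i) - (((R.ops i).take j).map fnet).sum
  | _ => 0

theorem exists_cr_bound [Finite Q] [Finite ι] : ∃ κ : ℕ, ∀ q, |S.cr q| ≤ κ := by
  obtain ⟨b, hb⟩ := (Set.finite_range fun q => |S.cr q|).bddAbove
  refine ⟨b.toNat, fun q => ?_⟩
  have : |S.cr q| ≤ b := hb ⟨q, rfl⟩
  omega

/-- The states of the wrapped system belonging to the original system. -/
def IsUsr : WState R → Prop
  | .usr _ => True
  | .mid _ _ => True
  | _ => False

/-- Conservation of the weight. -/
theorem step_weight {q q' : WState R} {m m' : List Unit} {s s' : Stk Γ}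
    (h : S.WS q m s q' m' s') (hq : IsUsr q) (hq' : IsUsr q') :
    m' = m ∧ (ssize s' : ℤ) + S.cr q' = ssize s + S.cr q := by
  cases h with
  | mark => exact hq.elim
  | pad => exact hq.elim
  | enter => exact hq.elim
  | go i m s => simp [cr]
  | mic i j m s s' h =>
    refine ⟨rfl, ?_⟩
    rw [h.ssize]
    simp only [cr]
    have e1 : (R.ops i).take (j.succ : Fin _).val = (R.ops i).take j ++ [(R.ops i)[j]] := by
      simp
    rw [e1]
    simp
    ring
  | ret i m s =>
    refine ⟨rfl, ?_⟩
    have := S.net i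
    rw [← sum_fnet_ops] at this
    simp only [cr, Fin.val_last, List.take_length]
    linarith
  | leave => exact hq'.elim
  | unmark => exact hq.elim
  | erase => exact hq.elim
  | done => exact hq.elim
  | short => exact hq.elim

theorem usr_step {κ : ℕ} (hκ : ∀ q, |S.cr q| ≤ κ) {i : ι} {s s' : Stk Γ} (m : List Unit)
    (h : FRel (R.fam i) s s') {B : ℕ} (hB : (m.length : ℤ) + ssize s + S.corr (R.src i) + κ ≤ B) :
    S.W.ConnW B (.usr (R.src i), wstk m s) (.usr (R.dst i), wstk m s') := by
  have key : ∀ j (hj : j < (R.ops i).length + 1) (t : Stk Γ), LRel ((R.ops i).take j) s t →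
      S.W.ConnW B (.usr (R.src i), wstk m s) (.mid i ⟨j, hj⟩, wstk m t) := by
    have hsz : ∀ j (hj : j < (R.ops i).length + 1) (t : Stk Γ), LRel ((R.ops i).take j) s t →
        m.length + ssize t ≤ B := by
      intro j hj t ht
      have h1 := ht.ssize
      have h2 := abs_le.1 (hκ (.mid i ⟨j, hj⟩))
      simp only [cr] at h2
      zify
      linarith
    intro j
    induction j with
    | zero =>
      intro hj t ht
      have h3 := hsz _ hj t ht
      obtain rfl : t = s := by simpa [LRel] using ht
      exact S.conn_of_step (.go i m t) h3 h3
    | succ j ih =>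
      intro hj t ht
      have e1 : (R.ops i).take (j + 1) = (R.ops i).take j ++ [(R.ops i)[j]] := by
        simp
      have h3 := hsz _ hj t ht
      rw [e1, lrel_append] at ht
      obtain ⟨r, h1, h2⟩ := ht
      refine .trans (ih (by omega) r h1) ?_
      exact S.conn_of_step (.mic i ⟨j, by omega⟩ m r t (lrel_singleton.1 h2))
        (hsz _ (by omega) r h1) h3
  have h3 := key (R.ops i).length (by omega) s' (by rw [List.take_length]; exact lrel_splitFam.2 h)
  refine .trans h3 ?_
  have h4 : m.length + ssize s' ≤ B := by
    have h1 := h.ssize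
    have h2 := abs_le.1 (hκ (.usr (R.dst i)))
    have h3 := S.net i
    simp only [cr] at h2
    zify
    linarith
  exact S.conn_of_step (.ret i m s') h4 h4

theorem usr_conn {κ : ℕ} (hκ : ∀ q, |S.cr q| ≤ κ) {a b : Q × Stk Γ} (m : List Unit)
    (h : R.Conn a b) {B : ℕ} (hB : (m.length : ℤ) + ssize a.2 + S.corr a.1 + κ ≤ B) :
    S.W.ConnW B (.usr a.1, wstk m a.2) (.usr b.1, wstk m b.2) ∧
      (ssize b.2 : ℤ) + S.corr b.1 = ssize a.2 + S.corr a.1 := by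
  induction h with
  | refl => exact ⟨.refl, rfl⟩
  | @tail c d _ h ih =>
    obtain ⟨i, h | h⟩ := h
    · obtain ⟨h1, h2, h3⟩ := h
      have h4 := h3.ssize
      have h5 := S.net i
      rw [h1] at ih
      rw [h2]
      exact ⟨ih.1.trans (S.usr_step hκ m h3 (by linarith)), by linarith⟩
    · obtain ⟨h1, h2, h3⟩ := h
      have h4 := h3.ssize
      have h5 := S.net i
      rw [h2] at ih
      rw [h1]
      exact ⟨ih.1.trans (S.usr_step hκ m h3 (by linarith)).symm, by linarith⟩

theorem erase_conn {N : ℕ} (m : List Unit) (s : Stk Γ) (h : m.length + ssize s ≤ N) :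
    S.W.ConnW N (.fin, wstk m s) (.acc, fun _ => []) := by
  generalize hn : m.length + ssize s = n
  induction n generalizing m s with
  | zero =>
    obtain rfl : m = [] := List.length_eq_zero_iff.1 (by omega)
    obtain rfl : s = fun _ => [] := ssize_eq_zero.1 (by omega)
    rw [← wstk_nil]
    exact S.conn_of_step .done (by omega) (by omega)
  | succ n ih =>
    cases m with
    | cons x m =>
      simp only [List.length_cons] at h hn
      exact .trans (S.conn_of_step (.unmark m s) (by simpa using h) (by omega))
        (ih m s (by omega) (by omega))
    | nil =>
      simp only [List.length_nil] at h hn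
      have : s ≠ fun _ => [] := by
        intro h1
        rw [ssize_eq_zero.2 h1] at hn
        omega
      obtain ⟨k, hk⟩ := Function.ne_iff.1 this
      obtain ⟨x, l, hl⟩ := List.exists_cons_of_ne_nil hk
      have h2 := ssize_update s k l
      rw [hl, List.length_cons] at h2
      exact .trans (S.conn_of_step (.erase k x [] s (Function.update s k l) (by simpa using hl)
        (fun j hj => by simp [hj])) (by simpa using h) (by simp; omega))
        (ih [] _ (by simp; omega) (by simp; omega))

/-- Remove all padding. -/
def base (s : Stk Γ) : Stk Γ := fun k => if S.pad k = true then [] else s k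

theorem pad_conn {N : ℕ} (m : List Unit) (s : Stk Γ) (h : m.length + ssize s ≤ N) :
    S.W.ConnW N (.pre, wstk m s) (.pre, wstk m (S.base s)) := by
  generalize hn : ssize s = n
  induction n using Nat.strong_induction_on generalizing s with
  | _ n ih =>
    by_cases h1 : ∃ k, S.pad k = true ∧ s k ≠ []
    · obtain ⟨k, hk, hk2⟩ := h1
      obtain ⟨x, l, hl⟩ := List.exists_cons_of_ne_nil hk2
      have h2 := ssize_update s k l
      rw [hl, List.length_cons] at h2
      have h3 := S.conn_of_step (N := N) (.pad k hk x m (Function.update s k l) s (by simpa using hl)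
        (fun j hj => by simp [hj])) (by omega) (by omega)
      refine h3.symm.trans ?_
      have h4 : S.base (Function.update s k l) = S.base s := by
        funext j
        unfold base
        by_cases hj : j = k
        · subst hj
          simp [hk]
        · simp [hj]
      rw [← h4]
      exact ih _ (by omega) _ (by omega) rfl
    · have h2 : S.base s = s := by
        funext j
        unfold base
        split_ifs with hj
        · by_contra h3
          exact h1 ⟨j, hj, fun h4 => h3 h4.symm⟩
        · rfl
      rw [h2]
      exact .refl

theorem base_eq_of_ini {u : List X} {s s' : Stk Γ} (h : S.Ini u s) (h' : S.Ini u s') :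
    S.base s = S.base s' := by
  funext k
  unfold base
  split_ifs with hk
  · rfl
  · by_cases hk2 : k = S.inp
    · subst hk2
      rw [h.1, h'.1]
    · rw [h.2 k hk2 (by simpa using hk), h'.2 k hk2 (by simpa using hk)]

theorem pre_conn {κ : ℕ} (hκ : ∀ q, |S.cr q| ≤ κ) {u : List X} {t : ℕ} (hu : Acc u t)
    {m : List Unit} (hm : m ≠ []) {s : Stk Γ} (hs : S.Ini u s) {B : ℕ}
    (hB : m.length + ssize s + S.C * (g t + 1) + 2 * κ ≤ B) :
    S.W.ConnW B (.pre, wstk m s) (.acc, fun _ => []) := by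
  obtain ⟨s₁, s₂, h1, h2, h3⟩ := S.complete u t hu
  have e1 := S.pad_conn (N := B) m s (by omega)
  have e2 := S.pad_conn (N := B) m s₁ (by omega)
  rw [S.base_eq_of_ini hs h1] at e1
  refine (e1.trans e2.symm).trans ?_
  have e3 := S.conn_of_step (N := B) (.enter m s₁ h1.2) (by omega) (by omega)
  refine e3.trans ?_
  have h4 := abs_le.1 (hκ (.usr S.qin))
  have h5 := abs_le.1 (hκ (.usr S.qout))
  simp only [cr] at h4 h5
  have e4 := S.usr_conn hκ m h3 (B := B) (by zify at hB h2; simp only; linarith)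
  refine e4.1.trans ?_
  have h6 : m.length + ssize s₂ ≤ B := by
    have := e4.2
    simp only at this
    zify at hB h2 ⊢
    linarith
  obtain ⟨x, m, rfl⟩ := List.exists_cons_of_ne_nil hm
  simp only [List.length_cons] at h6
  exact (S.conn_of_step (.leave m s₂) (by simpa using h6) (by omega)).trans
    (S.erase_conn m s₂ (by omega))

theorem start_conn {κ : ℕ} (hκ : ∀ q, |S.cr q| ≤ κ) {u : List X} {t : ℕ} (hu : Acc u t)
    {m : List Unit} {s : Stk Γ} (hs : S.Ini u s) {B : ℕ}
    (hB : m.length + ssize s + 1 + S.C * (g t + 1) + 2 * κ ≤ B) :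
    S.W.ConnW B (.start, wstk m s) (.acc, fun _ => []) :=
  (S.conn_of_step (.mark m s) (by omega) (by simp; omega)).trans
    (S.pre_conn hκ hu (by simp) hs (by simp; omega))

theorem walk {N κ : ℕ} (hκ : ∀ q, |S.cr q| ≤ κ) {q : WState R} {m : List Unit} {s : Stk Γ}
    (h : S.W.ConnW N (q, wstk m s) (.acc, fun _ => [])) (hq : IsUsr q) {B : ℕ}
    (hB : (m.length : ℤ) + ssize s + S.cr q + κ ≤ B) :
    ∃ q' m' s', (q' = .pre ∨ q' = .fin) ∧ m'.length + ssize s' ≤ B ∧ 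
      S.W.ConnW B (q, wstk m s) (q', wstk m' s') := by
  revert hq hB
  refine S.conn_induction (N := N) (P := fun q m s => IsUsr q →
    (m.length : ℤ) + ssize s + S.cr q + κ ≤ B → ∃ q' m' s', (q' = .pre ∨ q' = .fin) ∧
      m'.length + ssize s' ≤ B ∧ S.W.ConnW B (q, wstk m s) (q', wstk m' s')) ?_ ?_ h
  · intro hq
    exact hq.elim
  · intro q m s q' m' s' hstep _ _ _ ih hq hB
    have hsz : ∀ (q : WState R) (n : ℕ), (n : ℤ) + S.cr q + κ ≤ B → n ≤ B := by
      intro q n hn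
      have := abs_le.1 (hκ q)
      zify
      linarith
    have h1 : m.length + ssize s ≤ B := hsz q _ (by push_cast; linarith)
    by_cases hq' : IsUsr q'
    · have h2 : m' = m ∧ (ssize s' : ℤ) + S.cr q' = ssize s + S.cr q := by
        rcases hstep with hstep | hstep
        · exact S.step_weight hstep hq hq'
        · have := S.step_weight hstep hq' hq
          exact ⟨this.1.symm, this.2.symm⟩
      obtain ⟨rfl, h2⟩ := h2
      have hB' : (m'.length : ℤ) + ssize s' + S.cr q' + κ ≤ B := by linarith
      obtain ⟨q₁, m₁, s₁, h3, h4, h5⟩ := ih hq' hB'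
      refine ⟨q₁, m₁, s₁, h3, h4, .trans ?_ h5⟩
      have h6 : m'.length + ssize s' ≤ B := hsz q' _ (by push_cast; linarith)
      rcases hstep with hstep | hstep
      · exact S.conn_of_step hstep h1 h6
      · exact (S.conn_of_step hstep h6 h1).symm
    · rcases hstep with hstep | hstep <;> cases hstep <;> first
        | exact hq.elim
        | exact (hq' trivial).elim
        | skip
      · simp only [List.length_cons] at h1
        exact ⟨_, _, _, .inr rfl, by omega, S.conn_of_step (.leave ..) (by simpa using h1) (by omega)⟩
      · exact ⟨_, _, _, .inl rfl, by omega, (S.conn_of_step (.enter _ _ (by assumption)) (by omega) (by omega)).symm⟩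

theorem mark_ne_nil {N : ℕ} {q : WState R} {m : List Unit} {s : Stk Γ}
    (h : S.W.ConnW N (q, wstk m s) (.acc, fun _ => [])) (hq : q = .pre ∨ IsUsr q) : m ≠ [] := by
  revert hq
  refine S.conn_induction (N := N) (P := fun q m s => (q = .pre ∨ IsUsr q) → m ≠ []) ?_ ?_ h
  · rintro (h | h)
    · simp at h
    · exact h.elim
  · rintro q m s q' m' s' (h1 | h1) - - - ih hq
    · cases h1 <;> first
        | exact ih (.inl rfl)
        | exact ih (.inr trivial)
        | (simp [IsUsr] at hq; done)
        | simp
    · cases h1 <;> first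
        | exact ih (.inl rfl)
        | exact ih (.inr trivial)
        | (simp [IsUsr] at hq; done)
        | simp

end Sim

end Simulation

section SpaceBounds

theorem TM.spaceFun_spec {T X : Type} (M : TM T X) {n : ℕ} {u : List X} (hu : u.length ≤ n)
    (h : M.AcceptsConf (M.inputConf u)) : M.AcceptsWithin (M.inputConf u) (M.spaceFun n) := by
  have hne : {s | ∀ u : List X, u.length ≤ n → M.AcceptsConf (M.inputConf u) →
      M.AcceptsWithin (M.inputConf u) s}.Nonempty := by
    have := M.finX
    have hfin : {u : List X | u.length ≤ n}.Finite := List.finite_length_le X n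
    choose f hf using fun (v : {u : List X // M.AcceptsConf (M.inputConf u)}) => v.2
    classical
    let F : List X → ℕ := fun u => if h : M.AcceptsConf (M.inputConf u) then f ⟨u, h⟩ else 0
    obtain ⟨b, hb⟩ := (hfin.image F).bddAbove
    refine ⟨b, fun v hv h => ?_⟩
    have h1 := hb ⟨v, hv, rfl⟩
    simp only [F, h, dite_true] at h1
    exact (hf ⟨v, h⟩).mono h1
  exact Nat.sInf_mem hne u hu h

theorem TM.spaceFun_le {T X : Type} (M : TM T X) {n b : ℕ}
    (h : ∀ u : List X, u.length ≤ n → M.AcceptsConf (M.inputConf u) →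
      M.AcceptsWithin (M.inputConf u) b) : M.spaceFun n ≤ b :=
  Nat.sInf_le h

theorem TM.spaceFun_mono {T X : Type} (M : TM T X) : Monotone M.spaceFun :=
  fun _ _ hab => M.spaceFun_le fun _ hu h => M.spaceFun_spec (hu.trans hab) h

theorem TM.genSpaceFun_le {T X : Type} (M : TM T X) {n b : ℕ}
    (h : ∀ c : M.Conf, M.cSpace c ≤ n → M.AcceptsConf c → M.AcceptsWithin c b) :
    M.genSpaceFun n ≤ b :=
  Nat.sInf_le h

theorem TM.genSpaceFun_spec {T X : Type} (M : TM T X) {n b : ℕ}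
    (h : ∀ c : M.Conf, M.cSpace c ≤ n → M.AcceptsConf c → M.AcceptsWithin c b)
    {c : M.Conf} (hc : M.cSpace c ≤ n) (h2 : M.AcceptsConf c) :
    M.AcceptsWithin c (M.genSpaceFun n) := by
  have hne : {s | ∀ c : M.Conf, M.cSpace c ≤ n → M.AcceptsConf c →
      M.AcceptsWithin c s}.Nonempty := ⟨b, h⟩
  exact Nat.sInf_mem hne c hc h2

theorem TM.cSpace_inputConf {T X : Type} (M : TM T X) (u : List X) :
    M.cSpace (M.inputConf u) = u.length := by
  classical
  let := M.finT
  unfold TM.cSpace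
  rw [Finset.sum_eq_single M.inputTape]
  · have : M.inputConf u M.inputTape = (u.map M.emb, M.startQ M.inputTape, []) :=
      Function.update_self _ _ _
    rw [this]
    simp
  · intro j _ hj
    have : M.inputConf u j = ([], M.startQ j, []) := Function.update_of_ne hj _ _
    rw [this]
    simp
  · intro h
    exact (h (Finset.mem_univ _)).elim

end SpaceBounds

namespace Sim

section Machine

variable {K : Type} [Fintype K] {Γ : K → Type} {Q ι : Type} {T X : Type} {R : Rules K Γ Q ι}
  {g : ℕ → ℕ} {M : TM T X} (S : Sim R (fun u s => M.AcceptsWithin (M.inputConf u) s) g)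

theorem acc_eq {N : ℕ} {m : List Unit} {s : Stk Γ}
    (h : S.W.ConnW N (.acc, wstk m s) (.acc, fun _ => [])) : m = [] ∧ s = fun _ => [] := by
  refine S.conn_induction (N := N) (P := fun q m s => q = .acc → m = [] ∧ s = fun _ => [])
    ?_ ?_ h rfl
  · exact fun _ => ⟨rfl, rfl⟩
  · rintro q m s q' m' s' (h1 | h1) - - - - rfl
    · cases h1
    · cases h1 <;> exact ⟨rfl, rfl⟩

theorem ini_length {u : List X} {s : Stk Γ} (h : S.Ini u s) : u.length ≤ ssize s := by
  have := length_le_ssize s S.inp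
  rw [h.1] at this
  simpa using this

/-- Bound for the space of an accepting path of the wrapped system. -/
theorem gen_bound (g0 : g 0 = 0) {κ : ℕ} (hκ : ∀ q, |S.cr q| ≤ κ) {N n : ℕ} {q : WState R}
    {m : List Unit} {s : Stk Γ} (hn : m.length + ssize s ≤ n)
    (h : S.W.ConnW N (q, wstk m s) (.acc, fun _ => [])) :
    S.W.ConnW (if n = 0 ∧ M.spaceFun 0 = 0 then 0 else
      n + 4 * κ + 1 + S.C * (g (M.spaceFun ((2 * κ + 1) * n)) + 1))
      (q, wstk m s) (.acc, fun _ => []) := by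
  set B := n + 4 * κ + 1 + S.C * (g (M.spaceFun ((2 * κ + 1) * n)) + 1) with hB
  have hDn : n ≤ (2 * κ + 1) * n := Nat.le_mul_of_pos_left _ (by omega)
  have hpre : ∀ (m : List Unit) (s : Stk Γ) (N : ℕ), m.length + ssize s ≤ (2 * κ + 1) * n →
      m.length + ssize s ≤ n + 2 * κ →
      S.W.ConnW N (.pre, wstk m s) (.acc, fun _ => []) →
      S.W.ConnW B (.pre, wstk m s) (.acc, fun _ => []) := by
    intro m s N h1 h1' h2
    obtain ⟨u, hu, t, ht, -⟩ := S.sound_pre g0 (.inr rfl) h2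
    have h3 := S.ini_length hu
    exact S.pre_conn hκ (M.spaceFun_spec (n := (2 * κ + 1) * n) (by omega) ⟨t, ht⟩)
      (S.mark_ne_nil h2 (.inl rfl)) hu (by omega)
  have hpos : m ≠ [] → n ≠ 0 := by
    intro h1 h2
    have := List.length_pos_iff.2 h1
    omega
  have husr : IsUsr q → S.W.ConnW B (q, wstk m s) (.acc, fun _ => []) := by
    intro hq
    have h1 := abs_le.1 (hκ q)
    have hn0 := hpos (S.mark_ne_nil h (.inr hq))
    obtain ⟨q', m', s', h2, h3, h4⟩ := S.walk hκ h hq (B := n + 2 * κ) (by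
      zify at hn
      push_cast
      linarith)
    have h5 : n + 2 * κ ≤ (2 * κ + 1) * n := by
      have : 2 * κ * 1 ≤ 2 * κ * n := Nat.mul_le_mul_left _ (by omega)
      linarith
    have h6 : S.W.ConnW (max N (n + 2 * κ)) (q', wstk m' s') (.acc, fun _ => []) :=
      (h4.mono (le_max_right _ _)).symm.trans (h.mono (le_max_left _ _))
    refine .trans (h4.mono (by omega)) ?_
    rcases h2 with rfl | rfl
    · exact hpre m' s' _ (by omega) h3 h6
    · exact S.erase_conn m' s' (by omega)
  cases q with
  | acc =>
    obtain ⟨rfl, rfl⟩ := S.acc_eq h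
    rw [wstk_nil]
    exact .refl
  | fin =>
    refine S.erase_conn m s ?_
    split_ifs <;> omega
  | start =>
    obtain ⟨u, hu, t, ht, -⟩ := S.sound_pre g0 (.inl rfl) h
    have h3 := S.ini_length hu
    split_ifs with h1
    · obtain rfl : u = [] := List.length_eq_zero_iff.1 (by omega)
      obtain rfl : m = [] := List.length_eq_zero_iff.1 (by omega)
      obtain rfl : s = fun _ => [] := ssize_eq_zero.1 (by omega)
      have h4 := M.spaceFun_spec (n := 0) le_rfl ⟨t, ht⟩
      rw [h1.2] at h4
      have h5 := S.conn_of_step (N := 0) (.short h4) (by omega) (by omega)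
      rwa [← wstk_nil]
    · exact S.start_conn hκ (M.spaceFun_spec (n := (2 * κ + 1) * n) (by omega) ⟨t, ht⟩) hu
        (by omega)
  | pre =>
    have := hpos (S.mark_ne_nil h (.inl rfl))
    rw [if_neg (by omega)]
    exact hpre m s N (by omega) (by omega) h
  | usr q =>
    have := hpos (S.mark_ne_nil h (.inr trivial))
    rw [if_neg (by omega)]
    exact husr trivial
  | mid i j =>
    have := hpos (S.mark_ne_nil h (.inr trivial))
    rw [if_neg (by omega)]
    exact husr trivial

theorem wstk_ini (u : List X) :
    iniStk (Γ := WAlph Γ) (some S.inp) S.emb u = wstk [] (iniStk S.inp S.emb u) := by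
  funext o
  cases o with
  | none => simp [iniStk, wstk]
  | some k =>
    by_cases hk : k = S.inp
    · subst hk
      simp [iniStk, wstk]
    · simp [iniStk, wstk, hk]

theorem ini_iniStk (u : List X) : S.Ini u (iniStk S.inp S.emb u) :=
  ⟨by simp [iniStk], fun k hk _ => by simp [iniStk, hk]⟩

theorem exists_machine [Finite Q] [Finite ι] [∀ k, Finite (Γ k)]
    (S : Sim R (fun u s => M.AcceptsWithin (M.inputConf u) s) g) (gm : Monotone g) (g0 : g 0 = 0)
    (gn : ∀ n, n ≤ g n) :
    ∃ (T' : Type) (M' : TM T' X), M'.lang = M.lang ∧ M'.SymmetricTM ∧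
      FEquiv M'.spaceFun (fun n => g (M.spaceFun n)) ∧
      FEquiv M'.genSpaceFun (fun n => g (M.spaceFun n)) ∧ ∀ t, M'.cmdLetters t ≤ 1 := by
  classical
  obtain ⟨κ, hκ⟩ := S.exists_cr_bound
  have hΓ : ∀ o, Finite (WAlph Γ o) := by
    rintro (_ | k)
    · exact inferInstanceAs (Finite Unit)
    · exact inferInstanceAs (Finite (Γ k))
  have hQ : Finite (WState R) := inferInstance
  have hι : Finite (WRule R S.pad (M.AcceptsWithin (M.inputConf []) 0)) := inferInstance
  let M' := S.W.toTM hQ hΓ M.finX hι (some S.inp) S.emb .start .acc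
  let cf : WState R → List Unit → Stk Γ → M'.Conf := fun q m s =>
    S.W.toConf hQ hΓ M.finX hι (some S.inp) S.emb .start .acc (q, wstk m s)
  have hacc : ∀ q m s B, M'.AcceptsWithin (cf q m s) B ↔
      m.length + ssize s ≤ B ∧ S.W.ConnW B (q, wstk m s) (.acc, fun _ => []) := by
    intro q m s B
    rw [← ssize_wstk]
    exact S.W.toTM_acceptsWithin ..
  have hinp : ∀ u, M'.inputConf u = cf .start [] (iniStk S.inp S.emb u) := by
    intro u
    have := S.W.toTM_inputConf hQ hΓ M.finX hι (some S.inp) S.emb .start .acc u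
    rw [S.wstk_ini] at this
    exact this
  have hrange : ∀ c, M'.AcceptsConf c → ∃ q m s, c = cf q m s := by
    intro c hc
    obtain ⟨⟨q, σ⟩, h⟩ := S.W.toTM_accepts_range hQ hΓ M.finX hι (some S.inp) S.emb .start .acc hc
    obtain ⟨m, s, rfl⟩ := exists_wstk σ
    exact ⟨q, m, s, h⟩
  have hcs : ∀ q m s, M'.cSpace (cf q m s) = m.length + ssize s := by
    intro q m s
    rw [← ssize_wstk]
    exact S.W.toTM_cSpace ..
  let B : ℕ → ℕ := fun n => if n = 0 ∧ M.spaceFun 0 = 0 then 0 else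
      n + 4 * κ + 1 + S.C * (g (M.spaceFun ((2 * κ + 1) * n)) + 1)
  have hgen : ∀ n, ∀ c : M'.Conf, M'.cSpace c ≤ n → M'.AcceptsConf c → M'.AcceptsWithin c (B n) := by
    intro n c hc h
    obtain ⟨q, m, s, rfl⟩ := hrange c h
    obtain ⟨N, h⟩ := h
    rw [hcs] at hc
    rw [hacc] at h ⊢
    refine ⟨?_, S.gen_bound g0 hκ hc h.2⟩
    simp only [B]
    split_ifs <;> omega
  have hlow : ∀ u N, M'.AcceptsWithin (M'.inputConf u) N → S.Good N u := by
    intro u N h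
    rw [hinp, hacc] at h
    obtain ⟨v, hv, h2⟩ := S.sound_pre g0 (.inl rfl) h.2
    have h3 := hv.1.symm.trans (S.ini_iniStk u).1
    rw [List.reverse_inj] at h3
    rwa [List.map_injective_iff.2 S.emb_inj h3] at h2
  have hlang : M'.lang = M.lang := by
    ext u
    constructor
    · rintro ⟨N, h⟩
      obtain ⟨t, ht, -⟩ := hlow u N h
      exact ⟨t, ht⟩
    · rintro ⟨t, ht⟩
      refine ⟨([] : List Unit).length + ssize (iniStk S.inp S.emb u) + 1 + S.C * (g t + 1) + 2 * κ, ?_⟩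
      rw [hinp, hacc]
      exact ⟨by omega, S.start_conn hκ ht (S.ini_iniStk u) le_rfl⟩
  have hle : ∀ n, M'.spaceFun n ≤ M'.genSpaceFun n := by
    intro n
    refine M'.spaceFun_le fun u hu h => M'.genSpaceFun_spec (hgen n) ?_ h
    rw [M'.cSpace_inputConf]
    exact hu
  have hup : ∀ n, M'.genSpaceFun n ≤ B n := fun n => M'.genSpaceFun_le (hgen n)
  have hB : DomBy B (fun n => g (M.spaceFun n)) := by
    refine ⟨6 * κ + 3 + 2 * S.C, by omega, fun n => ?_⟩
    simp only [B]
    split_ifs with h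
    · exact Nat.zero_le _
    · have h1 : g (M.spaceFun ((2 * κ + 1) * n)) ≤ g (M.spaceFun ((6 * κ + 3 + 2 * S.C) * n)) :=
        gm (M.spaceFun_mono (Nat.mul_le_mul_right _ (by omega)))
      set G := g (M.spaceFun ((6 * κ + 3 + 2 * S.C) * n)) with hG
      have h2 : 1 ≤ n ∨ 1 ≤ G := by
        by_contra h3
        have h4 : n = 0 := by omega
        have h5 := gn (M.spaceFun ((6 * κ + 3 + 2 * S.C) * n))
        rw [← hG, h4, Nat.mul_zero] at h5
        omega
      have h3 : S.C * g (M.spaceFun ((2 * κ + 1) * n)) ≤ S.C * G := Nat.mul_le_mul_left _ h1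
      rcases h2 with h2 | h2
      · nlinarith [Nat.mul_le_mul_left κ h2, Nat.mul_le_mul_left S.C h2, Nat.zero_le (κ * G),
          Nat.zero_le (S.C * G)]
      · nlinarith [Nat.mul_le_mul_left κ h2, Nat.mul_le_mul_left S.C h2, Nat.zero_le (κ * n),
          Nat.zero_le (S.C * n)]
  have hdown : DomBy (fun n => g (M.spaceFun n)) M'.spaceFun := by
    refine ⟨2 * S.C + 1, by omega, fun n => ?_⟩
    have h1 : g (M.spaceFun n) ≤ S.C * (M'.spaceFun n + 1) := by
      have hbdd : BddAbove {s | g s ≤ S.C * (M'.spaceFun n + 1)} :=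
        ⟨S.C * (M'.spaceFun n + 1), fun s hs => (gn s).trans hs⟩
      have hmem := Nat.sSup_mem (s := {s | g s ≤ S.C * (M'.spaceFun n + 1)})
        ⟨0, by simp [g0]⟩ hbdd
      refine le_trans (gm (M.spaceFun_le fun u hu h => ?_)) hmem
      have h2 : M'.AcceptsConf (M'.inputConf u) := by
        have : u ∈ M'.lang := by
          rw [hlang]
          exact h
        exact this
      obtain ⟨t, ht, h3⟩ := hlow u _ (M'.spaceFun_spec hu h2)
      exact ht.mono (le_csSup hbdd h3)
    have h2 : M'.spaceFun n ≤ M'.spaceFun ((2 * S.C + 1) * n) :=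
      M'.spaceFun_mono (Nat.le_mul_of_pos_left _ (by omega))
    set σ := M'.spaceFun ((2 * S.C + 1) * n) with hσ
    have h3 : S.C * M'.spaceFun n ≤ S.C * σ := Nat.mul_le_mul_left _ h2
    by_cases hn : 1 ≤ n
    · nlinarith [Nat.mul_le_mul_left S.C hn]
    · obtain rfl : n = 0 := by omega
      by_cases h0 : M.spaceFun 0 = 0
      · simp only [h0, g0]
        exact Nat.zero_le _
      · have h4 : 1 ≤ σ := by
          by_contra h5
          have h6 : σ = 0 := by omega
          rw [Nat.mul_zero] at hσ
          refine h0 (Nat.le_zero.1 (M.spaceFun_le fun u hu h => ?_))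
          obtain rfl : u = [] := List.length_eq_zero_iff.1 (by omega)
          have h2 : M'.AcceptsConf (M'.inputConf []) := by
            have : [] ∈ M'.lang := by
              rw [hlang]
              exact h
            exact this
          have h7 := M'.spaceFun_spec (n := 0) hu h2
          rw [← hσ, h6, hinp, hacc] at h7
          generalize iniStk S.inp S.emb [] = s₀ at h7
          rcases Relation.ReflTransGen.cases_head h7.2 with h8 | ⟨⟨q, σ⟩, h8, -⟩
          · simp at h8
          · obtain ⟨m', s', rfl⟩ := exists_wstk σ
            obtain ⟨h8, -, h9⟩ := h8
            rw [ssize_wstk] at h9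
            rcases (wrap_adj _ _ _ _ _ _).1 h8 with h8 | h8
            · cases h8 with
              | mark => simp at h9
              | short h => exact h
            · cases h8
        change g (M.spaceFun 0) ≤ (2 * S.C + 1) * σ + (2 * S.C + 1) * 0
        nlinarith [Nat.mul_le_mul_left S.C h4]
  have trans_le : ∀ {f f' h : ℕ → ℕ}, (∀ n, f n ≤ f' n) → DomBy f' h → DomBy f h := by
    rintro f f' h h1 ⟨c, hc, h2⟩
    exact ⟨c, hc, fun n => (h1 n).trans (h2 n)⟩
  have le_trans' : ∀ {f h h' : ℕ → ℕ}, (∀ n, h n ≤ h' n) → DomBy f h → DomBy f h' := by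
    rintro f h h' h1 ⟨c, hc, h2⟩
    refine ⟨c, hc, fun n => (h2 n).trans ?_⟩
    have := Nat.mul_le_mul_left c (h1 (c * n))
    omega
  exact ⟨Option K, M', hlang, S.W.toTM_symmetric hQ hΓ M.finX hι (some S.inp) S.emb .start .acc,
    ⟨trans_le (fun n => (hle n).trans (hup n)) hB, hdown⟩,
    ⟨trans_le hup hB, le_trans' hle hdown⟩,
    S.W.toTM_cmdLetters _ _ _ _ _ _ _ _ fun i => wrap_letters _ _ _ _ _ _ i⟩

end Machine

end Sim

/-- A prefix-rewriting system on a family of stacks, one of which always contains a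
single letter, with initial and accepting contents. -/
structure PRS (K : Type) (Γ : K → Type) (X : Type) where
  ι : Type
  fam : ι → Fam Γ
  kst : K
  kin : K
  hne : kin ≠ kst
  qs : Γ kst
  qa : Γ kst
  emb : X → Γ kin
  st : ι → Γ kst
  st' : ι → Γ kst
  fam_kst : ∀ i, fam i kst = ⟨[st i], [st' i], true⟩

namespace PRS

open scoped Classical

variable {K : Type} {Γ : K → Type} {X : Type} (P : PRS K Γ X)

/-- One rewriting step. -/
def Step (x y : Stk Γ) : Prop := ∃ i, FRel (P.fam i) x y

/-- The accepting stack contents. -/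
noncomputable def acc : Stk Γ := Function.update (fun _ => []) P.kst [P.qa]

/-- The contents with the initial letter on one stack and the image of a given word on
another. -/
noncomputable def load (w : List X) : Stk Γ :=
  Function.update (Function.update (fun _ => []) P.kst [P.qs]) P.kin (w.map P.emb)

/-- The initial stack contents on a given input. -/
noncomputable def start (u : List X) : Stk Γ := P.load u.reverse

@[simp] theorem acc_kst : P.acc P.kst = [P.qa] := by simp [acc]

theorem acc_of_ne {k : K} (h : k ≠ P.kst) : P.acc k = [] := by simp [acc, h]

@[simp] theorem load_kst (w : List X) : P.load w P.kst = [P.qs] := by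
  simp [load, P.hne.symm]

@[simp] theorem load_kin (w : List X) : P.load w P.kin = w.map P.emb := by
  simp [load]

theorem load_of_ne (w : List X) {k : K} (h : k ≠ P.kst) (h' : k ≠ P.kin) :
    P.load w k = [] := by simp [load, h, h']

/-- Contents with exactly one letter on the distinguished stack. -/
def Wf (x : Stk Γ) : Prop := ∃ q, x P.kst = [q]

theorem frel_kst {i : P.ι} {x y : Stk Γ} (h : FRel (P.fam i) x y) :
    x P.kst = [P.st i] ∧ y P.kst = [P.st' i] := by
  have := h P.kst
  rw [P.fam_kst] at this
  obtain ⟨a, h1, h2, h3⟩ := this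
  rw [h1 rfl] at h2 h3
  exact ⟨h2, h3⟩

variable {P}

theorem Step.wf_left {x y : Stk Γ} (h : P.Step x y) : P.Wf x := by
  obtain ⟨i, h⟩ := h
  exact ⟨_, (P.frel_kst h).1⟩

theorem Step.wf_right {x y : Stk Γ} (h : P.Step x y) : P.Wf y := by
  obtain ⟨i, h⟩ := h
  exact ⟨_, (P.frel_kst h).2⟩

variable (P) [Fintype K]

/-- A step in bounded space. -/
def StepW (s : ℕ) (x y : Stk Γ) : Prop := P.Step x y ∧ ssize x ≤ s ∧ ssize y ≤ s

/-- Acceptance in bounded space. -/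
def AccW (s : ℕ) (x : Stk Γ) : Prop :=
  ssize x ≤ s ∧ Relation.ReflTransGen (P.StepW s) x P.acc

variable {P}

theorem AccW.head {s : ℕ} {x y : Stk Γ} (h : P.Step x y) (hx : ssize x ≤ s) (hy : P.AccW s y) :
    P.AccW s x :=
  ⟨hx, .head ⟨h, hx, hy.1⟩ hy.2⟩

theorem ssize_acc : ssize P.acc = 1 := by
  unfold ssize
  rw [Finset.sum_eq_single P.kst]
  · simp
  · intro k _ hk
    simp [P.acc_of_ne hk]
  · simp

theorem accW_acc {s : ℕ} (hs : 1 ≤ s) : P.AccW s P.acc :=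
  ⟨ssize_acc.le.trans hs, .refl⟩

end PRS

namespace TM

variable {T X : Type} (M : TM T X)

/-- The alphabets of the prefix-rewriting system of a machine. -/
def PAlph : Option (T × Bool) → Type
  | none => ∀ i, M.Q i
  | some p => M.Y p.1

/-- The stack contents encoding a configuration. -/
def enc (c : M.Conf) : Stk M.PAlph
  | none => [fun i => (c i).2.1]
  | some (i, false) => (c i).1.reverse
  | some (i, true) => (c i).2.2

/-- The prefix-rewriting system of a machine. -/
def prs : PRS (Option (T × Bool)) M.PAlph X where
  ι := M.ι
  fam t := fun k => match k with
    | none => ⟨[fun i => (M.cmds t i).q], [fun i => (M.cmds t i).q'], true⟩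
    | some (i, false) =>
      ⟨(M.cmds t i).u.reverse, (M.cmds t i).u'.reverse, (M.cmds t i).lAnch⟩
    | some (i, true) => ⟨(M.cmds t i).v, (M.cmds t i).v', (M.cmds t i).rAnch⟩
  kst := none
  kin := some (M.inputTape, false)
  hne := by simp
  qs := M.startQ
  qa := M.acceptQ
  emb := M.emb
  st t := fun i => (M.cmds t i).q
  st' t := fun i => (M.cmds t i).q'
  fam_kst _ := rfl

theorem frel_enc {t : M.ι} {c d : M.Conf} :
    FRel (M.prs.fam t) (M.enc c) (M.enc d) ↔ M.StepVia t c d := by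
  constructor
  · intro h i
    have h0 : M.enc c none = _ ∧ M.enc d none = _ := M.prs.frel_kst h
    obtain ⟨h3, h4⟩ := h0
    obtain ⟨a, ha, h5, h6⟩ := h (some (i, false))
    obtain ⟨b, hb, h7, h8⟩ := h (some (i, true))
    change List (M.Y i) at a
    change (c i).1.reverse = (M.cmds t i).u.reverse ++ a at h5
    change (d i).1.reverse = (M.cmds t i).u'.reverse ++ a at h6
    refine ⟨congrFun (List.cons.inj h3).1 i, congrFun (List.cons.inj h4).1 i, a.reverse, b, ?_, hb, ?_, ?_, h7, h8⟩
    · intro h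
      rw [ha h]
      rfl
    · rw [← List.reverse_reverse (c i).1, h5]
      simp
    · rw [← List.reverse_reverse (d i).1, h6]
      simp
  · intro h k
    match k with
    | none =>
      refine ⟨[], by simp, ?_, ?_⟩
      · exact congrArg (fun f => [f]) (funext fun i => (h i).1)
      · exact congrArg (fun f => [f]) (funext fun i => (h i).2.1)
    | some (i, false) =>
      obtain ⟨-, -, a, b, h1, h2, h3, h4, h5, h6⟩ := h i
      refine ⟨a.reverse, ?_, ?_, ?_⟩
      · intro h
        rw [h1 h]
        rfl
      · exact (congrArg List.reverse h3).trans List.reverse_append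
      · exact (congrArg List.reverse h4).trans List.reverse_append
    | some (i, true) =>
      obtain ⟨-, -, a, b, h1, h2, h3, h4, h5, h6⟩ := h i
      exact ⟨b, h2, h5, h6⟩

theorem step_enc {c d : M.Conf} : M.prs.Step (M.enc c) (M.enc d) ↔ M.Step c d := by
  simp only [PRS.Step, Step, ← frel_enc]
  rfl

theorem exists_enc {x : Stk M.PAlph} (h : M.prs.Wf x) : ∃ c, x = M.enc c := by
  obtain ⟨q, h⟩ := h
  refine ⟨fun i => ((x (some (i, false))).reverse, q i, x (some (i, true))), ?_⟩
  funext k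
  match k with
  | none => exact h
  | some (i, false) => exact (List.reverse_reverse _).symm
  | some (i, true) => rfl

theorem enc_injective : Function.Injective M.enc := by
  intro c d h
  funext i
  have h0 := congrFun h none
  have h1 := congrFun h (some (i, false))
  have h2 := congrFun h (some (i, true))
  exact Prod.ext (List.reverse_injective h1) (Prod.ext (congrFun (List.cons.inj h0).1 i) h2)

theorem enc_inputConf (u : List X) : M.enc (M.inputConf u) = M.prs.start u := by
  classical
  have h : ∀ i, M.inputConf u i = if h : i = M.inputTape then
      h ▸ (u.map M.emb, M.startQ M.inputTape, []) else ([], M.startQ i, []) := by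
    intro i
    by_cases hi : i = M.inputTape
    · subst hi
      simp only [dite_true]
      exact Function.update_self _ _ _
    · simp only [hi, dite_false]
      exact Function.update_of_ne hi _ _
  funext k
  match k with
  | none =>
    refine Eq.trans ?_ (M.prs.load_kst _).symm
    refine congrArg (fun f => [f]) (funext fun i => ?_)
    rw [h]
    by_cases hi : i = M.inputTape
    · subst hi
      simp
      rfl
    · simp [hi]
      rfl
  | some (i, false) =>
    by_cases hi : i = M.inputTape
    · subst hi
      refine Eq.trans ?_ (M.prs.load_kin _).symm
      change (M.inputConf u M.inputTape).1.reverse = u.reverse.map M.emb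
      simp [h]
    · refine Eq.trans ?_ (M.prs.load_of_ne _ (k := some (i, false)) (by simp [prs])
        (by simp [prs, hi])).symm
      change (M.inputConf u i).1.reverse = []
      simp [h, hi]
  | some (i, true) =>
    refine Eq.trans ?_ (M.prs.load_of_ne _ (k := some (i, true)) (by simp [prs])
        (by simp [prs])).symm
    change (M.inputConf u i).2.2 = []
    rw [h]
    by_cases hi : i = M.inputTape
    · subst hi
      simp
    · simp [hi]

theorem enc_acceptConf : M.enc M.acceptConf = M.prs.acc := by
  funext k
  match k with
  | none => exact M.prs.acc_kst.symm
  | some (i, false) =>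
    exact (M.prs.acc_of_ne (k := some (i, false)) (by simp [prs])).symm
  | some (i, true) =>
    exact (M.prs.acc_of_ne (k := some (i, true)) (by simp [prs])).symm

theorem prs_det (h : M.Deterministic) {x y z : Stk M.PAlph} (h1 : M.prs.Step x y)
    (h2 : M.prs.Step x z) : y = z := by
  obtain ⟨c, rfl⟩ := M.exists_enc h1.wf_left
  obtain ⟨d, rfl⟩ := M.exists_enc h1.wf_right
  obtain ⟨e, rfl⟩ := M.exists_enc h2.wf_right
  rw [h c d e (M.step_enc.1 h1) (M.step_enc.1 h2)]

variable [Fintype T]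

theorem ssize_enc (c : M.Conf) : ssize (M.enc c) = M.cSpace c + 1 := by
  have : M.finT = ‹Fintype T› := Subsingleton.elim _ _
  subst this
  simp only [ssize, cSpace, Fintype.sum_option, Fintype.sum_prod_type, Fintype.sum_bool]
  rw [add_comm]
  refine congrArg (· + 1) (Finset.sum_congr rfl fun i _ => ?_)
  change (c i).2.2.length + (c i).1.reverse.length = _
  rw [List.length_reverse, add_comm]

theorem accW_enc {c : M.Conf} {s : ℕ} :
    M.prs.AccW (s + 1) (M.enc c) ↔ M.AcceptsWithin c s := by
  rw [M.acceptsWithin_iff, PRS.AccW, ssize_enc, Nat.add_le_add_iff_right]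
  refine and_congr_right fun _ => ⟨fun h => ?_, fun h => ?_⟩
  · have key : ∀ x, Relation.ReflTransGen (M.prs.StepW (s + 1)) (M.enc c) x → ∃ d, x = M.enc d ∧
        Relation.ReflTransGen (fun x y => M.Step x y ∧ M.cSpace x ≤ s ∧ M.cSpace y ≤ s) c d := by
      intro x hx
      induction hx with
      | refl => exact ⟨c, rfl, .refl⟩
      | @tail y z _ h ih =>
        obtain ⟨d, rfl, hd⟩ := ih
        obtain ⟨e, rfl⟩ := M.exists_enc h.1.wf_right
        obtain ⟨h1, h2, h3⟩ := h
        rw [ssize_enc] at h2 h3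
        exact ⟨e, rfl, .tail hd ⟨M.step_enc.1 h1, by omega, by omega⟩⟩
    obtain ⟨d, h1, h2⟩ := key _ h
    rw [← M.enc_acceptConf] at h1
    rwa [M.enc_injective h1]
  · rw [← M.enc_acceptConf]
    refine h.lift M.enc fun x y h => ⟨M.step_enc.2 h.1, ?_, ?_⟩ <;> rw [ssize_enc] <;> omega

theorem accW_start {u : List X} {s : ℕ} :
    M.prs.AccW (s + 1) (M.prs.start u) ↔ M.AcceptsWithin (M.inputConf u) s := by
  rw [← M.enc_inputConf, accW_enc]

end TM

section Aux

open scoped Classical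

theorem unit_list_ext {l l' : List Unit} (h : l.length = l'.length) : l = l' :=
  List.ext_get h fun _ _ _ => rfl

/-- The pattern replacing a number of counters by another number of counters. -/
def Pat.unary (a b : ℕ) : Pat Unit := ⟨List.replicate a (), List.replicate b (), false⟩

@[simp] theorem Pat.rel_unary {a b : ℕ} {l l' : List Unit} :
    (Pat.unary a b).Rel l l' ↔ a ≤ l.length ∧ l'.length + a = l.length + b := by
  constructor
  · rintro ⟨c, -, rfl, rfl⟩
    simp [Pat.unary]
    omega
  · rintro ⟨h1, h2⟩
    refine ⟨List.replicate (l.length - a) (), by simp [Pat.unary], unit_list_ext ?_,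
      unit_list_ext ?_⟩ <;> simp [Pat.unary] <;> omega

variable {K : Type} {Γ : K → Type}

theorem frel_single_push {k : K} {y : Γ k} {s s' : Stk Γ} :
    FRel (single k (.push y)) s s' ↔ s' = Function.update s k (y :: s k) := by
  rw [frel_single, Pat.rel_push]
  constructor
  · rintro ⟨h1, h2⟩
    funext j
    by_cases hj : j = k
    · subst hj
      simp [h1]
    · simp [hj, h2 j hj]
  · rintro rfl
    exact ⟨by simp, fun j hj => by simp [hj]⟩

theorem frel_single_peek {k : K} {y : Γ k} {s s' : Stk Γ} :
    FRel (single k (.peek y)) s s' ↔ s' = s ∧ ∃ a, s k = y :: a := by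
  rw [frel_single, Pat.rel_peek]
  constructor
  · rintro ⟨⟨h1, h2⟩, h3⟩
    refine ⟨funext fun j => ?_, h2⟩
    by_cases hj : j = k
    · subst hj
      exact h1
    · exact h3 j hj
  · rintro ⟨rfl, h⟩
    exact ⟨⟨rfl, h⟩, fun _ _ => rfl⟩

theorem frel_single_pop {k : K} {y : Γ k} {s s' : Stk Γ} :
    FRel (single k (.pop y)) s s' ↔ s = Function.update s' k (y :: s' k) := by
  rw [frel_single, Pat.rel_pop]
  constructor
  · rintro ⟨h1, h2⟩
    funext j
    by_cases hj : j = k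
    · subst hj
      simp [h1]
    · simp [hj, h2 j hj]
  · rintro rfl
    exact ⟨by simp, fun j hj => by simp [hj]⟩

variable [Fintype K]

/-- The number of letters removed by a family. -/
def preLen (f : Fam Γ) : ℕ := ∑ k, (f k).pre.length

/-- The number of letters added by a family. -/
def postLen (f : Fam Γ) : ℕ := ∑ k, (f k).post.length

theorem fnet_eq (f : Fam Γ) : fnet f = (postLen f : ℤ) - preLen f := by
  simp [fnet, postLen, preLen, Finset.sum_sub_distrib]

theorem fnet_idleFam : fnet (idleFam : Fam Γ) = 0 := by
  simp [fnet, idleFam, Pat.idle]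

theorem FRel.postLen_le {f : Fam Γ} {s s' : Stk Γ} (h : FRel f s s') :
    postLen f ≤ Olsh.ssize s' := by
  refine Finset.sum_le_sum fun k _ => ?_
  obtain ⟨a, -, -, h⟩ := h k
  rw [h]
  simp

variable {Q ι X : Type}

/-- A simulation whose invariant may use the bound on the number of letters. -/
def Sim.ofInv {R : Rules K Γ Q ι} {Acc : List X → ℕ → Prop} {g : ℕ → ℕ}
    (inp : K) (emb : X → Γ inp) (emb_inj : Function.Injective emb)
    (emb_surj : Function.Surjective emb) (pad : K → Bool) (pad_inp : pad inp = false)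
    (qin qout : Q) (corr : Q → ℤ) (C : ℕ) (Inv : ℕ → Q → Stk Γ → Prop)
    (net : ∀ i, fnet (R.fam i) + corr (R.dst i) = corr (R.src i))
    (init : ∀ N u s, IsIni inp emb pad u s → ssize s ≤ N →
      (Inv N qin s ↔ ¬ ∃ t, Acc u t ∧ g t ≤ C * (N + 1)))
    (step : ∀ (N : ℕ) i s s', FRel (R.fam i) s s' → (ssize s + corr (R.src i) : ℤ) ≤ N + corr qin →
      (ssize s' + corr (R.dst i) : ℤ) ≤ N + corr qin →
      (Inv N (R.src i) s ↔ Inv N (R.dst i) s'))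
    (final : ∀ N s, ¬ Inv N qout s)
    (complete : ∀ u t, Acc u t → ∃ s s', IsIni inp emb pad u s ∧ ssize s ≤ C * (g t + 1) ∧
      R.Conn (qin, s) (qout, s')) : Sim R Acc g where
  inp := inp
  emb := emb
  emb_inj := emb_inj
  emb_surj := emb_surj
  pad := pad
  pad_inp := pad_inp
  qin := qin
  qout := qout
  corr := corr
  C := C
  Inv N q s := (ssize s + corr q : ℤ) ≤ N + corr qin ∧ Inv N q s
  net := net
  init N u s h1 h2 h3 := ⟨by omega, (init N u s h1 h2).2 h3⟩
  step N i s s' h := by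
    have h1 := h.ssize
    have h2 := net i
    have h3 : (ssize s' + corr (R.dst i) : ℤ) = ssize s + corr (R.src i) := by linarith
    rw [h3]
    exact and_congr_right fun h4 => step N i s s' h h4 (h3.le.trans h4)
  back N u s h1 h2 := (init N u s h2 (by omega)).1 h1.2
  final N s h := final N s h.2
  complete := complete

end Aux

namespace PRS

open scoped Classical

variable {K : Type} {Γ : K → Type} {X : Type} (P : PRS K Γ X)

/-- The family erasing the accepting contents. -/
noncomputable def accFam : Fam Γ := Function.update testFam P.kst ⟨[P.qa], [], true⟩

theorem frel_accFam {x y : Stk Γ} : FRel P.accFam x y ↔ x = P.acc ∧ y = fun _ => [] := by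
  constructor
  · intro h
    have key : ∀ k, x k = P.acc k ∧ y k = [] := by
      intro k
      have := h k
      by_cases hk : k = P.kst
      · subst hk
        simpa [accFam, Pat.Rel] using this
      · rw [accFam, Function.update_of_ne hk] at this
        rw [P.acc_of_ne hk]
        exact Pat.rel_test.1 this
    exact ⟨funext fun k => (key k).1, funext fun k => (key k).2⟩
  · rintro ⟨rfl, rfl⟩ k
    by_cases hk : k = P.kst
    · subst hk
      simp [accFam, Pat.Rel]
    · rw [accFam, Function.update_of_ne hk, P.acc_of_ne hk]
      exact Pat.rel_test.2 ⟨rfl, rfl⟩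

theorem fnet_accFam [Fintype K] : fnet P.accFam = -1 := by
  unfold fnet
  rw [Finset.sum_eq_single P.kst]
  · simp [accFam]
  · intro k _ hk
    rw [accFam, Function.update_of_ne hk]
    simp [testFam, Pat.test]
  · simp

theorem ne_acc_of_head {x : Stk Γ} {k : K} {y : Γ k} {a : List (Γ k)} (h : x k = y :: a)
    (hy : (⟨k, y⟩ : Σ k, Γ k) ≠ ⟨P.kst, P.qa⟩) : x ≠ P.acc := by
  rintro rfl
  by_cases hk : k = P.kst
  · subst hk
    rw [acc_kst] at h
    simp only [List.cons.injEq] at h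
    exact hy (by rw [h.1])
  · rw [P.acc_of_ne hk] at h
    cases h

theorem exists_head {x : Stk Γ} (hx : P.Wf x) (h : x ≠ P.acc) : ∃ k y a, x k = y :: a ∧
    (⟨k, y⟩ : Σ k, Γ k) ≠ ⟨P.kst, P.qa⟩ := by
  obtain ⟨q, hq⟩ := hx
  by_contra! h2
  refine h (funext fun k => ?_)
  by_cases hk : k = P.kst
  · subst hk
    have := h2 _ _ _ hq
    simp only [Sigma.mk.injEq, heq_eq_eq, true_and] at this
    rw [hq, this, acc_kst]
  · rw [P.acc_of_ne hk]
    cases h3 : x k with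
    | nil => rfl
    | cons y a =>
      have := h2 _ _ _ h3
      simp only [Sigma.mk.injEq] at this
      exact (hk this.1).elim

end PRS

namespace DetSim

open scoped Classical

variable {K : Type} {Γ : K → Type} {X : Type}

/-- The stacks of the simulation of a deterministic system. -/
inductive AK (K : Type)
  | inp | tmp | pad
  | m (k : K)

/-- An equivalence used to enumerate the stacks. -/
def AK.equiv : Option (Option (Option K)) ≃ AK K where
  toFun
    | none => .inp
    | some none => .tmp
    | some (some none) => .pad
    | some (some (some k)) => .m k
  invFun
    | .inp => none
    | .tmp => some none
    | .pad => some (some none)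
    | .m k => some (some (some k))
  left_inv := by rintro (_ | _ | _ | k) <;> rfl
  right_inv := by rintro (_ | _ | _ | k) <;> rfl

instance [Fintype K] : Fintype (AK K) := Fintype.ofEquiv _ AK.equiv

theorem AK.sum [Fintype K] {A : Type} [AddCommMonoid A] (f : AK K → A) :
    ∑ k, f k = f .inp + (f .tmp + (f .pad + ∑ k, f (.m k))) := by
  rw [← AK.equiv.sum_comp f]
  simp only [Fintype.sum_option]
  rfl

/-- The stack alphabets. -/
abbrev AΓ (Γ : K → Type) (X : Type) : AK K → Type
  | .inp => X
  | .tmp => X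
  | .pad => Unit
  | .m k => Γ k

/-- A stack content. -/
def stk (i t : List X) (p : List Unit) (m : Stk Γ) : Stk (AΓ Γ X)
  | .inp => i
  | .tmp => t
  | .pad => p
  | .m k => m k

/-- A family of patterns. -/
def fam (i t : Pat X) (p : Pat Unit) (m : Fam Γ) : Fam (AΓ Γ X)
  | .inp => i
  | .tmp => t
  | .pad => p
  | .m k => m k

theorem exists_stk (s : Stk (AΓ Γ X)) : ∃ i t p m, s = stk i t p m :=
  ⟨s .inp, s .tmp, s .pad, fun k => s (.m k), by funext k; cases k <;> rfl⟩

theorem frel_fam {i t : Pat X} {p : Pat Unit} {m : Fam Γ} {i₁ t₁ p₁ m₁ i₂ t₂ p₂ m₂} :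
    FRel (fam i t p m) (stk i₁ t₁ p₁ m₁) (stk i₂ t₂ p₂ m₂) ↔
      i.Rel i₁ i₂ ∧ t.Rel t₁ t₂ ∧ p.Rel p₁ p₂ ∧ FRel m m₁ m₂ := by
  constructor
  · intro h
    exact ⟨h .inp, h .tmp, h .pad, fun k => h (.m k)⟩
  · rintro ⟨h1, h2, h3, h4⟩ (_ | _ | _ | k)
    exacts [h1, h2, h3, h4 k]

theorem fnet_fam [Fintype K] (i t : Pat X) (p : Pat Unit) (m : Fam Γ) : fnet (fam i t p m) =
    (i.post.length - i.pre.length) + ((t.post.length - t.pre.length) +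
      ((p.post.length - p.pre.length) + fnet m)) := by
  rw [fnet, AK.sum]
  rfl

theorem ssize_stk [Fintype K] (i t : List X) (p : List Unit) (m : Stk Γ) :
    ssize (stk i t p m) = i.length + (t.length + (p.length + ssize m)) := by
  rw [ssize, AK.sum]
  rfl

/-- The states. -/
inductive AQ
  | load | unload | run | check | out

instance : Finite AQ := by
  refine Finite.of_surjective (fun x : Fin 5 => match x with
    | 0 => AQ.load
    | 1 => .unload
    | 2 => .run
    | 3 => .check
    | 4 => .out) ?_
  rintro (_ | _ | _ | _ | _)
  exacts [⟨0, rfl⟩, ⟨1, rfl⟩, ⟨2, rfl⟩, ⟨3, rfl⟩, ⟨4, rfl⟩]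

variable (P : PRS K Γ X)

/-- The names of the rules. -/
inductive AR
  | load (x : X)
  | turn
  | unload (x : X)
  | begin
  | check (p : {p : Σ k, Γ k // p ≠ ⟨P.kst, P.qa⟩})
  | step (t : P.ι)
  | fin

instance [Finite K] [∀ k, Finite (Γ k)] [Finite X] [Finite P.ι] : Finite (AR P) := by
  refine Finite.of_surjective
    (fun x : Fin 3 ⊕ X ⊕ X ⊕ {p : Σ k, Γ k // p ≠ ⟨P.kst, P.qa⟩} ⊕ P.ι => match x with
    | .inl 0 => AR.turn
    | .inl 1 => .begin
    | .inl 2 => .fin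
    | .inr (.inl x) => .load x
    | .inr (.inr (.inl x)) => .unload x
    | .inr (.inr (.inr (.inl p))) => .check p
    | .inr (.inr (.inr (.inr t))) => .step t) ?_
  rintro (x | _ | x | _ | p | t | _)
  exacts [⟨.inr (.inl x), rfl⟩, ⟨.inl 0, rfl⟩, ⟨.inr (.inr (.inl x)), rfl⟩, ⟨.inl 1, rfl⟩,
    ⟨.inr (.inr (.inr (.inl p))), rfl⟩, ⟨.inr (.inr (.inr (.inr t))), rfl⟩, ⟨.inl 2, rfl⟩]

theorem load_snoc (w : List X) (x : X) (m : Stk Γ) :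
    (fun k => P.load (w ++ [x]) k ++ m k) =
      fun k => P.load w k ++ Function.update m P.kin (P.emb x :: m P.kin) k := by
  funext k
  by_cases h1 : k = P.kin
  · subst h1
    simp
  · by_cases h2 : k = P.kst
    · subst h2
      simp [h1]
    · simp [h1, h2, P.load_of_ne]

theorem load_nil (m : Stk Γ) :
    (fun k => P.load [] k ++ m k) = Function.update m P.kst (P.qs :: m P.kst) := by
  funext k
  by_cases h1 : k = P.kst
  · subst h1
    simp
  · by_cases h2 : k = P.kin
    · subst h2
      simp [h1]
    · simp [h1, h2, P.load_of_ne]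

variable [Fintype K]

/-- The rules. -/
noncomputable def rules : Rules (AK K) (AΓ Γ X) AQ (AR P) where
  src
    | .load _ => .load
    | .turn => .load
    | .unload _ => .unload
    | .begin => .unload
    | .check _ => .run
    | .step _ => .check
    | .fin => .run
  dst
    | .load _ => .load
    | .turn => .unload
    | .unload _ => .unload
    | .begin => .run
    | .check _ => .check
    | .step _ => .run
    | .fin => .out
  fam
    | .load x => fam (.pop x) (.push x) .idle idleFam
    | .turn => fam .test .idle .idle idleFam
    | .unload x => fam .idle (.pop x) .idle (single P.kin (.push (P.emb x)))
    | .begin => fam .idle .test .idle (single P.kst (.push P.qs))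
    | .check p => fam .idle .idle .idle (single p.1.1 (.peek p.1.2))
    | .step t => fam .idle .idle (.unary (postLen (P.fam t)) (preLen (P.fam t))) (P.fam t)
    | .fin => fam .idle .idle .idle P.accFam

/-- The space bound for the simulated computations. -/
def bd (N : ℕ) : ℕ := 2 * (N + 1) + 1

/-- The invariant. -/
def Inv (N : ℕ) : AQ → Stk (AΓ Γ X) → Prop
  | .load, s => ¬ P.AccW (bd N)
      (fun k => P.load ((s .tmp).reverse ++ s .inp) k ++ s (.m k))
  | .unload, s => s .inp = [] ∧ ¬ P.AccW (bd N)
      (fun k => P.load (s .tmp).reverse k ++ s (.m k))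
  | .run, s => s .inp = [] ∧ s .tmp = [] ∧ ¬ P.AccW (bd N) (fun k => s (.m k))
  | .check, s => s .inp = [] ∧ s .tmp = [] ∧
      ∀ x, P.Step (fun k => s (.m k)) x → ¬ P.AccW (bd N) x
  | .out, _ => False

/-- The correction terms. -/
def corr : AQ → ℤ
  | .load => 1
  | .unload => 1
  | .run => 0
  | .check => 0
  | .out => 1

theorem net (i : AR P) : fnet ((rules P).fam i) + corr ((rules P).dst i) =
    corr ((rules P).src i) := by
  cases i with
  | step t =>
    simp only [rules, corr, fnet_fam]
    rw [fnet_eq (P.fam t)]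
    simp [Pat.idle, Pat.unary]
  | _ =>
    simp only [rules, corr, fnet_fam, fnet_single, P.fnet_accFam, fnet_idleFam]
    simp [Pat.pop, Pat.push, Pat.idle, Pat.test, Pat.peek]

theorem inv_step (hdet : ∀ {x y z}, P.Step x y → P.Step x z → y = z) (N : ℕ) (i : AR P)
    (s s' : Stk (AΓ Γ X)) (h : FRel ((rules P).fam i) s s')
    (hs : (ssize s + corr ((rules P).src i) : ℤ) ≤ N + 1) :
    Inv P N ((rules P).src i) s ↔ Inv P N ((rules P).dst i) s' := by
  obtain ⟨i₁, t₁, p₁, m₁, rfl⟩ := exists_stk s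
  obtain ⟨i₂, t₂, p₂, m₂, rfl⟩ := exists_stk s'
  cases i with
  | load x =>
    simp only [rules, frel_fam, Pat.rel_pop, Pat.rel_push, Pat.rel_idle, frel_idleFam] at h
    obtain ⟨rfl, rfl, rfl, rfl⟩ := h
    simp [rules, Inv, stk]
  | turn =>
    simp only [rules, frel_fam, Pat.rel_test, Pat.rel_idle, frel_idleFam] at h
    obtain ⟨⟨rfl, rfl⟩, rfl, rfl, rfl⟩ := h
    simp [rules, Inv, stk]
  | unload x =>
    simp only [rules, frel_fam, Pat.rel_pop, Pat.rel_idle, frel_single_push] at h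
    obtain ⟨rfl, rfl, rfl, rfl⟩ := h
    simp [rules, Inv, stk, load_snoc]
  | begin =>
    simp only [rules, frel_fam, Pat.rel_test, Pat.rel_idle, frel_single_push] at h
    obtain ⟨rfl, ⟨rfl, rfl⟩, rfl, rfl⟩ := h
    simp [rules, Inv, stk, load_nil]
  | check p =>
    obtain ⟨⟨k, y⟩, hp⟩ := p
    simp only [rules, frel_fam, Pat.rel_idle, frel_single_peek] at h
    obtain ⟨rfl, rfl, rfl, rfl, a, ha⟩ := h
    have hne := P.ne_acc_of_head ha hp
    simp only [rules, corr, ssize_stk] at hs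
    simp only [rules, Inv, stk]
    refine and_congr_right fun _ => and_congr_right fun _ => ⟨fun h x hx h2 => ?_, fun h h2 => ?_⟩
    · have h3 : ssize m₂ ≤ bd N := by
        unfold bd
        omega
      exact h (h2.head hx h3)
    · rcases Relation.ReflTransGen.cases_head h2.2 with h3 | ⟨x, h3, h4⟩
      · exact hne h3
      · exact h x h3.1 ⟨h3.2.2, h4⟩
  | step t =>
    simp only [rules, frel_fam, Pat.rel_idle] at h
    obtain ⟨rfl, rfl, -, h⟩ := h
    simp only [rules, Inv, stk]
    refine and_congr_right fun _ => and_congr_right fun _ => ⟨fun h2 => h2 _ ⟨t, h⟩, ?_⟩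
    rintro h2 x hx
    obtain rfl := hdet hx ⟨t, h⟩
    exact h2
  | fin =>
    simp only [rules, frel_fam, Pat.rel_idle, P.frel_accFam] at h
    obtain ⟨rfl, rfl, rfl, rfl, rfl⟩ := h
    simp only [rules, Inv, stk]
    simp only [iff_false, not_and, not_not]
    exact fun _ _ => P.accW_acc (by unfold bd; omega)

variable {P}

theorem conn_load (w v : List X) (p : List Unit) (m : Stk Γ) :
    (rules P).Conn (.load, stk w v p m) (.load, stk [] (w.reverse ++ v) p m) := by
  induction w generalizing v with
  | nil => exact .refl
  | cons x w ih =>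
    refine .head ⟨.load x, .inl ⟨rfl, rfl, ?_⟩⟩ (by simpa [Rules.Conn] using ih (x :: v))
    simp [rules, frel_fam, frel_idleFam]

theorem conn_unload (w : List X) (p : List Unit) (m : Stk Γ) :
    (rules P).Conn (.unload, stk [] w p m) (.run, stk [] [] p
      (fun k => P.load w.reverse k ++ m k)) := by
  induction w generalizing m with
  | nil =>
    refine .single ⟨.begin, .inl ⟨rfl, rfl, ?_⟩⟩
    simp [rules, frel_fam, frel_single_push, load_nil]
  | cons x w ih =>
    rw [List.reverse_cons, load_snoc]
    refine .head ⟨.unload x, .inl ⟨rfl, rfl, ?_⟩⟩ (ih _)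
    simp [rules, frel_fam, frel_single_push]

theorem conn_run {N : ℕ} {x : Stk Γ} (h : Relation.ReflTransGen (P.StepW N) x P.acc) :
    ∀ p : List Unit, p.length + ssize x = 2 * N →
      ∃ s', (rules P).Conn (.run, stk [] [] p x) (.out, s') := by
  induction h using Relation.ReflTransGen.head_induction_on with
  | refl =>
    intro p _
    refine ⟨stk [] [] p fun _ => [], .single ⟨.fin, .inl ⟨rfl, rfl, ?_⟩⟩⟩
    simp [rules, frel_fam, P.frel_accFam]
  | @head x y h _ ih =>
    intro p hp
    obtain ⟨h1, h2, h3⟩ := h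
    by_cases hx : x = P.acc
    · subst hx
      refine ⟨stk [] [] p fun _ => [], .single ⟨.fin, .inl ⟨rfl, rfl, ?_⟩⟩⟩
      simp [rules, frel_fam, P.frel_accFam]
    · obtain ⟨k, z, a, h4, h5⟩ := P.exists_head h1.wf_left hx
      obtain ⟨t, h6⟩ := h1
      have h7 := h6.ssize
      rw [fnet_eq] at h7
      have h8 := h6.postLen_le
      obtain ⟨s', hs'⟩ := ih (List.replicate (2 * N - ssize y) ()) (by simp; omega)
      refine ⟨s', .head (b := (.check, stk [] [] p x))
        ⟨.check ⟨⟨k, z⟩, h5⟩, .inl ⟨rfl, rfl, ?_⟩⟩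
        (.head ⟨.step t, .inl ⟨rfl, rfl, ?_⟩⟩ hs')⟩
      · simp [rules, frel_fam, frel_single_peek, h4]
      · simp only [rules, frel_fam, Pat.rel_idle, Pat.rel_unary, List.length_replicate, true_and]
        exact ⟨⟨by omega, by omega⟩, h6⟩

/-- The simulation of a deterministic machine. -/
noncomputable def sim {T X : Type} [Fintype T] (M : TM T X) (hdet : M.Deterministic) :
    Sim (rules M.prs) (fun u s => M.AcceptsWithin (M.inputConf u) s) id := by
  refine Sim.ofInv .inp id Function.injective_id Function.surjective_id
    (fun k => match k with
      | .pad => true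
      | _ => false) rfl .load .out corr 2 (Inv M.prs) (net M.prs) ?_ ?_ ?_ ?_
  · intro N u s hs _
    obtain ⟨h1, h2⟩ := hs
    have h3 : ∀ k, s (.m k) = [] := fun k => h2 (.m k) (by simp) rfl
    have h4 : s .tmp = [] := h2 .tmp (by simp) rfl
    have h1 : s .inp = u.reverse := by simpa using h1
    have h5 : (fun k => M.prs.load ((s .tmp).reverse ++ s .inp) k ++ s (.m k)) =
        M.prs.start u := by
      funext k
      rw [h3, h4, h1]
      simp [PRS.start]
    simp only [Inv, h5, bd, M.accW_start, id]
    refine not_congr ⟨fun h => ⟨_, h, le_rfl⟩, ?_⟩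
    rintro ⟨t, h, ht⟩
    exact h.mono ht
  · intro N i s s' h h1 _
    exact inv_step M.prs (M.prs_det hdet) N i s s' h h1
  · exact fun N s h => h
  · intro u t h
    rw [← M.accW_start] at h
    obtain ⟨h1, h2⟩ := h
    set p : List Unit := List.replicate (2 * (t + 1) - ssize (M.prs.start u)) () with hp
    obtain ⟨s', hs'⟩ := conn_run h2 p (by simp [hp]; omega)
    have h3 : (fun k => M.prs.load u.reverse k ++ []) = M.prs.start u := by
      funext k
      simp [PRS.start]
    have h4 := conn_unload (P := M.prs) u p (fun _ => [])
    rw [h3] at h4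
    refine ⟨stk u.reverse [] p fun _ => [], s', ⟨by simp [stk], ?_⟩, ?_,
      (conn_load u.reverse [] p _).trans (.head (b := (.unload, stk [] u p fun _ => []))
        ⟨.turn, .inl ⟨rfl, rfl, ?_⟩⟩ (h4.trans hs'))⟩
    · rintro (_ | _ | _ | k) h5 h6
      · exact (h5 rfl).elim
      · rfl
      · cases h6
      · rfl
    · have h5 : u.length ≤ ssize (M.prs.start u) := by
        have := length_le_ssize (M.prs.start u) M.prs.kin
        simpa [PRS.start] using this
      rw [ssize_stk, ssize_eq_zero.2 rfl]
      simp [hp]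
      omega
    · simp [rules, frel_fam, frel_idleFam]

end DetSim

section StackWords

open scoped Classical

variable {K : Type} {Γ : K → Type}

/-- The alphabets with an additional separator. -/
abbrev OΓ (Γ : K → Type) : K → Type := fun k => Option (Γ k)

/-- Putting contents on top of contents with separators. -/
def cat (a : Stk Γ) (σ : Stk (OΓ Γ)) : Stk (OΓ Γ) := fun k => (a k).map some ++ σ k

/-- Putting separators on top. -/
def sep (σ : Stk (OΓ Γ)) : Stk (OΓ Γ) := fun k => none :: σ k

/-- Reversing contents. -/
def rev (a : Stk Γ) : Stk Γ := fun k => (a k).reverse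

/-- Concatenating contents. -/
def app (a b : Stk Γ) : Stk Γ := fun k => a k ++ b k

/-- The contents representing a list of contents. -/
def encS : List (Stk Γ) → Stk (OΓ Γ)
  | [] => fun _ => []
  | x :: l => cat x (sep (encS l))

theorem cat_cat (a b : Stk Γ) (σ : Stk (OΓ Γ)) : cat a (cat b σ) = cat (app a b) σ := by
  funext k
  simp [cat, app]

@[simp] theorem rev_nil : rev (fun _ => [] : Stk Γ) = fun _ => [] := rfl

@[simp] theorem cat_nil (σ : Stk (OΓ Γ)) : cat (fun _ => []) σ = σ := rfl

@[simp] theorem app_nil (a : Stk Γ) : app a (fun _ => []) = a := by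
  funext k
  simp [app]

@[simp] theorem nil_app (a : Stk Γ) : app (fun _ => []) a = a := rfl

theorem map_some_append_none_inj {A : Type} {a b : List A} {r t : List (Option A)}
    (h : a.map some ++ none :: r = b.map some ++ none :: t) : a = b ∧ r = t := by
  induction a generalizing b with
  | nil =>
    cases b with
    | nil => simpa using h
    | cons y b => simp at h
  | cons x a ih =>
    cases b with
    | nil => simp at h
    | cons y b =>
      simp only [List.map_cons, List.cons_append, List.cons.injEq, Option.some.injEq] at h
      obtain ⟨rfl, rfl⟩ := ih h.2
      exact ⟨by rw [h.1], rfl⟩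

theorem cat_sep_inj {a b : Stk Γ} {σ τ : Stk (OΓ Γ)} (h : cat a (sep σ) = cat b (sep τ)) :
    a = b ∧ σ = τ := by
  have key := fun k => map_some_append_none_inj (congrFun h k)
  exact ⟨funext fun k => (key k).1, funext fun k => (key k).2⟩

/-- The contents represent a list of contents with the given property. -/
def OK (B : Stk Γ → Prop) (σ : Stk (OΓ Γ)) : Prop := ∃ l, σ = encS l ∧ ∀ z ∈ l, B z

variable {B : Stk Γ → Prop}

theorem ok_nil : OK B (fun _ => []) := ⟨[], rfl, by simp⟩

theorem ok_cat_sep [Nonempty K] {a : Stk Γ} {σ : Stk (OΓ Γ)} :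
    OK B (cat a (sep σ)) ↔ B a ∧ OK B σ := by
  constructor
  · rintro ⟨l, h1, h2⟩
    cases l with
    | nil =>
      have := congrFun h1 (Classical.arbitrary K)
      simp [cat, sep, encS] at this
    | cons z l =>
      obtain ⟨rfl, rfl⟩ := cat_sep_inj h1
      exact ⟨h2 _ (by simp), l, rfl, fun y hy => h2 y (by simp [hy])⟩
  · rintro ⟨h, l, rfl, h2⟩
    refine ⟨a :: l, rfl, ?_⟩
    simpa [h] using h2

theorem cat_rev_push (W : Stk Γ) (S : Stk (OΓ Γ)) (k : K) (y : Γ k) :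
    cat (rev (Function.update W k (y :: W k))) S =
      cat (rev W) (Function.update S k (some y :: S k)) := by
  funext j
  by_cases hj : j = k
  · subst hj
    simp [cat, rev]
  · simp [cat, rev, hj]

theorem frel_sepPush {σ σ' : Stk (OΓ Γ)} :
    FRel (fun _ => .push none) σ σ' ↔ σ' = sep σ := by
  simp only [FRel, Pat.rel_push]
  exact ⟨fun h => funext h, fun h k => by rw [h]; rfl⟩

theorem frel_sepPop {σ σ' : Stk (OΓ Γ)} :
    FRel (fun _ => .pop none) σ σ' ↔ σ = sep σ' := by
  simp only [FRel, Pat.rel_pop]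
  exact ⟨fun h => funext h, fun h k => by rw [h]; rfl⟩

theorem frel_sepPeek {σ σ' : Stk (OΓ Γ)} :
    FRel (fun _ => .peek none) σ σ' ↔ σ' = σ ∧ ∃ τ, σ = sep τ := by
  simp only [FRel, Pat.rel_peek]
  constructor
  · intro h
    choose h1 τ h2 using h
    exact ⟨funext h1, τ, funext h2⟩
  · rintro ⟨rfl, τ, rfl⟩ k
    exact ⟨rfl, τ k, rfl⟩

/-- The left hand sides of a family. -/
def preS (f : Fam Γ) : Stk Γ := fun k => (f k).pre

/-- The right hand sides of a family. -/
def postS (f : Fam Γ) : Stk Γ := fun k => (f k).post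

/-- Removing the left hand sides of a family from encoded contents. -/
def enter (f : Fam Γ) : Fam (OΓ Γ) := fun k =>
  ⟨(f k).pre.map some ++ (if (f k).anch then [none] else []),
    if (f k).anch then [none] else [], false⟩

/-- Adding the left hand sides of a family to encoded contents. -/
def leave (f : Fam Γ) : Fam (OΓ Γ) := fun k => (enter f k).inv

/-- Adding given letters to encoded contents. -/
def put (a : Stk Γ) : Fam (OΓ Γ) := fun k => ⟨[], (a k).map some, false⟩

/-- Removing given contents, and separators, from encoded contents. -/
def take (a : Stk Γ) : Fam (OΓ Γ) := fun k => ⟨(a k).map some ++ [none], [], false⟩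

theorem frel_enter {f : Fam Γ} {σ σ' : Stk (OΓ Γ)} : FRel (enter f) σ σ' ↔
    σ = cat (preS f) σ' ∧ ∀ k, (f k).anch = true → (σ' k).head? = some none := by
  have key : ∀ k, (enter f k).Rel (σ k) (σ' k) ↔ σ k = cat (preS f) σ' k ∧
      ((f k).anch = true → (σ' k).head? = some none) := by
    intro k
    unfold enter Pat.Rel cat preS
    by_cases h : (f k).anch = true
    · simp only [h, if_true, Bool.false_eq_true, false_imp_iff, true_and, true_imp_iff]
      constructor
      · rintro ⟨a, h1, h2⟩
        rw [h1, h2]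
        simp
      · rintro ⟨h1, h2⟩
        obtain ⟨a, ha⟩ := List.head?_eq_some_iff.1 h2
        refine ⟨a, ?_, by simpa using ha⟩
        rw [h1, ha]
        simp
    · simp [h]
  unfold FRel
  rw [funext_iff, ← forall_and]
  exact forall_congr' key

theorem frel_leave {f : Fam Γ} {σ σ' : Stk (OΓ Γ)} : FRel (leave f) σ σ' ↔
    σ' = cat (preS f) σ ∧ ∀ k, (f k).anch = true → (σ k).head? = some none := by
  rw [← frel_enter]
  exact forall_congr' fun k => Pat.rel_inv

theorem frel_put {a : Stk Γ} {σ σ' : Stk (OΓ Γ)} : FRel (put a) σ σ' ↔ σ' = cat a σ := by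
  rw [funext_iff]
  refine forall_congr' fun k => ?_
  simp [put, Pat.Rel, cat]

theorem frel_take {a : Stk Γ} {σ σ' : Stk (OΓ Γ)} :
    FRel (take a) σ σ' ↔ σ = cat a (sep σ') := by
  rw [funext_iff]
  refine forall_congr' fun k => ?_
  simp [take, Pat.Rel, cat, sep]

theorem frel_app {f : Fam Γ} {a : Stk Γ} (h : ∀ k, (f k).anch = true → a k = []) :
    FRel f (app (preS f) a) (app (postS f) a) := fun k => ⟨a k, h k, rfl, rfl⟩

theorem FRel.exists_app {f : Fam Γ} {x y : Stk Γ} (h : FRel f x y) :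
    ∃ a, (∀ k, (f k).anch = true → a k = []) ∧ x = app (preS f) a ∧ y = app (postS f) a := by
  choose a h1 h2 h3 using h
  exact ⟨a, h1, funext h2, funext h3⟩

variable [Fintype K]

theorem ssize_push (W : Stk Γ) (k : K) (y : Γ k) :
    ssize (Function.update W k (y :: W k)) = ssize W + 1 := by
  have h := (frel_single_push (k := k) (y := y) (s := W)).2 rfl
  have h2 := h.ssize
  rw [fnet_single] at h2
  simp only [Pat.push, List.length_singleton, List.length_nil] at h2
  omega

@[simp] theorem ssize_nil : ssize (fun _ => [] : Stk Γ) = 0 := ssize_eq_zero.2 rfl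

@[simp] theorem ssize_cat (a : Stk Γ) (σ : Stk (OΓ Γ)) : ssize (cat a σ) = ssize a + ssize σ := by
  simp [ssize, cat, Finset.sum_add_distrib]

@[simp] theorem ssize_sep (σ : Stk (OΓ Γ)) : ssize (sep σ) = ssize σ + Fintype.card K := by
  simp [ssize, sep, Finset.sum_add_distrib]

@[simp] theorem ssize_app (a b : Stk Γ) : ssize (app a b) = ssize a + ssize b := by
  simp [ssize, app, Finset.sum_add_distrib]

@[simp] theorem ssize_rev (a : Stk Γ) : ssize (rev a) = ssize a := by
  simp [ssize, rev]

theorem ssize_preS (f : Fam Γ) : ssize (preS f) = preLen f := rfl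

theorem ssize_postS (f : Fam Γ) : ssize (postS f) = postLen f := rfl

theorem fnet_testFam : fnet (testFam : Fam Γ) = 0 := by
  simp [fnet, testFam, Pat.test]

theorem fnet_sepPush : fnet (fun _ => .push none : Fam (OΓ Γ)) = Fintype.card K := by
  simp [fnet, Pat.push]

theorem fnet_sepPop : fnet (fun _ => .pop none : Fam (OΓ Γ)) = -Fintype.card K := by
  simp [fnet, Pat.pop]

theorem fnet_sepPeek : fnet (fun _ => .peek none : Fam (OΓ Γ)) = 0 := by
  simp [fnet, Pat.peek]

theorem fnet_enter (f : Fam Γ) : fnet (enter f) = -preLen f := by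
  simp [fnet, enter, preLen]

theorem fnet_leave (f : Fam Γ) : fnet (leave f) = preLen f := by
  simp [fnet, leave, enter, preLen, Pat.inv]

theorem fnet_put (a : Stk Γ) : fnet (put a) = ssize a := by
  simp [fnet, put, ssize]

theorem fnet_take (a : Stk Γ) : fnet (take a) = -(ssize a + Fintype.card K : ℤ) := by
  simp only [fnet, take, ssize]
  simp [Finset.sum_add_distrib]

end StackWords

namespace PebSim

open scoped Classical

variable {K : Type} {Γ : K → Type} {X : Type}

/-- The stacks of the simulation of a nondeterministic system. -/
inductive BK (K : Type)
  | inp | tmp | pad | ru | pd | pv | d | e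
  | W (k : K)
  | S (k : K)
  | S' (k : K)

/-- An equivalence used to enumerate the stacks. -/
def BK.equiv : Fin 8 ⊕ K ⊕ K ⊕ K ≃ BK K where
  toFun
    | .inl 0 => .inp
    | .inl 1 => .tmp
    | .inl 2 => .pad
    | .inl 3 => .ru
    | .inl 4 => .pd
    | .inl 5 => .pv
    | .inl 6 => .d
    | .inl 7 => .e
    | .inr (.inl k) => .W k
    | .inr (.inr (.inl k)) => .S k
    | .inr (.inr (.inr k)) => .S' k
  invFun
    | .inp => .inl 0
    | .tmp => .inl 1
    | .pad => .inl 2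
    | .ru => .inl 3
    | .pd => .inl 4
    | .pv => .inl 5
    | .d => .inl 6
    | .e => .inl 7
    | .W k => .inr (.inl k)
    | .S k => .inr (.inr (.inl k))
    | .S' k => .inr (.inr (.inr k))
  left_inv := by
    rintro (i | k | k | k)
    · fin_cases i <;> rfl
    all_goals rfl
  right_inv := by rintro (_ | _ | _ | _ | _ | _ | _ | _ | k | k | k) <;> rfl

instance [Fintype K] : Fintype (BK K) := Fintype.ofEquiv _ BK.equiv

theorem BK.sum [Fintype K] {A : Type} [AddCommMonoid A] (f : BK K → A) :
    ∑ k, f k = f .inp + f .tmp + f .pad + f .ru + f .pd + f .pv + f .d + f .e +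
      (∑ k, f (.W k) + (∑ k, f (.S k) + ∑ k, f (.S' k))) := by
  rw [← BK.equiv.sum_comp f]
  simp only [Fintype.sum_sum_type, Fin.sum_univ_eight]
  rfl

/-- The stack alphabets. -/
abbrev BΓ (Γ : K → Type) (X : Type) : BK K → Type
  | .inp => X
  | .tmp => X
  | .pad => Unit
  | .ru => Unit
  | .pd => Unit
  | .pv => Unit
  | .d => Unit
  | .e => Unit
  | .W k => Γ k
  | .S k => Option (Γ k)
  | .S' k => Option (Γ k)

/-- Stack contents, with unary stacks given by their heights. -/
@[ext] structure Cfg (Γ : K → Type) (X : Type) where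
  i : List X
  t : List X
  pad : ℕ
  ru : ℕ
  pd : ℕ
  pv : ℕ
  d : ℕ
  e : ℕ
  W : Stk Γ
  S : Stk (OΓ Γ)
  S' : Stk (OΓ Γ)

/-- The stack contents described by a record. -/
def Cfg.toStk (c : Cfg Γ X) : Stk (BΓ Γ X)
  | .inp => c.i
  | .tmp => c.t
  | .pad => List.replicate c.pad ()
  | .ru => List.replicate c.ru ()
  | .pd => List.replicate c.pd ()
  | .pv => List.replicate c.pv ()
  | .d => List.replicate c.d ()
  | .e => List.replicate c.e ()
  | .W k => c.W k
  | .S k => c.S k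
  | .S' k => c.S' k

/-- The record describing stack contents. -/
def Cfg.ofStk (s : Stk (BΓ Γ X)) : Cfg Γ X where
  i := s .inp
  t := s .tmp
  pad := (s .pad).length
  ru := (s .ru).length
  pd := (s .pd).length
  pv := (s .pv).length
  d := (s .d).length
  e := (s .e).length
  W k := s (.W k)
  S k := s (.S k)
  S' k := s (.S' k)

@[simp] theorem Cfg.ofStk_toStk (c : Cfg Γ X) : Cfg.ofStk c.toStk = c := by
  simp [Cfg.ofStk, Cfg.toStk]

theorem exists_cfg (s : Stk (BΓ Γ X)) : ∃ c : Cfg Γ X, s = c.toStk := by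
  refine ⟨Cfg.ofStk s, ?_⟩
  funext k
  cases k <;> first | rfl | exact unit_list_ext (by simp [Cfg.ofStk, Cfg.toStk])

/-- Patterns for all stacks. -/
structure Pats (Γ : K → Type) (X : Type) where
  i : Pat X := .idle
  t : Pat X := .idle
  pad : Pat Unit := .unary 0 0
  ru : Pat Unit := .unary 0 0
  pd : Pat Unit := .unary 0 0
  pv : Pat Unit := .unary 0 0
  d : Pat Unit := .unary 0 0
  e : Pat Unit := .unary 0 0
  W : Fam Γ := idleFam
  S : Fam (OΓ Γ) := idleFam
  S' : Fam (OΓ Γ) := idleFam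

/-- The family of patterns described by a record. -/
def Pats.toFam (p : Pats Γ X) : Fam (BΓ Γ X)
  | .inp => p.i
  | .tmp => p.t
  | .pad => p.pad
  | .ru => p.ru
  | .pd => p.pd
  | .pv => p.pv
  | .d => p.d
  | .e => p.e
  | .W k => p.W k
  | .S k => p.S k
  | .S' k => p.S' k

/-- The relation of heights defined by a pattern. -/
def URel (p : Pat Unit) (m n : ℕ) : Prop := p.Rel (List.replicate m ()) (List.replicate n ())

@[simp] theorem urel_unary {a b m n : ℕ} : URel (.unary a b) m n ↔ a ≤ m ∧ n + a = m + b := by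
  simp [URel]

@[simp] theorem urel_test {m n : ℕ} : URel .test m n ↔ m = 0 ∧ n = 0 := by
  simp [URel]

theorem frel_toFam {p : Pats Γ X} {c c' : Cfg Γ X} : FRel p.toFam c.toStk c'.toStk ↔
    p.i.Rel c.i c'.i ∧ p.t.Rel c.t c'.t ∧ URel p.pad c.pad c'.pad ∧ URel p.ru c.ru c'.ru ∧
    URel p.pd c.pd c'.pd ∧ URel p.pv c.pv c'.pv ∧ URel p.d c.d c'.d ∧ URel p.e c.e c'.e ∧
    FRel p.W c.W c'.W ∧ FRel p.S c.S c'.S ∧ FRel p.S' c.S' c'.S' := by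
  constructor
  · intro h
    exact ⟨h .inp, h .tmp, h .pad, h .ru, h .pd, h .pv, h .d, h .e, fun k => h (.W k),
      fun k => h (.S k), fun k => h (.S' k)⟩
  · rintro ⟨h1, h2, h3, h4, h5, h6, h7, h8, h9, h10, h11⟩ (_ | _ | _ | _ | _ | _ | _ | _ | k | k | k)
    exacts [h1, h2, h3, h4, h5, h6, h7, h8, h9 k, h10 k, h11 k]

/-- The net number of letters added by a pattern. -/
def pnet {A : Type} (p : Pat A) : ℤ := p.post.length - p.pre.length

@[simp] theorem pnet_unary (a b : ℕ) : pnet (.unary a b) = b - a := by simp [pnet, Pat.unary]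
@[simp] theorem pnet_test {A : Type} : pnet (.test : Pat A) = 0 := by simp [pnet, Pat.test]
@[simp] theorem pnet_idle {A : Type} : pnet (.idle : Pat A) = 0 := by simp [pnet, Pat.idle]
@[simp] theorem pnet_pop {A : Type} (x : A) : pnet (.pop x) = -1 := by simp [pnet, Pat.pop]
@[simp] theorem pnet_push {A : Type} (x : A) : pnet (.push x) = 1 := by simp [pnet, Pat.push]

theorem fnet_single_eq_pnet {J : Type} [Fintype J] {Δ : J → Type} (k : J) (p : Pat (Δ k)) :
    fnet (single k p) = pnet p := fnet_single k p

theorem fnet_toFam [Fintype K] (p : Pats Γ X) : fnet p.toFam = pnet p.i + pnet p.t + pnet p.pad +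
    pnet p.ru + pnet p.pd + pnet p.pv + pnet p.d + pnet p.e +
      (fnet p.W + (fnet p.S + fnet p.S')) := by
  rw [fnet, BK.sum]
  rfl

theorem ssize_toStk [Fintype K] (c : Cfg Γ X) : ssize c.toStk = c.i.length + c.t.length + c.pad +
    c.ru + c.pd + c.pv + c.d + c.e + (ssize c.W + (ssize c.S + ssize c.S')) := by
  rw [ssize, BK.sum]
  simp only [Cfg.toStk, List.length_replicate]
  rfl

/-- The states. -/
inductive BQ (ι : Type)
  | prep | mb | mc | tr | idle | sh | sh' | out
  | down (t : ι)
  | up (t : ι)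

instance {ι : Type} [Finite ι] : Finite (BQ ι) := by
  refine Finite.of_surjective (fun x : Fin 8 ⊕ ι ⊕ ι => match x with
    | .inl 0 => BQ.prep
    | .inl 1 => .mb
    | .inl 2 => .mc
    | .inl 3 => .tr
    | .inl 4 => .idle
    | .inl 5 => .sh
    | .inl 6 => .sh'
    | .inl 7 => .out
    | .inr (.inl t) => .down t
    | .inr (.inr t) => .up t) ?_
  rintro (_ | _ | _ | _ | _ | _ | _ | _ | t | t)
  exacts [⟨.inl 0, rfl⟩, ⟨.inl 1, rfl⟩, ⟨.inl 2, rfl⟩, ⟨.inl 3, rfl⟩, ⟨.inl 4, rfl⟩, ⟨.inl 5, rfl⟩,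
    ⟨.inl 6, rfl⟩, ⟨.inl 7, rfl⟩, ⟨.inr (.inl t), rfl⟩, ⟨.inr (.inr t), rfl⟩]

variable (P : PRS K Γ X)

/-- The names of the rules. -/
inductive BR
  | grow | mb | turn | mc | done | start | begin | fin | sh | shMid | shEnd
  | load (x : X)
  | unload (x : X)
  | down (t : P.ι)
  | flip (t : P.ι)
  | leave (t : P.ι)
  | dl (t : P.ι) (k : K) (y : Γ k)
  | ul (t : P.ι) (k : K) (y : Γ k)
  | sl (k : K) (y : Γ k)
  | sl' (k : K) (y : Γ k)

instance [Finite K] [∀ k, Finite (Γ k)] [Finite X] [Finite P.ι] : Finite (BR P) := by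
  refine Finite.of_surjective
    (fun x : Fin 11 ⊕ (Bool × X) ⊕ (Fin 3 × P.ι) ⊕ (Bool × P.ι × Σ k, Γ k) ⊕ (Bool × Σ k, Γ k) =>
      match x with
      | .inl 0 => BR.grow
      | .inl 1 => .mb
      | .inl 2 => .turn
      | .inl 3 => .mc
      | .inl 4 => .done
      | .inl 5 => .start
      | .inl 6 => .begin
      | .inl 7 => .fin
      | .inl 8 => .sh
      | .inl 9 => .shMid
      | .inl 10 => .shEnd
      | .inr (.inl (false, x)) => .load x
      | .inr (.inl (true, x)) => .unload x
      | .inr (.inr (.inl (0, t))) => .down t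
      | .inr (.inr (.inl (1, t))) => .flip t
      | .inr (.inr (.inl (2, t))) => .leave t
      | .inr (.inr (.inr (.inl (false, t, y)))) => .dl t y.1 y.2
      | .inr (.inr (.inr (.inl (true, t, y)))) => .ul t y.1 y.2
      | .inr (.inr (.inr (.inr (false, y)))) => .sl y.1 y.2
      | .inr (.inr (.inr (.inr (true, y)))) => .sl' y.1 y.2) ?_
  rintro (_ | _ | _ | _ | _ | _ | _ | _ | _ | _ | _ | x | x | t | t | t | ⟨t, k, y⟩ | ⟨t, k, y⟩ |
    ⟨k, y⟩ | ⟨k, y⟩)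
  exacts [⟨.inl 0, rfl⟩, ⟨.inl 1, rfl⟩, ⟨.inl 2, rfl⟩, ⟨.inl 3, rfl⟩, ⟨.inl 4, rfl⟩, ⟨.inl 5, rfl⟩,
    ⟨.inl 6, rfl⟩, ⟨.inl 7, rfl⟩, ⟨.inl 8, rfl⟩, ⟨.inl 9, rfl⟩, ⟨.inl 10, rfl⟩,
    ⟨.inr (.inl (false, x)), rfl⟩, ⟨.inr (.inl (true, x)), rfl⟩,
    ⟨.inr (.inr (.inl (0, t))), rfl⟩, ⟨.inr (.inr (.inl (1, t))), rfl⟩,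
    ⟨.inr (.inr (.inl (2, t))), rfl⟩,
    ⟨.inr (.inr (.inr (.inl (false, t, ⟨k, y⟩)))), rfl⟩,
    ⟨.inr (.inr (.inr (.inl (true, t, ⟨k, y⟩)))), rfl⟩,
    ⟨.inr (.inr (.inr (.inr (false, ⟨k, y⟩)))), rfl⟩,
    ⟨.inr (.inr (.inr (.inr (true, ⟨k, y⟩)))), rfl⟩]

theorem cat_load_snoc (w : List X) (x : X) (S : Stk (OΓ Γ)) :
    cat (P.load (w ++ [x])) S =
      cat (P.load w) (Function.update S P.kin (some (P.emb x) :: S P.kin)) := by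
  funext k
  unfold cat
  by_cases h1 : k = P.kin
  · subst h1
    simp
  · by_cases h2 : k = P.kst
    · subst h2
      simp [h1]
    · simp [h1, h2, P.load_of_ne]

theorem cat_load_nil (S : Stk (OΓ Γ)) :
    cat (P.load []) S = Function.update S P.kst (some P.qs :: S P.kst) := by
  funext k
  unfold cat
  by_cases h1 : k = P.kst
  · subst h1
    simp
  · by_cases h2 : k = P.kin
    · subst h2
      simp [h1]
    · simp [h1, h2, P.load_of_ne]

variable [Fintype K]

/-- The sources, targets and patterns of the rules. -/
noncomputable def rule : BR P → BQ P.ι × BQ P.ι × Pats Γ X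
  | .grow => (.prep, .mb, { ru := .unary 1 0, d := .unary 0 1, e := .test })
  | .mb => (.mb, .mb,
      { d := .unary 1 0, e := .unary 0 1, pad := .unary 1 0, pv := .unary 0 1 })
  | .turn => (.mb, .mc, { d := .test })
  | .mc => (.mc, .mc, { e := .unary 1 0, d := .unary 0 1 })
  | .done => (.mc, .prep, { e := .test })
  | .load x => (.prep, .prep, { i := .pop x, t := .push x })
  | .start => (.prep, .tr, { i := .test, S := fun _ => .push none })
  | .unload x => (.tr, .tr, { t := .pop x, S := single P.kin (.push (some (P.emb x))) })
  | .begin => (.tr, .idle, { t := .test, S := single P.kst (.push (some P.qs)) })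
  | .down t => (.idle, .down t, { W := testFam, S := enter (P.fam t) })
  | .dl t k y => (.down t, .down t,
      { S := single k (.pop (some y)), W := single k (.push y), d := .unary 1 0,
        pd := .unary 0 1 })
  | .flip t => (.down t, .up t, { S := fun _ => .peek none, S' := fun _ => .push none })
  | .ul t k y => (.up t, .up t,
      { W := single k (.pop y), S := single k (.push (some y)), S' := single k (.push (some y)),
        d := .unary 0 1, pd := .unary 2 0 })
  | .leave t => (.up t, .idle,
      { W := testFam, S := leave (P.fam t), S' := put (postS (P.fam t)),
        pd := .unary (Fintype.card K + postLen (P.fam t)) 0 })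
  | .sh => (.idle, .sh, { W := testFam })
  | .sl k y => (.sh, .sh, { S' := single k (.pop (some y)), W := single k (.push y) })
  | .shMid => (.sh, .sh', { S' := fun _ => .pop none, S := fun _ => .push none })
  | .sl' k y => (.sh', .sh', { W := single k (.pop y), S := single k (.push (some y)) })
  | .shEnd => (.sh', .idle, { W := testFam })
  | .fin => (.idle, .out, { S := take P.acc })

/-- The rules. -/
noncomputable def rules : Rules (BK K) (BΓ Γ X) (BQ P.ι) (BR P) where
  src r := (rule P r).1
  dst r := (rule P r).2.1
  fam r := (rule P r).2.2.toFam

/-- The correction terms. -/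
def corr : BQ P.ι → ℤ
  | .prep => Fintype.card K + 1
  | .mb => Fintype.card K + 1
  | .mc => Fintype.card K + 1
  | .tr => 1
  | .idle => 0
  | .sh => 0
  | .sh' => 0
  | .out => Fintype.card K + 1
  | .down t => preLen (P.fam t)
  | .up t => preLen (P.fam t) - Fintype.card K

theorem net (i : BR P) : fnet ((rules P).fam i) + corr P ((rules P).dst i) =
    corr P ((rules P).src i) := by
  cases i <;> simp [rules, rule, corr, fnet_toFam, fnet_idleFam, fnet_testFam,
    fnet_single_eq_pnet, fnet_sepPush, fnet_sepPop, fnet_sepPeek, fnet_enter, fnet_leave, fnet_put,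
    fnet_take, ssize_postS, PRS.ssize_acc] <;> ring

/-- The unary stacks store a triangular number. -/
def Tri (pv d : ℕ) : Prop := 2 * pv = d ^ 2 + d

/-- The invariant. -/
def InvC (b : ℕ) : BQ P.ι → Cfg Γ X → Prop
  | .prep, c => c.e = 0 ∧ Tri c.pv c.d ∧ c.W = (fun _ => []) ∧
      ¬ P.AccW b (P.load (c.t.reverse ++ c.i)) ∧
      OK (fun z => ¬ P.AccW b z) c.S ∧ OK (fun z => ¬ P.AccW b z) c.S'
  | .mb, c => 2 * c.pv + (c.d + c.e) = (c.d + c.e) ^ 2 + 2 * c.e ∧ c.W = (fun _ => []) ∧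
      ¬ P.AccW b (P.load (c.t.reverse ++ c.i)) ∧
      OK (fun z => ¬ P.AccW b z) c.S ∧ OK (fun z => ¬ P.AccW b z) c.S'
  | .mc, c => Tri c.pv (c.d + c.e) ∧ c.W = (fun _ => []) ∧
      ¬ P.AccW b (P.load (c.t.reverse ++ c.i)) ∧
      OK (fun z => ¬ P.AccW b z) c.S ∧ OK (fun z => ¬ P.AccW b z) c.S'
  | .tr, c => c.i = [] ∧ c.e = 0 ∧ Tri c.pv c.d ∧ c.W = (fun _ => []) ∧
      OK (fun z => ¬ P.AccW b z) (cat (P.load c.t.reverse) c.S) ∧ OK (fun z => ¬ P.AccW b z) c.S'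
  | .idle, c => c.i = [] ∧ c.t = [] ∧ c.e = 0 ∧ Tri c.pv c.d ∧ c.W = (fun _ => []) ∧
      OK (fun z => ¬ P.AccW b z) c.S ∧ OK (fun z => ¬ P.AccW b z) c.S'
  | .down t, c => c.i = [] ∧ c.t = [] ∧ c.e = 0 ∧ Tri c.pv (c.d + ssize c.W) ∧
      (∀ k, (P.fam t k).anch = true → c.W k = [] ∧ (c.S k).head? = some none) ∧
      OK (fun z => ¬ P.AccW b z) (cat (preS (P.fam t)) (cat (rev c.W) c.S)) ∧
      OK (fun z => ¬ P.AccW b z) c.S'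
  | .up t, c => c.i = [] ∧ c.t = [] ∧ c.e = 0 ∧ Tri c.pv (c.d + ssize c.W) ∧
      (∀ k, (P.fam t k).anch = true → c.W k = [] ∧ (c.S k).head? = some none) ∧
      OK (fun z => ¬ P.AccW b z) (cat (preS (P.fam t)) (cat (rev c.W) c.S)) ∧
      OK (fun z => ¬ P.AccW b z) (cat (postS (P.fam t)) (cat (rev c.W) c.S'))
  | .sh, c => c.i = [] ∧ c.t = [] ∧ c.e = 0 ∧ Tri c.pv c.d ∧
      OK (fun z => ¬ P.AccW b z) c.S ∧ OK (fun z => ¬ P.AccW b z) (cat (rev c.W) c.S')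
  | .sh', c => c.i = [] ∧ c.t = [] ∧ c.e = 0 ∧ Tri c.pv c.d ∧
      OK (fun z => ¬ P.AccW b z) (cat (rev c.W) c.S) ∧ OK (fun z => ¬ P.AccW b z) c.S'
  | .out, _ => False

end PebSim

namespace PebSim

open scoped Classical

variable {K : Type} {Γ : K → Type} {X : Type} (P : PRS K Γ X) [Fintype K]

theorem inv_step (b c₀ N : ℕ) (hc₀ : ∀ t, preLen (P.fam t) ≤ c₀)
    (hb : ∀ m, m ^ 2 ≤ (2 * c₀ ^ 2 + 4 * Fintype.card K + 8) * (N + 1) → m ≤ b) (r : BR P)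
    (s s' : Stk (BΓ Γ X)) (h : FRel ((rules P).fam r) s s')
    (hs : (ssize s + corr P ((rules P).src r) : ℤ) ≤ N + (Fintype.card K + 1)) :
    InvC P b ((rules P).src r) (Cfg.ofStk s) ↔ InvC P b ((rules P).dst r) (Cfg.ofStk s') := by
  have : Nonempty K := ⟨P.kst⟩
  obtain ⟨⟨i, t, pad, ru, pd, pv, d, e, W, S, S₂⟩, rfl⟩ := exists_cfg s
  obtain ⟨⟨i', t', pad', ru', pd', pv', d', e', W', S', S₂'⟩, rfl⟩ := exists_cfg s'
  rw [Cfg.ofStk_toStk, Cfg.ofStk_toStk]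
  rw [ssize_toStk] at hs
  cases r <;> simp only [rules, rule, frel_toFam, Pat.rel_idle, Pat.rel_pop, Pat.rel_push,
    Pat.rel_test, frel_idleFam, frel_testFam, frel_single_push, frel_single_pop, frel_sepPush,
    frel_sepPop, frel_sepPeek, frel_enter, frel_leave, frel_put, frel_take, urel_unary,
    urel_test, zero_le, true_and, add_zero] at h
  case grow =>
    obtain ⟨rfl, rfl, rfl, -, rfl, rfl, rfl, ⟨rfl, rfl⟩, rfl, rfl, rfl⟩ := h
    simp only [rules, rule, InvC, Tri, true_and, add_zero]
    refine and_congr_left fun _ => ?_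
    constructor <;> intro h <;> nlinarith
  case mb =>
    obtain ⟨rfl, rfl, -, rfl, rfl, rfl, ⟨hd, h1⟩, rfl, rfl, rfl, rfl⟩ := h
    obtain rfl : d = d' + 1 := by omega
    have : d' + 1 + e = d' + (e + 1) := by ring
    simp only [rules, rule, InvC, this]
    refine and_congr_left fun _ => ?_
    constructor <;> intro h <;> linarith
  case turn =>
    obtain ⟨rfl, rfl, rfl, rfl, rfl, rfl, ⟨rfl, rfl⟩, rfl, rfl, rfl, rfl⟩ := h
    simp only [rules, rule, InvC, Tri, zero_add]
    refine and_congr_left fun _ => ?_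
    constructor <;> intro h <;> linarith
  case mc =>
    obtain ⟨rfl, rfl, rfl, rfl, rfl, rfl, rfl, ⟨he, h1⟩, rfl, rfl, rfl⟩ := h
    obtain rfl : e = e' + 1 := by omega
    have : d + 1 + e' = d + (e' + 1) := by ring
    simp only [rules, rule, InvC, this]
  case done =>
    obtain ⟨rfl, rfl, rfl, rfl, rfl, rfl, rfl, ⟨rfl, rfl⟩, rfl, rfl, rfl⟩ := h
    simp [rules, rule, InvC]
  case load x =>
    obtain ⟨rfl, rfl, rfl, rfl, rfl, rfl, rfl, rfl, rfl, rfl, rfl⟩ := h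
    simp [rules, rule, InvC]
  case start =>
    obtain ⟨⟨rfl, rfl⟩, rfl, rfl, rfl, rfl, rfl, rfl, rfl, rfl, rfl, rfl⟩ := h
    simp [rules, rule, InvC, ok_cat_sep, and_assoc]
  case unload x =>
    obtain ⟨rfl, rfl, rfl, rfl, rfl, rfl, rfl, rfl, rfl, rfl, rfl⟩ := h
    simp [rules, rule, InvC, cat_load_snoc]
  case begin =>
    obtain ⟨rfl, ⟨rfl, rfl⟩, rfl, rfl, rfl, rfl, rfl, rfl, rfl, rfl, rfl⟩ := h
    simp [rules, rule, InvC, cat_load_nil]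
  case fin =>
    obtain ⟨rfl, rfl, rfl, rfl, rfl, rfl, rfl, rfl, rfl, rfl, rfl⟩ := h
    simp only [rules, rule, InvC, ok_cat_sep, iff_false]
    rintro ⟨-, -, -, -, -, ⟨h, -⟩, -⟩
    exact h (P.accW_acc (hb 1 (by nlinarith [Nat.zero_le (c₀ ^ 2)])))
  case sh =>
    obtain ⟨rfl, rfl, rfl, rfl, rfl, rfl, rfl, rfl, ⟨rfl, rfl⟩, rfl, rfl⟩ := h
    simp [rules, rule, InvC]
  case shEnd =>
    obtain ⟨rfl, rfl, rfl, rfl, rfl, rfl, rfl, rfl, ⟨rfl, rfl⟩, rfl, rfl⟩ := h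
    simp [rules, rule, InvC]
  case shMid =>
    obtain ⟨rfl, rfl, rfl, rfl, rfl, rfl, rfl, rfl, rfl, rfl, rfl⟩ := h
    simp only [rules, rule, InvC, ok_cat_sep]
    tauto
  case sl k y =>
    obtain ⟨rfl, rfl, rfl, rfl, rfl, rfl, rfl, rfl, rfl, rfl, rfl⟩ := h
    simp only [rules, rule, InvC, cat_rev_push]
  case sl' k y =>
    obtain ⟨rfl, rfl, rfl, rfl, rfl, rfl, rfl, rfl, rfl, rfl, rfl⟩ := h
    simp only [rules, rule, InvC, cat_rev_push]
  case down τ =>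
    obtain ⟨rfl, rfl, rfl, rfl, rfl, rfl, rfl, rfl, ⟨rfl, rfl⟩, ⟨rfl, h⟩, rfl⟩ := h
    simp only [rules, rule, InvC, rev_nil, cat_nil, ssize_nil, add_zero, true_and]
    have h2 : (∀ k, (P.fam τ k).anch = true → (S' k).head? = some none) ↔ True := iff_true_intro h
    rw [h2, true_and]
  case leave τ =>
    obtain ⟨rfl, rfl, rfl, rfl, -, rfl, rfl, rfl, ⟨rfl, rfl⟩, ⟨rfl, h⟩, rfl⟩ := h
    simp only [rules, rule, InvC, rev_nil, cat_nil, ssize_nil, add_zero, true_and]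
    have h2 : (∀ k, (P.fam τ k).anch = true → (S k).head? = some none) ↔ True := iff_true_intro h
    rw [h2, true_and]
  case dl τ k y =>
    obtain ⟨rfl, rfl, rfl, rfl, -, rfl, ⟨hd, h1⟩, rfl, rfl, rfl, rfl⟩ := h
    obtain rfl : d = d' + 1 := by omega
    have h2 : d' + 1 + ssize W = d' + (ssize W + 1) := by ring
    simp only [rules, rule, InvC, cat_rev_push, ssize_push, h2]
    refine and_congr_right fun _ => and_congr_right fun _ => and_congr_right fun _ =>
      and_congr_right fun _ => and_congr_left fun _ => forall_congr' fun j => ?_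
    by_cases hj : j = k
    · subst hj
      simp
    · simp [hj]
  case ul τ k y =>
    obtain ⟨rfl, rfl, rfl, rfl, -, rfl, rfl, rfl, rfl, rfl, rfl⟩ := h
    have h2 : d + 1 + ssize W' = d + (ssize W' + 1) := by ring
    simp only [rules, rule, InvC, cat_rev_push, ssize_push, h2]
    refine and_congr_right fun _ => and_congr_right fun _ => and_congr_right fun _ =>
      and_congr_right fun _ => and_congr_left fun _ => forall_congr' fun j => ?_
    by_cases hj : j = k
    · subst hj
      simp
    · simp [hj]
  case flip τ =>
    obtain ⟨rfl, rfl, rfl, rfl, rfl, rfl, rfl, rfl, rfl, ⟨rfl, S₀, rfl⟩, rfl⟩ := h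
    simp only [rules, rule, InvC, cat_cat, ok_cat_sep]
    refine and_congr_right fun _ => and_congr_right fun _ => and_congr_right fun _ =>
      and_congr_right fun h1 => and_congr_right fun h2 => ?_
    simp only [and_assoc]
    refine and_congr_right fun h3 => and_congr_right fun _ => ?_
    refine ⟨fun h4 => ⟨fun h5 => h3 ?_, h4⟩, fun h4 => h4.2⟩
    refine h5.head ⟨τ, frel_app fun k hk => ?_⟩ (hb _ ?_)
    · simp [rev, (h2 k hk).1]
    · simp only [rules, rule, corr] at hs
      have h6 : pv' ≤ N + (Fintype.card K + 1) := by omega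
      simp only [ssize_app, ssize_rev, ssize_preS]
      have h7 := hc₀ τ
      unfold Tri at h1
      have h8 : ssize W' ^ 2 ≤ 2 * pv' := by nlinarith
      have h9 : (preLen (P.fam τ) + ssize W') ^ 2 ≤ (c₀ + ssize W') ^ 2 := by gcongr
      have h10 : (c₀ + ssize W') ^ 2 ≤ 2 * c₀ ^ 2 + 2 * ssize W' ^ 2 := add_sq_le.trans (by linarith)
      nlinarith [Nat.zero_le (c₀ ^ 2 * N), Nat.zero_le (Fintype.card K * N)]

end PebSim

section StackInduction

open scoped Classical

variable {K : Type} {Γ : K → Type}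

theorem cat_push (a : Stk Γ) (σ : Stk (OΓ Γ)) (k : K) (y : Γ k) :
    cat (Function.update a k (y :: a k)) σ =
      Function.update (cat a σ) k (some y :: cat a σ k) := by
  funext j
  by_cases hj : j = k
  · subst hj
    simp [cat]
  · simp [cat, hj]

theorem app_rev_push (a w : Stk Γ) (k : K) (y : Γ k) :
    app (rev (Function.update a k (y :: a k))) w =
      app (rev a) (Function.update w k (y :: w k)) := by
  funext j
  by_cases hj : j = k
  · subst hj
    simp [app, rev]
  · simp [app, rev, hj]

theorem stk_induction [Fintype K] {motive : Stk Γ → Prop} (nil : motive fun _ => [])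
    (cons : ∀ a k y, motive a → motive (Function.update a k (y :: a k))) (a : Stk Γ) :
    motive a := by
  induction h : ssize a generalizing a with
  | zero =>
    rw [ssize_eq_zero.1 h]
    exact nil
  | succ n ih =>
    obtain ⟨k, y, l, hk⟩ : ∃ k y l, a k = y :: l := by
      by_contra! h2
      have : a = fun _ => [] := by
        funext k
        cases h3 : a k with
        | nil => rfl
        | cons y l => exact (h2 k y l h3).elim
      rw [ssize_eq_zero.2 this] at h
      cases h
    have h3 : a = Function.update (Function.update a k l) k (y :: Function.update a k l k) := by
      funext j
      by_cases hj : j = k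
      · subst hj
        simp [hk]
      · simp [hj]
    have h4 := ssize_push (Function.update a k l) k y
    rw [← h3, h] at h4
    rw [h3]
    exact cons _ k y (ih _ (by omega))

end StackInduction

namespace PebSim

open scoped Classical

variable {K : Type} {Γ : K → Type} {X : Type} (P : PRS K Γ X) [Fintype K]

/-- Connectedness by rules and their inverses. -/
def Cn (q : BQ P.ι) (c : Cfg Γ X) (q' : BQ P.ι) (c' : Cfg Γ X) : Prop :=
  (rules P).Conn (q, c.toStk) (q', c'.toStk)

variable {P}

theorem Cn.symm {q q' : BQ P.ι} {c c' : Cfg Γ X} (h : Cn P q c q' c') : Cn P q' c' q c :=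
  Rules.Conn.symm h

theorem Cn.trans {q q' q'' : BQ P.ι} {c c' c'' : Cfg Γ X} (h : Cn P q c q' c')
    (h' : Cn P q' c' q'' c'') : Cn P q c q'' c'' :=
  Relation.ReflTransGen.trans h h'

theorem Cn.refl (q : BQ P.ι) (c : Cfg Γ X) : Cn P q c q c := Relation.ReflTransGen.refl

theorem Cn.rule {c c' : Cfg Γ X} (r : BR P)
    (h : FRel (rule P r).2.2.toFam c.toStk c'.toStk) :
    Cn P (PebSim.rule P r).1 c (PebSim.rule P r).2.1 c' :=
  .single ⟨r, .inl ⟨rfl, rfl, h⟩⟩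

variable {i t : List X} {pad ru pv : ℕ}

theorem cn_down (τ : P.ι) (a w : Stk Γ) (σ S' : Stk (OΓ Γ)) (pd d : ℕ) :
    Cn P (.down τ) ⟨i, t, pad, ru, pd, pv, d + ssize a, 0, w, cat a σ, S'⟩
      (.down τ) ⟨i, t, pad, ru, pd + ssize a, pv, d, 0, app (rev a) w, σ, S'⟩ := by
  induction a using stk_induction generalizing w pd with
  | nil => simpa using Cn.refl _ _
  | cons a k y ih =>
    rw [ssize_push, cat_push, app_rev_push]
    refine (Cn.rule (.dl τ k y) ?_).trans (?_ : Cn P (.down τ)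
      ⟨i, t, pad, ru, pd + 1, pv, d + ssize a, 0, Function.update w k (y :: w k), cat a σ, S'⟩ _ _)
    · simp [rule, frel_toFam, frel_idleFam, frel_single_push, frel_single_pop]
      omega
    · rw [show pd + (ssize a + 1) = pd + 1 + ssize a by ring]
      exact ih _ _

theorem cn_up (τ : P.ι) (a w : Stk Γ) (σ σ' : Stk (OΓ Γ)) (pd d : ℕ) :
    Cn P (.up τ) ⟨i, t, pad, ru, pd, pv, d + ssize a, 0, w, cat a σ, cat a σ'⟩
      (.up τ) ⟨i, t, pad, ru, pd + 2 * ssize a, pv, d, 0, app (rev a) w, σ, σ'⟩ := by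
  induction a using stk_induction generalizing w pd with
  | nil => simpa using Cn.refl _ _
  | cons a k y ih =>
    rw [ssize_push, cat_push, cat_push, app_rev_push]
    refine (Cn.rule (c := ⟨i, t, pad, ru, pd + 2, pv, d + ssize a, 0,
      Function.update w k (y :: w k), cat a σ, cat a σ'⟩) (.ul τ k y) ?_).symm.trans
        (?_ : Cn P (.up τ) _ _ _)
    · simp [rule, frel_toFam, frel_single_push, frel_single_pop]
      omega
    · rw [show pd + 2 * (ssize a + 1) = pd + 2 + 2 * ssize a by ring]
      exact ih _ _

theorem cn_sh (a w : Stk Γ) (σ σ' : Stk (OΓ Γ)) (pd d : ℕ) :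
    Cn P .sh ⟨i, t, pad, ru, pd, pv, d, 0, w, σ, cat a σ'⟩
      .sh ⟨i, t, pad, ru, pd, pv, d, 0, app (rev a) w, σ, σ'⟩ := by
  induction a using stk_induction generalizing w with
  | nil => simpa using Cn.refl _ _
  | cons a k y ih =>
    rw [cat_push, app_rev_push]
    refine (Cn.rule (.sl k y) ?_).trans (ih _ : Cn P .sh _ _ _)
    simp [rule, frel_toFam, frel_idleFam, frel_single_push, frel_single_pop]

theorem cn_sh' (a w : Stk Γ) (σ σ' : Stk (OΓ Γ)) (pd d : ℕ) :
    Cn P .sh' ⟨i, t, pad, ru, pd, pv, d, 0, w, cat a σ, σ'⟩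
      .sh' ⟨i, t, pad, ru, pd, pv, d, 0, app (rev a) w, σ, σ'⟩ := by
  induction a using stk_induction generalizing w with
  | nil => simpa using Cn.refl _ _
  | cons a k y ih =>
    rw [cat_push, app_rev_push]
    refine (Cn.rule (c' := ⟨i, t, pad, ru, pd, pv, d, 0, w, Function.update (cat a σ) k _, σ'⟩)
      (.sl' k y) ?_).symm.trans (ih _ : Cn P .sh' _ _ _)
    simp [rule, frel_toFam, frel_idleFam, frel_single_push, frel_single_pop]

/-- The contents representing two lists. -/
def lst (pad ru pv d pd : ℕ) (l l' : List (Stk Γ)) : Cfg Γ X :=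
  ⟨[], [], pad, ru, pd, pv, d, 0, fun _ => [], encS l, encS l'⟩

variable {d : ℕ}

theorem cn_insert {τ : P.ι} {x y : Stk Γ} (h : FRel (P.fam τ) x y) (hx : ssize x ≤ d) (m : ℕ)
    (l l' : List (Stk Γ)) :
    Cn P .idle (lst pad ru pv d (m + Fintype.card K + ssize y) (x :: l) l')
      .idle (lst pad ru pv d m (x :: l) (y :: l')) := by
  obtain ⟨a, h1, rfl, rfl⟩ := h.exists_app
  simp only [ssize_app, ssize_postS, ssize_preS] at hx ⊢
  have h2 : ∀ k, (P.fam τ k).anch = true → (cat a (sep (encS l)) k).head? = some none := by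
    intro k hk
    simp [cat, sep, h1 k hk]
  have e1 : d = d - ssize a + ssize a := by omega
  have e2 : m + Fintype.card K + (postLen (P.fam τ) + ssize a) + ssize a =
      m + Fintype.card K + postLen (P.fam τ) + 2 * ssize a := by ring
  have s1 : Cn P .idle (lst pad ru pv d (m + Fintype.card K + (postLen (P.fam τ) + ssize a))
      (app (preS (P.fam τ)) a :: l) l') (.down τ)
      ⟨[], [], pad, ru, m + Fintype.card K + (postLen (P.fam τ) + ssize a), pv, d, 0,
        fun _ => [], cat a (sep (encS l)), encS l'⟩ := by
    refine Cn.rule (.down τ) ?_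
    simp [rule, frel_toFam, lst, frel_idleFam, frel_testFam, frel_enter, encS, cat_cat]
    exact h2
  have s2 := cn_down (i := []) (t := []) (pad := pad) (ru := ru) (pv := pv) τ a (fun _ => [])
    (sep (encS l)) (encS l') (m + Fintype.card K + (postLen (P.fam τ) + ssize a)) (d - ssize a)
  rw [← e1] at s2
  have s3 : Cn P (.down τ) ⟨[], [], pad, ru,
      m + Fintype.card K + (postLen (P.fam τ) + ssize a) + ssize a, pv, d - ssize a, 0,
        app (rev a) fun _ => [], sep (encS l), encS l'⟩ (.up τ) ⟨[], [], pad, ru,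
      m + Fintype.card K + postLen (P.fam τ) + 2 * ssize a, pv, d - ssize a, 0,
        app (rev a) fun _ => [], sep (encS l), sep (encS l')⟩ := by
    rw [e2]
    refine Cn.rule (.flip τ) ?_
    simp [rule, frel_toFam, frel_idleFam, frel_sepPeek, frel_sepPush]
  have s4 := cn_up (i := []) (t := []) (pad := pad) (ru := ru) (pv := pv) τ a (fun _ => [])
    (sep (encS l)) (sep (encS l')) (m + Fintype.card K + postLen (P.fam τ)) (d - ssize a)
  rw [← e1] at s4
  have s5 : Cn P (.up τ) ⟨[], [], pad, ru, m + Fintype.card K + postLen (P.fam τ), pv, d, 0,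
        fun _ => [], cat a (sep (encS l)), cat a (sep (encS l'))⟩ .idle
      (lst pad ru pv d m (app (preS (P.fam τ)) a :: l) (app (postS (P.fam τ)) a :: l')) := by
    refine Cn.rule (.leave τ) ?_
    simp [rule, frel_toFam, lst, frel_testFam, frel_leave, frel_put, encS, cat_cat]
    exact ⟨by omega, h2⟩
  exact s1.trans (s2.trans (s3.trans (s4.symm.trans s5)))

theorem cn_shift (m : ℕ) (z : Stk Γ) (l l' : List (Stk Γ)) :
    Cn P .idle (lst pad ru pv d m l (z :: l')) .idle (lst pad ru pv d m (z :: l) l') := by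
  have s1 : Cn P .idle (lst pad ru pv d m l (z :: l')) .sh (lst pad ru pv d m l (z :: l')) := by
    refine Cn.rule .sh ?_
    simp [rule, frel_toFam, lst, frel_idleFam, frel_testFam]
  have s2 := cn_sh (P := P) (i := []) (t := []) (pad := pad) (ru := ru) (pv := pv) z (fun _ => [])
    (encS l) (sep (encS l')) m d
  have s3 : Cn P .sh ⟨[], [], pad, ru, m, pv, d, 0, app (rev z) fun _ => [], encS l,
      sep (encS l')⟩ .sh' ⟨[], [], pad, ru, m, pv, d, 0, app (rev z) fun _ => [], sep (encS l),
      encS l'⟩ := by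
    refine Cn.rule .shMid ?_
    simp [rule, frel_toFam, frel_idleFam, frel_sepPop, frel_sepPush]
  have s4 := cn_sh' (P := P) (i := []) (t := []) (pad := pad) (ru := ru) (pv := pv) z
    (fun _ => []) (sep (encS l)) (encS l') m d
  have s5 : Cn P .sh' (lst pad ru pv d m (z :: l) l') .idle (lst pad ru pv d m (z :: l) l') := by
    refine Cn.rule .shEnd ?_
    simp [rule, frel_toFam, lst, frel_idleFam, frel_testFam]
  exact s1.trans (s2.trans (s3.trans (s4.symm.trans s5)))

/-- Reachability with a number of steps that is at most exponential in `n`. -/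
def Reach (P : PRS K Γ X) (s : ℕ) : ℕ → Stk Γ → Stk Γ → Prop
  | 0, x, y => P.StepW s x y
  | n + 1, x, y => Reach P s n x y ∨ ∃ z, Reach P s n x z ∧ Reach P s n z y

theorem Reach.size_le {s n : ℕ} {x y : Stk Γ} (h : Reach P s n x y) :
    ssize x ≤ s ∧ ssize y ≤ s := by
  induction n generalizing x y with
  | zero => exact h.2
  | succ n ih =>
    rcases h with h | ⟨z, h, h'⟩
    · exact ih h
    · exact ⟨(ih h).1, (ih h').2⟩

theorem cn_reach {n : ℕ} {x y : Stk Γ} (h : Reach P d n x y) (m : ℕ)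
    (hm : n * (d + Fintype.card K) ≤ m) (l l' : List (Stk Γ)) :
    Cn P .idle (lst pad ru pv d (m + Fintype.card K + ssize y) (x :: l) l')
      .idle (lst pad ru pv d m (x :: l) (y :: l')) := by
  induction n generalizing x y m l l' with
  | zero =>
    obtain ⟨⟨τ, h⟩, h2, -⟩ := h
    exact cn_insert h h2 m l l'
  | succ n ih =>
    rw [Nat.succ_mul] at hm
    rcases h with h | ⟨z, h, h'⟩
    · exact ih h m (by omega) l l'
    · have hz := h.size_le.2
      obtain ⟨m', rfl⟩ : ∃ m', m = m' + Fintype.card K + ssize z :=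
        ⟨m - Fintype.card K - ssize z, by omega⟩
      have s1 := ih h (m' + Fintype.card K + ssize y) (by omega) l l'
      have e : m' + Fintype.card K + ssize z + Fintype.card K + ssize y =
        m' + Fintype.card K + ssize y + Fintype.card K + ssize z := by ring
      rw [e]
      exact s1.trans ((cn_shift _ z _ _).trans ((ih h' m' (by omega) (x :: l) l').trans
        ((cn_shift _ z _ _).symm.trans (ih h m' (by omega) l (y :: l')).symm)))

end PebSim

section Paths

theorem exists_short_path {A : Type} {r : A → A → Prop} {x y : A}
    (h : Relation.ReflTransGen r x y) : ∃ (n : ℕ) (f : ℕ → A), f 0 = x ∧ f n = y ∧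
      (∀ i < n, r (f i) (f (i + 1))) ∧ ∀ i j, i < j → j ≤ n → f i ≠ f j := by
  classical
  have hex : ∃ (n : ℕ) (f : ℕ → A), f 0 = x ∧ f n = y ∧ ∀ i < n, r (f i) (f (i + 1)) := by
    induction h using Relation.ReflTransGen.head_induction_on with
    | refl => exact ⟨0, fun _ => y, rfl, rfl, by simp⟩
    | @head x z h _ ih =>
      obtain ⟨n, f, h1, h2, h3⟩ := ih
      refine ⟨n + 1, fun i => Nat.casesOn i x f, rfl, h2, ?_⟩
      rintro (_ | i) hi
      · simpa [h1] using h
      · exact h3 i (by omega)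
  obtain ⟨f, h1, h2, h3⟩ := Nat.find_spec hex
  refine ⟨Nat.find hex, f, h1, h2, h3, fun i j hij hj he => ?_⟩
  have hm := Nat.find_min hex (m := Nat.find hex - (j - i)) (by omega)
  refine hm ⟨fun m => if m ≤ i then f m else f (m + (j - i)), by simp [h1], ?_, fun m hm => ?_⟩
  · beta_reduce
    split_ifs with h
    · rw [show Nat.find hex - (j - i) = i by omega, he, ← h2]
      congr 1
      omega
    · exact (congrArg f (by omega)).trans h2
  · beta_reduce
    rcases lt_trichotomy m i with h | rfl | h
    · rw [if_pos h.le, if_pos (by omega)]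
      exact h3 m (by omega)
    · rw [if_pos le_rfl, if_neg (by omega), he, show m + 1 + (j - m) = j + 1 by omega]
      exact h3 j (by omega)
    · rw [if_neg (by omega), if_neg (by omega), show m + 1 + (j - i) = m + (j - i) + 1 by omega]
      exact h3 _ (by omega)

variable {K : Type} {Γ : K → Type} [Fintype K]

/-- Small contents are determined by finitely many letters. -/
def code (s : ℕ) (z : Stk Γ) : ∀ k, Fin s → Option (Γ k) := fun k i => (z k)[(i : ℕ)]?

theorem code_inj {s : ℕ} {z w : Stk Γ} (hz : ssize z ≤ s) (hw : ssize w ≤ s)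
    (h : code s z = code s w) : z = w := by
  funext k
  have h1 := length_le_ssize z k
  have h2 := length_le_ssize w k
  refine List.ext_getElem? fun i => ?_
  by_cases hi : i < s
  · exact congrFun (congrFun h k) ⟨i, hi⟩
  · rw [List.getElem?_eq_none (by omega), List.getElem?_eq_none (by omega)]

/-- A number of letters sufficient for a binary code of a letter in every alphabet. -/
noncomputable def codeLen (Γ : K → Type) : ℕ := ∑ k, Nat.card (Option (Γ k))

open scoped Classical in
theorem card_code_le [∀ k, Finite (Γ k)] (s : ℕ) :
    Nat.card (∀ k, Fin s → Option (Γ k)) ≤ 2 ^ (codeLen Γ * s) := by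
  have := fun k => Fintype.ofFinite (Γ k)
  rw [Nat.card_pi, codeLen, pow_mul, ← Finset.prod_pow_eq_pow_sum, ← Finset.prod_pow]
  refine Finset.prod_le_prod' fun k _ => ?_
  rw [Nat.card_fun, Nat.card_fin]
  exact Nat.pow_le_pow_left Nat.lt_two_pow_self.le _

end Paths

namespace PebSim

open scoped Classical

variable {K : Type} {Γ : K → Type} {X : Type} {P : PRS K Γ X} [Fintype K]

theorem reach_of_path {s : ℕ} {f : ℕ → Stk Γ} (n : ℕ) : ∀ i m, 1 ≤ m → m ≤ 2 ^ n →
    (∀ j, i ≤ j → j < i + m → P.StepW s (f j) (f (j + 1))) → Reach P s n (f i) (f (i + m)) := by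
  induction n with
  | zero =>
    intro i m h1 h2 h
    obtain rfl : m = 1 := by omega
    exact h i le_rfl (by omega)
  | succ n ih =>
    intro i m h1 h2 h
    rw [pow_succ] at h2
    by_cases h3 : m ≤ 2 ^ n
    · exact .inl (ih i m h1 h3 h)
    · have h4 := Nat.one_le_two_pow (n := n)
      refine .inr ⟨_, ih i (2 ^ n) h4 le_rfl fun j hj hj' => h j hj (by omega), ?_⟩
      have h5 := ih (i + 2 ^ n) (m - 2 ^ n) (by omega) (by omega)
        fun j hj hj' => h j (by omega) (by omega)
      rwa [show i + 2 ^ n + (m - 2 ^ n) = i + m by omega] at h5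

theorem eq_or_reach [∀ k, Finite (Γ k)] {s : ℕ} {x y : Stk Γ}
    (h : Relation.ReflTransGen (P.StepW s) x y) : x = y ∨ Reach P s (codeLen Γ * s) x y := by
  obtain ⟨n, f, rfl, rfl, h1, h2⟩ := exists_short_path h
  rcases Nat.eq_zero_or_pos n with rfl | hn
  · exact .inl rfl
  right
  have hsz : ∀ i ≤ n, ssize (f i) ≤ s := by
    intro i hi
    rcases Nat.eq_zero_or_pos i with rfl | h3
    · exact (h1 0 hn).2.1
    · have h4 := (h1 (i - 1) (by omega)).2.2
      rwa [Nat.sub_add_cancel h3] at h4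
  have hinj : Function.Injective fun i : Fin (n + 1) => code s (f i) := by
    intro i j hij
    by_contra hne
    have h3 := code_inj (hsz i (by omega)) (hsz j (by omega)) hij
    rcases lt_or_gt_of_ne hne with h4 | h4
    · exact h2 i j h4 (by omega) h3
    · exact h2 j i h4 (by omega) h3.symm
  have h3 := (Nat.card_le_card_of_injective _ hinj).trans (card_code_le s)
  rw [Nat.card_fin] at h3
  have h4 := reach_of_path (P := P) (codeLen Γ * s) 0 n hn (by omega) fun j _ hj => h1 j (by omega)
  rwa [zero_add] at h4

/-- The triangular numbers. -/
def tri (n : ℕ) : ℕ := ∑ i ∈ Finset.range (n + 1), i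

theorem tri_succ (n : ℕ) : tri (n + 1) = tri n + (n + 1) := Finset.sum_range_succ _ _

theorem tri_le (n : ℕ) : tri n ≤ n ^ 2 := by
  induction n with
  | zero => simp [tri]
  | succ n ih =>
    rw [tri_succ]
    nlinarith

variable {i t : List X} {W : Stk Γ} {S S' : Stk (OΓ Γ)}

theorem cn_mb (m pad ru pd pv d e : ℕ) :
    Cn P .mb ⟨i, t, pad + m, ru, pd, pv, d + m, e, W, S, S'⟩
      .mb ⟨i, t, pad, ru, pd, pv + m, d, e + m, W, S, S'⟩ := by
  induction m generalizing pv e with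
  | zero => exact Cn.refl _ _
  | succ m ih =>
    refine (Cn.rule (c' := ⟨i, t, pad + m, ru, pd, pv + 1, d + m, e + 1, W, S, S'⟩) .mb ?_).trans
      (?_ : Cn P .mb _ _ _)
    · simp [rule, frel_toFam, frel_idleFam]
      omega
    · rw [show pv + (m + 1) = pv + 1 + m by ring, show e + (m + 1) = e + 1 + m by ring]
      exact ih _ _

theorem cn_mc (m pad ru pd pv d e : ℕ) :
    Cn P .mc ⟨i, t, pad, ru, pd, pv, d, e + m, W, S, S'⟩
      .mc ⟨i, t, pad, ru, pd, pv, d + m, e, W, S, S'⟩ := by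
  induction m generalizing d with
  | zero => exact Cn.refl _ _
  | succ m ih =>
    refine (Cn.rule (c' := ⟨i, t, pad, ru, pd, pv, d + 1, e + m, W, S, S'⟩) .mc ?_).trans
      (?_ : Cn P .mc _ _ _)
    · simp [rule, frel_toFam, frel_idleFam]
      omega
    · rw [show d + (m + 1) = d + 1 + m by ring]
      exact ih _

theorem cn_prep (m pad ru pd : ℕ) :
    Cn P .prep ⟨i, t, pad + tri m, ru + m, pd, 0, 0, 0, W, S, S'⟩
      .prep ⟨i, t, pad, ru, pd, tri m, m, 0, W, S, S'⟩ := by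
  induction m generalizing pad ru with
  | zero => exact Cn.refl _ _
  | succ m ih =>
    rw [tri_succ, show pad + (tri m + (m + 1)) = pad + (m + 1) + tri m by ring,
      show ru + (m + 1) = ru + 1 + m by ring]
    refine (ih _ _).trans ?_
    have s1 : Cn P .prep ⟨i, t, pad + (m + 1), ru + 1, pd, tri m, m, 0, W, S, S'⟩
        .mb ⟨i, t, pad + (m + 1), ru, pd, tri m, 0 + (m + 1), 0, W, S, S'⟩ := by
      refine Cn.rule .grow ?_
      simp [rule, frel_toFam, frel_idleFam]
    have s2 := cn_mb (P := P) (i := i) (t := t) (W := W) (S := S) (S' := S') (m + 1) pad ru pd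
      (tri m) 0 0
    have s3 : Cn P .mb ⟨i, t, pad, ru, pd, tri m + (m + 1), 0, 0 + (m + 1), W, S, S'⟩
        .mc ⟨i, t, pad, ru, pd, tri m + (m + 1), 0, 0 + (m + 1), W, S, S'⟩ := by
      refine Cn.rule .turn ?_
      simp [rule, frel_toFam, frel_idleFam]
    have s4 := cn_mc (P := P) (i := i) (t := t) (W := W) (S := S) (S' := S') (m + 1) pad ru pd
      (tri m + (m + 1)) 0 0
    have s5 : Cn P .mc ⟨i, t, pad, ru, pd, tri m + (m + 1), 0 + (m + 1), 0, W, S, S'⟩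
        .prep ⟨i, t, pad, ru, pd, tri m + (m + 1), m + 1, 0, W, S, S'⟩ := by
      refine Cn.rule .done ?_
      simp [rule, frel_toFam, frel_idleFam]
    exact s1.trans (s2.trans (s3.trans (s4.trans s5)))

variable {pad ru pd pv d e : ℕ}

theorem cn_load (w v : List X) :
    Cn P .prep ⟨w, v, pad, ru, pd, pv, d, e, W, S, S'⟩
      .prep ⟨[], w.reverse ++ v, pad, ru, pd, pv, d, e, W, S, S'⟩ := by
  induction w generalizing v with
  | nil => exact Cn.refl _ _
  | cons x w ih =>
    refine (Cn.rule (c' := ⟨w, x :: v, pad, ru, pd, pv, d, e, W, S, S'⟩) (.load x) ?_).trans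
      (?_ : Cn P .prep _ _ _)
    · simp [rule, frel_toFam, frel_idleFam]
    · simpa using ih (x :: v)

theorem cn_unload (w : List X) :
    Cn P .tr ⟨[], w, pad, ru, pd, pv, d, e, W, S, S'⟩
      .idle ⟨[], [], pad, ru, pd, pv, d, e, W, cat (P.load w.reverse) S, S'⟩ := by
  induction w generalizing S with
  | nil =>
    refine Cn.rule .begin ?_
    simp [rule, frel_toFam, frel_idleFam, frel_single_push, cat_load_nil]
  | cons x w ih =>
    rw [List.reverse_cons, cat_load_snoc]
    refine (Cn.rule (c' := ⟨[], w, pad, ru, pd, pv, d, e, W,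
      Function.update S P.kin (some (P.emb x) :: S P.kin), S'⟩) (.unload x) ?_).trans ih
    simp [rule, frel_toFam, frel_idleFam, frel_single_push]

theorem cn_fin (l l' : List (Stk Γ)) :
    Cn P .idle (lst pad ru pv d pd (P.acc :: l) l') .out (lst pad ru pv d pd l l') := by
  refine Cn.rule .fin ?_
  simp [rule, frel_toFam, lst, frel_idleFam, frel_take, encS]

theorem cn_accept [∀ k, Finite (Γ k)] {x : Stk Γ}
    (h : Relation.ReflTransGen (P.StepW d) x P.acc) :
    ∃ c', Cn P .idle (lst pad ru pv d
      (codeLen Γ * d * (d + Fintype.card K) + Fintype.card K + 1) [x] []) .out c' := by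
  rcases eq_or_reach h with rfl | h
  · exact ⟨_, cn_fin _ _⟩
  · have s1 := cn_reach (pad := pad) (ru := ru) (pv := pv) h _ le_rfl [] []
    rw [PRS.ssize_acc] at s1
    exact ⟨_, s1.trans ((cn_shift _ _ _ _).trans (cn_fin _ _))⟩

theorem cn_run [∀ k, Finite (Γ k)] {u : List X}
    (h : Relation.ReflTransGen (P.StepW d) (P.start u) P.acc) :
    ∃ c', Cn P .prep ⟨u.reverse, [], tri d, d,
      codeLen Γ * d * (d + Fintype.card K) + Fintype.card K + 1, 0, 0, 0,
        fun _ => [], fun _ => [], fun _ => []⟩ .out c' := by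
  set p := codeLen Γ * d * (d + Fintype.card K) + Fintype.card K + 1 with hp
  obtain ⟨c', s5⟩ := cn_accept (pad := 0) (ru := 0) (pv := tri d) h
  have s1 := cn_prep (P := P) (i := u.reverse) (t := []) (W := fun _ => []) (S := fun _ => [])
    (S' := fun _ => []) d 0 0 p
  have s2 := cn_load (P := P) (pad := 0) (ru := 0) (pd := p) (pv := tri d) (d := d) (e := 0)
    (W := fun _ => []) (S := fun _ => []) (S' := fun _ => []) u.reverse []
  simp only [zero_add, List.reverse_reverse, List.append_nil] at s1 s2
  have s3 : Cn P .prep ⟨[], u, 0, 0, p, tri d, d, 0, fun _ => [], fun _ => [], fun _ => []⟩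
      .tr ⟨[], u, 0, 0, p, tri d, d, 0, fun _ => [], sep fun _ => [], fun _ => []⟩ := by
    refine Cn.rule .start ?_
    simp [rule, frel_toFam, frel_idleFam, frel_sepPush]
  have s4 := cn_unload (P := P) (pad := 0) (ru := 0) (pd := p) (pv := tri d) (d := d) (e := 0)
    (W := fun _ => []) (S := sep fun _ => []) (S' := fun _ => []) u
  exact ⟨c', s1.trans (s2.trans (s3.trans (s4.trans s5)))⟩

/-- The simulation of a nondeterministic machine. -/
theorem exists_sim {T X : Type} [Fintype T] (M : TM T X) [Finite M.prs.ι]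
    [∀ k, Finite (M.PAlph k)] :
    Nonempty (Sim (rules M.prs) (fun u s => M.AcceptsWithin (M.inputConf u) s) (· ^ 2)) := by
  obtain ⟨c₀, hc₀⟩ : ∃ c₀, ∀ t, preLen (M.prs.fam t) ≤ c₀ := by
    obtain ⟨c, hc⟩ := (Set.finite_range fun t => preLen (M.prs.fam t)).bddAbove
    exact ⟨c, fun t => hc ⟨t, rfl⟩⟩
  set k := Fintype.card (Option (T × Bool)) with hk
  set C₁ := 2 * c₀ ^ 2 + 4 * k + 8 with hC₁
  set C := C₁ + 2 * codeLen M.PAlph * (1 + k) + k + 7 with hC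
  refine ⟨Sim.ofInv .inp id Function.injective_id Function.surjective_id
    (fun k => match k with
      | .pad => true
      | .ru => true
      | .pd => true
      | _ => false) rfl .prep .out (corr M.prs) C
    (fun N q s => InvC M.prs (Nat.sqrt (C * (N + 1)) + 1) q (Cfg.ofStk s)) (net M.prs)
    ?_ ?_ ?_ ?_⟩
  · intro N u s hs _
    obtain ⟨h1, h2⟩ := hs
    have h1 : s .inp = u.reverse := by simpa using h1
    have e1 : s .tmp = [] := h2 .tmp (by simp) rfl
    have e2 : s .pv = [] := h2 .pv (by simp) rfl
    have e3 : s .d = [] := h2 .d (by simp) rfl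
    have e4 : s .e = [] := h2 .e (by simp) rfl
    have e5 : ∀ k, s (.W k) = [] := fun k => h2 (.W k) (by simp) rfl
    have e6 : ∀ k, s (.S k) = [] := fun k => h2 (.S k) (by simp) rfl
    have e7 : ∀ k, s (.S' k) = [] := fun k => h2 (.S' k) (by simp) rfl
    have e8 : M.prs.load u.reverse = M.prs.start u := rfl
    simp only [InvC, Cfg.ofStk, h1, e1, e2, e3, e4, e5, e6, e7, Tri, List.length_nil, true_and,
      List.reverse_nil, List.nil_append, ok_nil, and_true, e8, M.accW_start]
    simp only [ne_eq, OfNat.ofNat_ne_zero, not_false_eq_true, zero_pow, mul_zero, add_zero,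
      true_and]
    refine not_congr ⟨fun h => ⟨_, h, ?_⟩, ?_⟩
    · simpa [pow_two] using Nat.sqrt_le (C * (N + 1))
    · rintro ⟨t, h, ht⟩
      exact h.mono (Nat.le_sqrt'.2 ht)
  · intro N r s s' h h1 _
    refine inv_step M.prs _ c₀ N hc₀ (fun m hm => ?_) r s s' h h1
    refine (Nat.le_sqrt'.2 (hm.trans ?_)).trans (Nat.le_succ _)
    exact Nat.mul_le_mul_right _ (by omega)
  · exact fun N s h => h
  · intro u t h
    rw [← M.accW_start] at h
    obtain ⟨h1, h2⟩ := h
    obtain ⟨c', hc'⟩ := cn_run h2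
    refine ⟨_, _, ⟨by simp [Cfg.toStk], ?_⟩, ?_, hc'⟩
    · rintro (_ | _ | _ | _ | _ | _ | _ | _ | k | k | k) h5 h6 <;>
        first | rfl | exact (h5 rfl).elim | cases h6
    · have h5 : u.length ≤ ssize (M.prs.start u) := by
        have := length_le_ssize (M.prs.start u) M.prs.kin
        simpa [PRS.start] using this
      rw [ssize_toStk]
      simp only [ssize_nil, List.length_reverse, List.length_nil, add_zero, ← hk]
      have h6 := tri_le (t + 1)
      set b := codeLen M.PAlph with hb
      have h7 : (t + 1) ^ 2 ≤ 2 * (t ^ 2 + 1) := by nlinarith [sq_nonneg ((t : ℤ) - 1)]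
      have h8 : t + 1 ≤ (t + 1) ^ 2 := by nlinarith
      have h9 : b * (t + 1) * (t + 1 + k) ≤ b * (1 + k) * (t + 1) ^ 2 := by
        have : t + 1 + k ≤ (1 + k) * (t + 1) := by nlinarith
        calc b * (t + 1) * (t + 1 + k) ≤ b * (t + 1) * ((1 + k) * (t + 1)) := by gcongr
          _ = _ := by ring
      have h10 : b * (1 + k) * (t + 1) ^ 2 ≤ b * (1 + k) * (2 * (t ^ 2 + 1)) := by gcongr
      have h11 : C * (t ^ 2 + 1) = C₁ * (t ^ 2 + 1) + b * (1 + k) * (2 * (t ^ 2 + 1)) +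
        (k + 7) * (t ^ 2 + 1) := by
        rw [hC]
        ring
      rw [h11]
      have h12 : k + 1 ≤ (k + 1) * (t ^ 2 + 1) := Nat.le_mul_of_pos_right _ (by positivity)
      have h13 : (k + 7) * (t ^ 2 + 1) = (k + 1) * (t ^ 2 + 1) + 6 * (t ^ 2 + 1) := by ring
      omega

end PebSim

theorem finite_PAlph {T X : Type} [Finite T] (M : TM T X) (k : Option (T × Bool)) :
    Finite (M.PAlph k) := by
  cases k with
  | none =>
    have := M.finQ
    exact inferInstanceAs (Finite (∀ i, M.Q i))
  | some p => exact M.finY p.1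

theorem exists_symmetric_of_deterministic {T X : Type} (M : TM T X) (hdet : M.Deterministic) :
    ∃ (T' : Type) (M' : TM T' X), M'.lang = M.lang ∧ M'.SymmetricTM ∧
      FEquiv M'.spaceFun M.spaceFun ∧ FEquiv M'.genSpaceFun M.spaceFun ∧
      ∀ t, M'.cmdLetters t ≤ 1 := by
  have := M.finT
  have := M.finX
  have : Finite M.prs.ι := M.finι
  have := finite_PAlph M
  have : ∀ k, Finite (DetSim.AΓ M.PAlph X k) := by
    rintro (_ | _ | _ | k) <;> dsimp only [DetSim.AΓ] <;> infer_instance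
  exact (DetSim.sim M hdet).exists_machine monotone_id rfl fun _ => le_rfl

theorem exists_symmetric_of_nondeterministic {T X : Type} (M : TM T X) :
    ∃ (T' : Type) (M' : TM T' X), M'.lang = M.lang ∧ M'.SymmetricTM ∧
      FEquiv M'.spaceFun (fun n => M.spaceFun n ^ 2) ∧
      FEquiv M'.genSpaceFun (fun n => M.spaceFun n ^ 2) ∧
      ∀ t, M'.cmdLetters t ≤ 1 := by
  have := M.finT
  have := M.finX
  have : Finite M.prs.ι := M.finι
  have := finite_PAlph M
  have : ∀ k, Finite (PebSim.BΓ M.PAlph X k) := by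
    intro k
    cases k <;> dsimp only [PebSim.BΓ] <;> infer_instance
  obtain ⟨S⟩ := PebSim.exists_sim M
  exact S.exists_machine (fun _ _ h => Nat.pow_le_pow_left h 2) rfl
    fun n => Nat.le_self_pow two_ne_zero n

/-- Lemma 2.4. (a) For every deterministic machine `M` with
space function `S(n)` there is a symmetric nondeterministic machine `M'`
recognizing the same language, whose space and generalized space functions are
equivalent to `S(n)`, and each of whose commands involves at most one tape
letter. (b) Likewise for every nondeterministic `M` with fully
space-constructible space function `f`, with `f(n)²` in place of `S(n)`. -/
theorem symmetric_machine_with_controlled_space_exists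
    {T X : Type} (M : TM T X) :
    (M.Deterministic →
      ∃ (T' : Type) (M' : TM T' X),
        M'.lang = M.lang ∧ M'.SymmetricTM ∧
        FEquiv M'.spaceFun M.spaceFun ∧ FEquiv M'.genSpaceFun M.spaceFun ∧
        ∀ t, M'.cmdLetters t ≤ 1) ∧
    (FSC M.spaceFun →
      ∃ (T' : Type) (M' : TM T' X),
        M'.lang = M.lang ∧ M'.SymmetricTM ∧
        FEquiv M'.spaceFun (fun n => M.spaceFun n ^ 2) ∧
        FEquiv M'.genSpaceFun (fun n => M.spaceFun n ^ 2) ∧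
        ∀ t, M'.cmdLetters t ≤ 1) := by
  exact ⟨exists_symmetric_of_deterministic M, fun _ => exists_symmetric_of_nondeterministic M⟩

end Olsh
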